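/- arXiv:2303.10919 — 4 statements merged into one kernel-verified Lean document; each statement's English description precedes it below -/
import Mathlib

section
/- For integers n_1 < n_2 < ... < n_N and complex numbers a_1, ..., a_N, the integral over [-1/2, 1/2] of |∑_{k=1}^N a_k e^{2πi n_k t}| dt is at least (1/30) ∑_{k=1}^N |a_k|/k. -/
open MeasureTheory intervalIntegral

theorem norm_sum_mul_exp_le (x y : ℕ → ℂ) (hx : ∀ j, ‖x j‖ ≤ 1)
    (hxy : ∀ j, ‖x j‖ ≤ (y j).re) (M : ℕ) :
    ‖∑ j ∈ Finset.range M,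
      x j * Complex.exp (-(1 / 4) * ∑ i ∈ Finset.Ico (j + 1) M, y i)‖ ≤ 5 := by
  induction M with
  | zero => simp
  | succ M ih =>
    have hrec : ∑ j ∈ Finset.range (M + 1),
        x j * Complex.exp (-(1 / 4) * ∑ i ∈ Finset.Ico (j + 1) (M + 1), y i) =
        (∑ j ∈ Finset.range M,
          x j * Complex.exp (-(1 / 4) * ∑ i ∈ Finset.Ico (j + 1) M, y i)) *
          Complex.exp (-(1 / 4) * y M) + x M := by
      rw [Finset.sum_range_succ, Finset.sum_mul]
      congr 1
      · refine Finset.sum_congr rfl fun j hj => ?_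
        rw [Finset.sum_Ico_succ_top (Finset.mem_range.mp hj), mul_add, Complex.exp_add, mul_assoc]
      · simp
    have hexp : ‖Complex.exp (-(1 / 4) * y M)‖ ≤ 1 - ‖x M‖ / 5 := by
      have hre : (-(1 / 4) * y M).re = -((y M).re / 4) := by
        simp [Complex.mul_re]
        ring
      rw [Complex.norm_exp, hre]
      have h0 := norm_nonneg (x M)
      have h1 := hx M
      have hpos : 0 < 1 + ‖x M‖ / 4 := by positivity
      calc Real.exp (-((y M).re / 4)) ≤ Real.exp (-(‖x M‖ / 4)) := by
            gcongr
            exact hxy M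
        _ = (Real.exp (‖x M‖ / 4))⁻¹ := Real.exp_neg _
        _ ≤ (1 + ‖x M‖ / 4)⁻¹ := by
            gcongr
            linarith [Real.add_one_le_exp (‖x M‖ / 4)]
        _ ≤ 1 - ‖x M‖ / 5 := by
            rw [inv_le_iff_one_le_mul₀ hpos]
            nlinarith
    rw [hrec]
    calc _ ≤ 5 * (1 - ‖x M‖ / 5) + ‖x M‖ := by
          refine (norm_add_le _ _).trans ?_
          rw [norm_mul]
          gcongr
      _ = 5 := by ring

theorem norm_exp_sub_one_le_of_re_nonpos {z : ℂ} (hz : z.re ≤ 0) :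
    ‖Complex.exp z - 1‖ ≤ ‖z‖ := by
  have h := (convex_halfSpace_re_le (0 : ℝ)).norm_image_sub_le_of_norm_deriv_le
    (f := Complex.exp) (C := 1) (x := 0) (y := z)
    (fun w _ => Complex.differentiable_exp.differentiableAt)
    (fun w hw => by simpa [Complex.norm_exp] using hw) (by simp) hz
  simpa using h

theorem UnitAddCircle.measureReal_univ : volume.real (Set.univ : Set UnitAddCircle) = 1 := by
  simp [Measure.real]

theorem fourier_natCast_eq_pow (m : ℕ) (x : UnitAddCircle) :
    fourier (m : ℤ) x = fourier 1 x ^ m := by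
  simp [fourier_apply, AddCircle.toCircle_nsmul]

theorem UnitAddCircle.integrable_of_continuous {E : Type*} [NormedAddCommGroup E]
    {f : UnitAddCircle → E} (hf : Continuous f) : Integrable f :=
  hf.integrable_of_hasCompactSupport (HasCompactSupport.of_compactSpace f)

theorem integral_norm_mul_le_of_integral_sq_le {f g : UnitAddCircle → ℂ} (hf : Continuous f)
    (hg : Continuous g) {A B : ℝ} (hA : 0 < A) (hB : 0 < B)
    (hfA : ∫ x, ‖f x‖ ^ 2 ≤ A ^ 2) (hgB : ∫ x, ‖g x‖ ^ 2 ≤ B ^ 2) :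
    ∫ x, ‖f x‖ * ‖g x‖ ≤ A * B := by
  have hf2 : Integrable fun x => ‖f x‖ ^ 2 := UnitAddCircle.integrable_of_continuous (by fun_prop)
  have hg2 : Integrable fun x => ‖g x‖ ^ 2 := UnitAddCircle.integrable_of_continuous (by fun_prop)
  calc ∫ x, ‖f x‖ * ‖g x‖
      ≤ ∫ x, (B / (2 * A) * ‖f x‖ ^ 2 + A / (2 * B) * ‖g x‖ ^ 2) := by
        refine integral_mono (UnitAddCircle.integrable_of_continuous (by fun_prop))
          ((hf2.const_mul _).add (hg2.const_mul _)) fun x => ?_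
        have h : B / (2 * A) * ‖f x‖ ^ 2 + A / (2 * B) * ‖g x‖ ^ 2 - ‖f x‖ * ‖g x‖ =
            (B * ‖f x‖ - A * ‖g x‖) ^ 2 / (2 * A * B) := by
          field_simp
          ring
        have : 0 ≤ (B * ‖f x‖ - A * ‖g x‖) ^ 2 / (2 * A * B) := by positivity
        simp only
        linarith
    _ = B / (2 * A) * (∫ x, ‖f x‖ ^ 2) + A / (2 * B) * ∫ x, ‖g x‖ ^ 2 := by
        rw [integral_add (hf2.const_mul _) (hg2.const_mul _), MeasureTheory.integral_const_mul,
          MeasureTheory.integral_const_mul]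
    _ ≤ B / (2 * A) * A ^ 2 + A / (2 * B) * B ^ 2 := by gcongr
    _ = A * B := by
        field_simp
        ring

theorem UnitAddCircle.integral_comp_fourier_one {G : ℂ → ℂ} (hG : Differentiable ℂ G) :
    ∫ x : UnitAddCircle, G (fourier 1 x) = G 0 := by
  have hmean : Real.circleAverage G 0 1 = G 0 :=
    DiffContOnCl.circleAverage hG.diffContOnCl
  rw [← UnitAddCircle.intervalIntegral_preimage 0, ← hmean, Real.circleAverage_def]
  have h := intervalIntegral.inv_smul_integral_comp_div (a := 0) (b := 2 * Real.pi)
    (fun t : ℝ => G (fourier 1 (t : UnitAddCircle))) (2 * Real.pi)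
  rw [zero_div, div_self (by positivity)] at h
  rw [zero_add, ← h]
  congr 1
  refine intervalIntegral.integral_congr fun θ _ => ?_
  simp only [fourier_coe_apply, circleMap]
  congr 1
  push_cast
  rw [zero_add, one_mul]
  congr 1
  field_simp [Complex.ofReal_ne_zero.mpr Real.pi_ne_zero]

theorem UnitAddCircle.integral_fourier (n : ℤ) :
    ∫ x : UnitAddCircle, fourier n x = if n = 0 then 1 else 0 := by
  have hpow : ∀ m : ℕ, ∫ x : UnitAddCircle, fourier (m : ℤ) x = if (m : ℤ) = 0 then 1 else 0 := by
    intro m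
    have h := UnitAddCircle.integral_comp_fourier_one (differentiable_pow (𝕜 := ℂ) m)
    rcases eq_or_ne m 0 with rfl | hm
    · simp [UnitAddCircle.measureReal_univ]
    · simp_rw [fourier_natCast_eq_pow]
      simpa [zero_pow hm, hm] using h
  obtain ⟨m, rfl | rfl⟩ := n.eq_nat_or_neg
  · exact hpow m
  · simp only [fourier_neg, integral_conj, hpow]
    split_ifs <;> simp_all

theorem exists_entire_re_eq_of_mem_span_fourier {p : C(UnitAddCircle, ℂ)}
    (hp : p ∈ Submodule.span ℂ (Set.range (fourier (T := 1)))) :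
    ∃ h : ℂ → ℂ, Differentiable ℂ h ∧ (h 0).im = 0 ∧
      ∀ x : UnitAddCircle, (h (fourier 1 x)).re = (p x).re := by
  suffices ∀ c : ℂ, ∃ h : ℂ → ℂ, Differentiable ℂ h ∧ (h 0).im = 0 ∧
      ∀ x : UnitAddCircle, (h (fourier 1 x)).re = (c * p x).re by simpa using this 1
  induction hp using Submodule.span_induction with
  | mem p hp =>
    obtain ⟨n, rfl⟩ := hp
    intro c
    rcases eq_or_ne n 0 with rfl | hn
    · exact ⟨fun _ => (c.re : ℂ), by fun_prop, by simp, by simp⟩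
    obtain ⟨m, rfl | rfl⟩ := n.eq_nat_or_neg
    · have hm : m ≠ 0 := by simpa using hn
      exact ⟨fun z => c * z ^ m, by fun_prop, by simp [hm], fun x => by
        rw [fourier_natCast_eq_pow]⟩
    · have hm : m ≠ 0 := by simpa using hn
      refine ⟨fun z => (starRingEnd ℂ) c * z ^ m, by fun_prop, by simp [hm], fun x => ?_⟩
      rw [← Complex.conj_re, map_mul, Complex.conj_conj, map_pow, fourier_neg,
        fourier_natCast_eq_pow, map_pow]
  | zero => exact fun _ => ⟨fun _ => 0, by fun_prop, by simp, by simp⟩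
  | add p q _ _ hp hq =>
    intro c
    obtain ⟨h, hd, h0, he⟩ := hp c
    obtain ⟨k, kd, k0, ke⟩ := hq c
    exact ⟨fun z => h z + k z, by fun_prop, by simp [h0, k0], fun x => by
      simp only [Complex.add_re, he, ke, ContinuousMap.add_apply, mul_add]⟩
  | smul d p _ hp =>
    intro c
    obtain ⟨h, hd, h0, he⟩ := hp (c * d)
    exact ⟨h, hd, h0, fun x => by rw [he, ContinuousMap.smul_apply, smul_eq_mul, mul_assoc]⟩

theorem integral_norm_sq_le_two_mul_integral_re_sq {h : ℂ → ℂ} (hd : Differentiable ℂ h)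
    (h0 : (h 0).im = 0) :
    ∫ x : UnitAddCircle, ‖h (fourier 1 x)‖ ^ 2 ≤
      2 * ∫ x : UnitAddCircle, (h (fourier 1 x)).re ^ 2 := by
  have hc := hd.continuous
  have hmean := congrArg Complex.re (UnitAddCircle.integral_comp_fourier_one (hd.pow 2))
  have hsq : Integrable fun x : UnitAddCircle => h (fourier 1 x) ^ 2 :=
    UnitAddCircle.integrable_of_continuous (by fun_prop)
  have hre : ∫ x : UnitAddCircle, (h (fourier 1 x) ^ 2).re = (h 0 ^ 2).re := by
    exact (integral_re hsq).trans hmean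
  have hid : ∀ x : UnitAddCircle, ‖h (fourier 1 x)‖ ^ 2 =
      2 * (h (fourier 1 x)).re ^ 2 - (h (fourier 1 x) ^ 2).re := fun x => by
    rw [Complex.sq_norm, Complex.normSq_apply, pow_two (h _), Complex.mul_re]
    ring
  have h0' : 0 ≤ (h 0 ^ 2).re := by
    rw [pow_two, Complex.mul_re, h0]
    nlinarith [sq_nonneg (h 0).re]
  simp_rw [hid]
  rw [integral_sub (UnitAddCircle.integrable_of_continuous (by fun_prop))
    (UnitAddCircle.integrable_of_continuous (by fun_prop)),
    MeasureTheory.integral_const_mul, hre]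
  linarith

theorem exists_entire_majorant {f : UnitAddCircle → ℂ} (hf : Continuous f)
    (hf1 : ∀ x, ‖f x‖ ≤ 1) {c : ℝ} (hc : 0 < c) (hc1 : c ≤ 1) (hfc : ∫ x, ‖f x‖ ^ 2 ≤ c) :
    ∃ h : ℂ → ℂ, Differentiable ℂ h ∧
      (∀ x : UnitAddCircle, ‖f x‖ ≤ (h (fourier 1 x)).re) ∧
      ∫ x : UnitAddCircle, ‖h (fourier 1 x)‖ ^ 2 ≤ 9 / 4 * c := by
  set δ : ℝ := c / 100 with hδ
  have hδ0 : 0 < δ := by positivity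
  let g : C(UnitAddCircle, ℂ) := ⟨fun x => ((‖f x‖ + δ : ℝ) : ℂ), by fun_prop⟩
  have hg : g ∈ closure (Submodule.span ℂ (Set.range (fourier (T := 1))) :
      Set C(UnitAddCircle, ℂ)) := by
    rw [← Submodule.topologicalClosure_coe, span_fourier_closure_eq_top]
    trivial
  obtain ⟨p, hp, hgp⟩ := Metric.mem_closure_iff.mp hg δ hδ0
  obtain ⟨h, hd, h0, he⟩ := exists_entire_re_eq_of_mem_span_fourier hp
  have hclose : ∀ x : UnitAddCircle, |‖f x‖ + δ - (h (fourier 1 x)).re| ≤ δ := fun x => by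
    have h1 : ‖g x - p x‖ ≤ δ := by
      rw [← dist_eq_norm]
      exact (ContinuousMap.dist_apply_le_dist x).trans hgp.le
    have h2 := (Complex.abs_re_le_norm _).trans h1
    rwa [Complex.sub_re, ← he x] at h2
  have hcont := hd.continuous
  refine ⟨h, hd, fun x => by linarith [(abs_le.mp (hclose x)).2], ?_⟩
  have hf2 : Integrable fun x => ‖f x‖ ^ 2 := UnitAddCircle.integrable_of_continuous (by fun_prop)
  have hbound : ∫ x : UnitAddCircle, (h (fourier 1 x)).re ^ 2 ≤ c + (4 * δ + 4 * δ ^ 2) := by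
    calc _ ≤ ∫ x, (‖f x‖ ^ 2 + (4 * δ + 4 * δ ^ 2)) := by
          refine integral_mono (UnitAddCircle.integrable_of_continuous (by fun_prop))
            (hf2.add (integrable_const _)) fun x => ?_
          have h1 := abs_le.mp (hclose x)
          simp only
          nlinarith [norm_nonneg (f x), hf1 x]
      _ ≤ _ := by
          rw [integral_add hf2 (integrable_const _)]
          simpa [UnitAddCircle.measureReal_univ] using hfc
  have := integral_norm_sq_le_two_mul_integral_re_sq hd h0
  nlinarith

theorem UnitAddCircle.integral_norm_sq_sum_fourier {ι : Type*} (s : Finset ι) (c : ι → ℂ)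
    {m : ι → ℤ} (hm : Function.Injective m) :
    ∫ x : UnitAddCircle, ‖∑ i ∈ s, c i * fourier (m i) x‖ ^ 2 = ∑ i ∈ s, ‖c i‖ ^ 2 := by
  classical
  have hexpand : ∀ x : UnitAddCircle, ((‖∑ i ∈ s, c i * fourier (m i) x‖ ^ 2 : ℝ) : ℂ) =
      ∑ i ∈ s, ∑ j ∈ s, c i * (starRingEnd ℂ) (c j) * fourier (m i - m j) x := by
    intro x
    rw [Complex.ofReal_pow, ← Complex.mul_conj', map_sum, Finset.sum_mul_sum]
    refine Finset.sum_congr rfl fun i _ => Finset.sum_congr rfl fun j _ => ?_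
    rw [sub_eq_add_neg, fourier_add, fourier_neg, map_mul]
    ring
  apply Complex.ofReal_injective
  rw [← integral_complex_ofReal]
  simp_rw [hexpand]
  rw [integral_finsetSum _ fun i _ => UnitAddCircle.integrable_of_continuous (by fun_prop)]
  rw [Complex.ofReal_sum]
  refine Finset.sum_congr rfl fun i hi => ?_
  rw [integral_finsetSum _ fun i _ => UnitAddCircle.integrable_of_continuous (by fun_prop)]
  simp_rw [MeasureTheory.integral_const_mul, UnitAddCircle.integral_fourier, sub_eq_zero,
    hm.eq_iff]
  simp [hi, Complex.mul_conj']

theorem UnitAddCircle.integral_fourier_mul_comp_eq_zero {G : ℂ → ℂ} (hG : Differentiable ℂ G)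
    {m : ℤ} (hm : 0 < m) : ∫ x : UnitAddCircle, fourier m x * G (fourier 1 x) = 0 := by
  lift m to ℕ using hm.le
  have hm' : m ≠ 0 := by
    rintro rfl
    simp at hm
  simp_rw [fourier_natCast_eq_pow]
  simpa [hm'] using UnitAddCircle.integral_comp_fourier_one ((differentiable_pow m).mul hG)

theorem card_filter_log_four_eq_le (N j : ℕ) :
    (Finset.univ.filter fun k : Fin N => Nat.log 4 (3 * k + 1) = j).card ≤ 4 ^ j := by
  have hmem : ∀ k : Fin N, Nat.log 4 (3 * k + 1) = j →
      4 ^ j ≤ 3 * (k : ℕ) + 1 ∧ 3 * (k : ℕ) + 1 < 4 * 4 ^ j := by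
    rintro k rfl
    refine ⟨Nat.pow_log_le_self 4 (by simp), ?_⟩
    rw [← pow_succ']
    exact Nat.lt_pow_succ_log_self (by norm_num) _
  rw [← Finset.card_range (4 ^ j)]
  refine Finset.card_le_card_of_injOn (fun k => (3 * (k : ℕ) + 1 - 4 ^ j) / 3) ?_ ?_
  · intro k hk
    have := hmem k (by simpa using hk)
    simp only [Finset.coe_range, Set.mem_Iio]
    omega
  · intro k hk k' hk' h
    have h1 := hmem k (by simpa using hk)
    have h2 := hmem k' (by simpa using hk')
    simp only at h
    ext
    omega

theorem norm_integral_mul_exp_sum_sub_one_le {e f : UnitAddCircle → ℂ} (he : ∀ x, ‖e x‖ ≤ 1)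
    (hf : Continuous f) {y : ℕ → UnitAddCircle → ℂ} (hy : ∀ i, Continuous (y i))
    (hy0 : ∀ i x, 0 ≤ (y i x).re) {j : ℕ} (hf2 : ∫ x, ‖f x‖ ^ 2 ≤ (1 / 4) ^ j)
    (hy2 : ∀ i, ∫ x, ‖y i x‖ ^ 2 ≤ 9 / 4 * (1 / 4) ^ i) (M : ℕ) :
    ‖∫ x, e x * f x * (Complex.exp (-(1 / 4) * ∑ i ∈ Finset.Ico (j + 1) M, y i x) - 1)‖ ≤
      3 / 8 * (1 / 4) ^ j := by
  have hpow : ∀ i : ℕ, (1 / 4 : ℝ) ^ i = ((1 / 2) ^ i) ^ 2 := fun i => by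
    rw [← pow_mul, mul_comm, pow_mul]
    norm_num
  have hpoint : ∀ x,
      ‖e x * f x * (Complex.exp (-(1 / 4) * ∑ i ∈ Finset.Ico (j + 1) M, y i x) - 1)‖ ≤
        1 / 4 * ∑ i ∈ Finset.Ico (j + 1) M, ‖f x‖ * ‖y i x‖ := fun x => by
    have hre : (-(1 / 4) * ∑ i ∈ Finset.Ico (j + 1) M, y i x).re ≤ 0 := by
      have h0 : 0 ≤ ∑ i ∈ Finset.Ico (j + 1) M, (y i x).re :=
        Finset.sum_nonneg fun i _ => hy0 i x
      simp only [Complex.mul_re, Complex.re_sum]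
      norm_num
      linarith
    calc _ ≤ 1 * ‖f x‖ * ‖-(1 / 4) * ∑ i ∈ Finset.Ico (j + 1) M, y i x‖ := by
          rw [norm_mul, norm_mul]
          gcongr
          · exact he x
          · exact norm_exp_sub_one_le_of_re_nonpos hre
      _ ≤ 1 * ‖f x‖ * (1 / 4 * ∑ i ∈ Finset.Ico (j + 1) M, ‖y i x‖) := by
          rw [norm_mul]
          gcongr
          · norm_num
          · exact norm_sum_le _ _
      _ = _ := by
          rw [← Finset.mul_sum]
          ring
  calc _ ≤ ∫ x, 1 / 4 * ∑ i ∈ Finset.Ico (j + 1) M, ‖f x‖ * ‖y i x‖ :=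
        norm_integral_le_of_norm_le
          (UnitAddCircle.integrable_of_continuous (by fun_prop)) (.of_forall hpoint)
    _ = 1 / 4 * ∑ i ∈ Finset.Ico (j + 1) M, ∫ x, ‖f x‖ * ‖y i x‖ := by
        rw [MeasureTheory.integral_const_mul, integral_finsetSum _ fun i _ =>
          UnitAddCircle.integrable_of_continuous (by fun_prop)]
    _ ≤ 1 / 4 * ∑ i ∈ Finset.Ico (j + 1) M, (1 / 2) ^ j * (3 / 2 * (1 / 2) ^ i) := by
        gcongr with i _
        refine integral_norm_mul_le_of_integral_sq_le hf (hy i) (by positivity) (by positivity)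
          (by rwa [← hpow]) ?_
        rw [mul_pow, ← hpow]
        convert hy2 i using 2
        norm_num
    _ = 3 / 8 * (1 / 2) ^ j * ∑ i ∈ Finset.Ico (j + 1) M, (1 / 2 : ℝ) ^ i := by
        simp_rw [← Finset.mul_sum]
        ring
    _ ≤ 3 / 8 * (1 / 2) ^ j * ((1 / 2) ^ (j + 1) / (1 - 1 / 2)) := by
        gcongr
        exact geom_sum_Ico_le_of_lt_one (by norm_num) (by norm_num)
    _ = 3 / 8 * (1 / 4) ^ j := by
        rw [hpow]
        ring

theorem exists_bounded_approx_fourier_prescribed {N : ℕ} {n : Fin N → ℤ} (hn : StrictMono n)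
    {u : Fin N → ℂ} (hu : ∀ k, ‖u k‖ ≤ 1) :
    ∃ F : UnitAddCircle → ℂ, Continuous F ∧ (∀ x, ‖F x‖ ≤ 5) ∧
      ∀ k, ‖(∫ x, fourier (n k) x * F x) - (1 / 4) ^ Nat.log 4 (3 * k + 1) * u k‖ ≤
        1 / 2 * (1 / 4) ^ Nat.log 4 (3 * k + 1) := by
  classical
  let b : Fin N → ℕ := fun k => Nat.log 4 (3 * k + 1)
  let S : ℕ → Finset (Fin N) := fun j => Finset.univ.filter fun k => b k = j
  let f : ℕ → UnitAddCircle → ℂ := fun j x =>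
    ∑ i ∈ S j, (1 / 4) ^ j * u i * fourier (-n i) x
  have hcard : ∀ j, ((S j).card : ℝ) ≤ 4 ^ j := fun j => by
    exact_mod_cast card_filter_log_four_eq_le N j
  have hcoef : ∀ j i, ‖(1 / 4 : ℂ) ^ j * u i‖ ≤ (1 / 4) ^ j := fun j i => by
    rw [norm_mul, norm_pow, show ‖(1 / 4 : ℂ)‖ = 1 / 4 by norm_num]
    exact mul_le_of_le_one_right (by positivity) (hu i)
  have hfc : ∀ j, Continuous (f j) := fun j => by fun_prop
  have hf1 : ∀ j x, ‖f j x‖ ≤ 1 := fun j x => by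
    calc ‖f j x‖ ≤ ∑ i ∈ S j, ((1 / 4) ^ j : ℝ) := by
          refine norm_sum_le_of_le _ fun i _ => ?_
          rw [norm_mul, fourier_apply, Circle.norm_coe, mul_one]
          exact hcoef j i
      _ ≤ 4 ^ j * (1 / 4) ^ j := by
          rw [Finset.sum_const, nsmul_eq_mul]
          gcongr
          exact hcard j
      _ = 1 := by
          rw [← mul_pow]
          norm_num
  have hf2 : ∀ j, ∫ x, ‖f j x‖ ^ 2 ≤ (1 / 4) ^ j := fun j => by
    calc ∫ x, ‖f j x‖ ^ 2 = ∑ i ∈ S j, ‖(1 / 4 : ℂ) ^ j * u i‖ ^ 2 :=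
          UnitAddCircle.integral_norm_sq_sum_fourier _ _ (neg_injective.comp hn.injective)
      _ ≤ ∑ i ∈ S j, ((1 / 4) ^ j : ℝ) ^ 2 := by
          gcongr with i _
          exact hcoef j i
      _ ≤ 4 ^ j * ((1 / 4) ^ j) ^ 2 := by
          rw [Finset.sum_const, nsmul_eq_mul]
          gcongr
          exact hcard j
      _ = (1 / 4) ^ j := by
          rw [pow_two, ← mul_assoc, ← mul_pow]
          norm_num
  choose h hd hmaj hh2 using fun j => exists_entire_majorant (hfc j) (hf1 j)
    (c := (1 / 4) ^ j) (by positivity) (pow_le_one₀ (by norm_num) (by norm_num)) (hf2 j)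
  have hhc : ∀ j, Continuous (h j) := fun j => (hd j).continuous
  let M : ℕ := Nat.log 4 (3 * N + 1) + 1
  let W : ℕ → ℂ → ℂ := fun j z => Complex.exp (-(1 / 4) * ∑ i ∈ Finset.Ico (j + 1) M, h i z)
  have hWd : ∀ j, Differentiable ℂ (W j) := fun j => by fun_prop
  have hWc : ∀ j, Continuous (W j) := fun j => (hWd j).continuous
  refine ⟨fun x => ∑ j ∈ Finset.range M, f j x * W j (fourier 1 x), by fun_prop,
    fun x => norm_sum_mul_exp_le (fun j => f j x) (fun j => h j (fourier 1 x))
      (fun j => hf1 j x) (fun j => hmaj j x) M, fun k => ?_⟩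
  have hbM : b k < M := Nat.lt_succ_of_le (Nat.log_mono_right (by omega))
  have hmain : ∀ j, ∫ x, fourier (n k) x * f j x =
      if b k = j then (1 / 4) ^ b k * u k else 0 := fun j => by
    have hexpand : ∀ x : UnitAddCircle, fourier (n k) x * f j x =
        ∑ i ∈ S j, (1 / 4) ^ j * u i * fourier (n k - n i) x := fun x => by
      rw [Finset.mul_sum]
      refine Finset.sum_congr rfl fun i _ => ?_
      rw [sub_eq_add_neg, fourier_add]
      ring
    simp_rw [hexpand]
    rw [integral_finsetSum _ fun i _ => UnitAddCircle.integrable_of_continuous (by fun_prop)]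
    simp_rw [MeasureTheory.integral_const_mul, UnitAddCircle.integral_fourier, sub_eq_zero,
      hn.injective.eq_iff]
    by_cases hj : b k = j
    · simp [S, hj]
    · simp [S, hj]
  have hlow : ∀ j < b k, ∫ x, fourier (n k) x * f j x * (W j (fourier 1 x) - 1) = 0 := by
    intro j hj
    have hexpand : ∀ x : UnitAddCircle, fourier (n k) x * f j x * (W j (fourier 1 x) - 1) =
        ∑ i ∈ S j, (1 / 4) ^ j * u i * (fourier (n k - n i) x * (W j (fourier 1 x) - 1)) :=
      fun x => by
        rw [Finset.mul_sum, Finset.sum_mul]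
        refine Finset.sum_congr rfl fun i _ => ?_
        rw [sub_eq_add_neg (n k), fourier_add]
        ring
    simp_rw [hexpand]
    rw [integral_finsetSum _ fun i _ => UnitAddCircle.integrable_of_continuous (by fun_prop)]
    refine Finset.sum_eq_zero fun i hi => ?_
    have hik : i < k := by
      by_contra! hki
      have hle : b k ≤ b i := Nat.log_mono_right (by simpa using hki)
      rw [(Finset.mem_filter.mp hi).2] at hle
      omega
    rw [MeasureTheory.integral_const_mul, UnitAddCircle.integral_fourier_mul_comp_eq_zero
      ((hWd j).sub_const 1) (sub_pos.mpr (hn hik)), mul_zero]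
  have hsplit : (∫ x, fourier (n k) x * ∑ j ∈ Finset.range M, f j x * W j (fourier 1 x)) -
      (1 / 4) ^ b k * u k =
      ∑ j ∈ Finset.Ico (b k) M, ∫ x, fourier (n k) x * f j x * (W j (fourier 1 x) - 1) := by
    have hsum : ∑ j ∈ Finset.Ico (b k) M,
        ∫ x, fourier (n k) x * f j x * (W j (fourier 1 x) - 1) =
        ∑ j ∈ Finset.range M, ∫ x, fourier (n k) x * f j x * (W j (fourier 1 x) - 1) := by
      rw [← Finset.sum_range_add_sum_Ico _ hbM.le,
        Finset.sum_eq_zero fun j hj => hlow j (Finset.mem_range.mp hj), zero_add]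
    have hmainsum : ∑ j ∈ Finset.range M, ∫ x, fourier (n k) x * f j x =
        (1 / 4) ^ b k * u k := by
      simp_rw [hmain]
      simp [hbM]
    rw [hsum, ← hmainsum]
    simp_rw [Finset.mul_sum]
    rw [integral_finsetSum _ fun i _ => UnitAddCircle.integrable_of_continuous (by fun_prop),
      ← Finset.sum_sub_distrib]
    refine Finset.sum_congr rfl fun j _ => ?_
    rw [← integral_sub (UnitAddCircle.integrable_of_continuous (by fun_prop))
      (UnitAddCircle.integrable_of_continuous (by fun_prop))]
    congr 1
    ext x
    ring
  change ‖_ - (1 / 4) ^ b k * u k‖ ≤ 1 / 2 * (1 / 4) ^ b k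
  rw [hsplit]
  calc _ ≤ ∑ j ∈ Finset.Ico (b k) M, 3 / 8 * (1 / 4 : ℝ) ^ j := by
        refine norm_sum_le_of_le _ fun j _ => ?_
        exact norm_integral_mul_exp_sum_sub_one_le
          (e := fun x => fourier (n k) x) (y := fun i x => h i (fourier 1 x))
          (fun x => by rw [fourier_apply, Circle.norm_coe]) (hfc j) (fun i => by fun_prop)
          (fun i x => (norm_nonneg _).trans (hmaj i x)) (hf2 j) hh2 M
    _ ≤ 3 / 8 * ((1 / 4) ^ b k / (1 - 1 / 4)) := by
        rw [← Finset.mul_sum]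
        gcongr
        exact geom_sum_Ico_le_of_lt_one (by norm_num) (by norm_num)
    _ = 1 / 2 * (1 / 4) ^ b k := by ring

theorem one_div_succ_le_three_mul_pow_log (k : ℕ) :
    1 / ((k : ℝ) + 1) ≤ 3 * (1 / 4) ^ Nat.log 4 (3 * k + 1) := by
  have h : ((4 ^ Nat.log 4 (3 * k + 1) : ℕ) : ℝ) ≤ ((3 * k + 1 : ℕ) : ℝ) :=
    Nat.cast_le.mpr (Nat.pow_log_le_self 4 (by simp))
  push_cast at h
  rw [one_div_pow, mul_one_div, div_le_div_iff₀ (by positivity) (by positivity)]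
  linarith

/-- McGehee–Pigno–Smith theorem (Littlewood conjecture). -/
theorem mcgehee_pigno_smith (N : ℕ) (n : Fin N → ℤ) (hn : StrictMono n)
    (a : Fin N → ℂ) :
    (1 / 30 : ℝ) * ∑ k : Fin N, ‖a k‖ / ((k : ℕ) + 1 : ℝ) ≤
      ∫ t in (-(1/2) : ℝ)..(1/2 : ℝ),
        ‖∑ k : Fin N, a k * Complex.exp (((2 * Real.pi * (n k : ℝ) * t : ℝ) : ℂ) * Complex.I)‖ := by
  have hcircle : ∫ t in (-(1/2) : ℝ)..(1/2 : ℝ),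
      ‖∑ k : Fin N, a k * Complex.exp (((2 * Real.pi * (n k : ℝ) * t : ℝ) : ℂ) * Complex.I)‖ =
      ∫ x : UnitAddCircle, ‖∑ k : Fin N, a k * fourier (n k) x‖ := by
    rw [← UnitAddCircle.intervalIntegral_preimage (-(1 / 2)), show (-(1 / 2) + 1 : ℝ) = 1 / 2 by
      norm_num]
    refine intervalIntegral.integral_congr fun t _ => ?_
    simp only [fourier_coe_apply]
    refine congrArg norm (Finset.sum_congr rfl fun k _ => ?_)
    congr 2
    push_cast
    ring
  rw [hcircle]
  let w : Fin N → ℝ := fun k => (1 / 4) ^ Nat.log 4 (3 * k + 1)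
  obtain ⟨F, hFc, hF, hcoef⟩ := exists_bounded_approx_fourier_prescribed hn
    (u := fun k => (starRingEnd ℂ) (a k) / ‖a k‖) fun k => by
      rw [norm_div, RCLike.norm_conj, Complex.norm_real, norm_norm]
      exact div_self_le_one _
  have hdual : ∫ x, (∑ k : Fin N, a k * fourier (n k) x) * F x =
      ∑ k, a k * ∫ x, fourier (n k) x * F x := by
    simp_rw [Finset.sum_mul, mul_assoc]
    rw [integral_finsetSum _ fun i _ => UnitAddCircle.integrable_of_continuous (by fun_prop)]
    simp_rw [MeasureTheory.integral_const_mul]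
  have hupper : ‖∫ x, (∑ k : Fin N, a k * fourier (n k) x) * F x‖ ≤
      5 * ∫ x : UnitAddCircle, ‖∑ k : Fin N, a k * fourier (n k) x‖ := by
    rw [← MeasureTheory.integral_const_mul]
    refine norm_integral_le_of_norm_le
      (UnitAddCircle.integrable_of_continuous (by fun_prop)) (.of_forall fun x => ?_)
    rw [norm_mul, mul_comm]
    gcongr
    exact hF x
  have hterm : ∀ k, 1 / 2 * w k * ‖a k‖ ≤ (a k * ∫ x, fourier (n k) x * F x).re := fun k => by
    have hphase : a k * ((1 / 4) ^ Nat.log 4 (3 * k + 1) *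
        ((starRingEnd ℂ) (a k) / ‖a k‖)) = ((w k * ‖a k‖ : ℝ) : ℂ) := by
      rcases eq_or_ne (a k) 0 with h0 | h0
      · simp [h0]
      · have h1 : (‖a k‖ : ℂ) ≠ 0 := by simpa using h0
        rw [mul_left_comm, ← mul_div_assoc, Complex.mul_conj', pow_two, mul_div_cancel_right₀ _ h1]
        simp [w]
    have herr := (Complex.abs_re_le_norm _).trans (norm_mul_le (a k) _ |>.trans
      (mul_le_mul_of_nonneg_left (hcoef k) (norm_nonneg (a k))))
    rw [mul_sub, hphase, Complex.sub_re, Complex.ofReal_re] at herr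
    have := (abs_le.mp herr).1
    change -(‖a k‖ * (1 / 2 * w k)) ≤ _ at this
    linarith
  have hlower : ∑ k, 1 / 2 * w k * ‖a k‖ ≤
      ‖∫ x, (∑ k : Fin N, a k * fourier (n k) x) * F x‖ := by
    refine le_trans ?_ (Complex.re_le_norm _)
    rw [hdual, Complex.re_sum]
    exact Finset.sum_le_sum fun k _ => hterm k
  have hweight : ∑ k : Fin N, ‖a k‖ / ((k : ℕ) + 1 : ℝ) ≤ 6 * ∑ k, 1 / 2 * w k * ‖a k‖ := by
    rw [Finset.mul_sum]
    refine Finset.sum_le_sum fun k _ => ?_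
    calc ‖a k‖ / ((k : ℕ) + 1 : ℝ) = ‖a k‖ * (1 / ((k : ℕ) + 1 : ℝ)) := by ring
      _ ≤ ‖a k‖ * (3 * w k) := by
          gcongr
          exact one_div_succ_le_three_mul_pow_log k
      _ = 6 * (1 / 2 * w k * ‖a k‖) := by ring
  linarith
end

section
/- For every integer N ≥ 4 and integers n_1 < n_2 < ... < n_N, the integral over [-1/2, 1/2] of |∑_{k=1}^N e^{2πi n_k t}| dt is at least (4/π³) log N. -/
open MeasureTheory intervalIntegral

namespace Littlewood

open Complex ComplexConjugate

/-- The character `t ↦ exp (2πint)` of `ℝ / ℤ`. -/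
noncomputable def character (n : ℤ) (t : ℝ) : ℂ :=
  exp (((2 * Real.pi * (n : ℝ) * t : ℝ) : ℂ) * I)

@[fun_prop]
lemma continuous_character (n : ℤ) : Continuous (character n) := by
  unfold character
  fun_prop

lemma character_zero (t : ℝ) : character 0 t = 1 := by simp [character]

lemma character_add (m n : ℤ) (t : ℝ) :
    character (m + n) t = character m t * character n t := by
  rw [character, character, character, ← exp_add]
  push_cast
  ring_nf

lemma character_pow (k : ℕ) (t : ℝ) : character 1 t ^ k = character k t := by
  induction k with
  | zero => simp [character_zero]
  | succ k ih => rw [pow_succ, ih, Nat.cast_succ, character_add]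

lemma norm_character (n : ℤ) (t : ℝ) : ‖character n t‖ = 1 :=
  norm_exp_ofReal_mul_I _

lemma conj_character (n : ℤ) (t : ℝ) : conj (character n t) = character (-n) t := by
  rw [character, character, ← exp_conj, map_mul, conj_ofReal, conj_I]
  push_cast
  ring_nf

lemma periodic_character (n : ℤ) : Function.Periodic (character n) 1 := by
  intro t
  rw [character, character, Complex.exp_eq_exp_iff_exists_int]
  exact ⟨n, by push_cast; ring⟩

lemma integral_entire_comp_character {g : ℂ → ℂ} (hg : Differentiable ℂ g) :
    ∫ t in (-(1 / 2) : ℝ)..(1 / 2), g (character 1 t) = g 0 := by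
  have h := (hg.diffContOnCl (s := Metric.ball 0 |1|)).circleAverage
  rw [Real.circleAverage_eq_integral_add (-Real.pi)] at h
  rw [← h, intervalIntegral.integral_comp_add_right (fun θ ↦ g (circleMap 0 1 θ))]
  have hc (t : ℝ) : character 1 t = circleMap 0 1 (2 * Real.pi * t) := by
    simp [character, circleMap]
  simp_rw [hc]
  rw [intervalIntegral.integral_comp_mul_left (fun θ ↦ g (circleMap 0 1 θ)) (by positivity)]
  congr 2 <;> ring

lemma integral_character_mul_entire {g : ℂ → ℂ} (hg : Differentiable ℂ g) {n : ℤ} (hn : 0 < n) :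
    ∫ t in (-(1 / 2) : ℝ)..(1 / 2), character n t * g (character 1 t) = 0 := by
  lift n to ℕ using hn.le
  have h := integral_entire_comp_character (g := fun z ↦ z ^ n * g z) (by fun_prop)
  simpa [character_pow, show n ≠ 0 by omega] using h

lemma integral_character (n : ℤ) :
    ∫ t in (-(1 / 2) : ℝ)..(1 / 2), character n t = if n = 0 then 1 else 0 := by
  rcases lt_trichotomy n 0 with h | rfl | h
  · have h' := integral_character_mul_entire (g := fun _ ↦ 1) (by fun_prop) (n := -n) (by omega)
    simp only [mul_one, ← conj_character] at h'
    rw [if_neg h.ne]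
    simp only [intervalIntegral.intervalIntegral_eq_integral_uIoc] at h' ⊢
    rw [integral_conj, smul_eq_zero] at h'
    simpa using h'
  · simp [character_zero]; norm_num
  · simpa [h.ne'] using integral_character_mul_entire (g := fun _ ↦ 1) (by fun_prop) h

lemma integral_conj_sum_character_mul_sum_character {a : ℕ → ℤ} {s s' : Finset ℕ}
    (hs : s' ⊆ s) (ha : Set.InjOn a s) :
    ∫ t in (-(1 / 2) : ℝ)..(1 / 2),
      conj (∑ i ∈ s, character (a i) t) * ∑ i ∈ s', character (a i) t = s'.card := by
  simp_rw [map_sum, conj_character, Finset.sum_mul_sum, ← character_add]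
  rw [intervalIntegral.integral_finsetSum
    fun i _ ↦ Continuous.intervalIntegrable (by fun_prop) _ _, Finset.sum_congr rfl
    fun i _ ↦ intervalIntegral.integral_finsetSum
      fun i _ ↦ Continuous.intervalIntegrable (by fun_prop) _ _, Finset.sum_comm]
  simp_rw [integral_character]
  rw [Finset.card_eq_sum_ones, Nat.cast_sum]
  refine Finset.sum_congr rfl fun i hi ↦ ?_
  rw [Finset.sum_eq_single i]
  · simp
  · intro j hj hji
    rw [if_neg]
    intro h
    exact hji (ha hj (hs hi) (by omega))
  · exact fun h ↦ absurd (hs hi) h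

lemma integral_sq_norm_sum_character {a : ℕ → ℤ} {s : Finset ℕ} (ha : Set.InjOn a s) :
    ∫ t in (-(1 / 2) : ℝ)..(1 / 2), ‖∑ i ∈ s, character (a i) t‖ ^ 2 = s.card := by
  have h := integral_conj_sum_character_mul_sum_character subset_rfl ha
  simp_rw [conj_mul', ← ofReal_pow] at h
  rw [intervalIntegral.integral_ofReal] at h
  exact_mod_cast h

lemma exists_entire_re_near {u : ℝ → ℝ} (hu : Continuous u) (hper : Function.Periodic u 1)
    {δ : ℝ} (hδ : 0 < δ) :
    ∃ h : ℂ → ℂ, Differentiable ℂ h ∧ (h 0).im = 0 ∧ ∀ t, |(h (character 1 t)).re - u t| ≤ δ := by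
  have hper' : Function.Periodic (fun t ↦ (u t : ℂ)) 1 := fun t ↦ by simp [hper t]
  let v : C(AddCircle (1 : ℝ), ℂ) :=
    ⟨hper'.lift, continuous_quot_lift _ (by fun_prop)⟩
  have hv : v ∈ (Submodule.span ℂ (Set.range (@fourier 1))).topologicalClosure := by
    rw [span_fourier_closure_eq_top]
    trivial
  obtain ⟨p, hp, hpv⟩ := Metric.mem_closure_iff.1 hv δ hδ
  have key : ∀ p ∈ Submodule.span ℂ (Set.range (@fourier 1)), ∀ c : ℂ, ∃ h : ℂ → ℂ,
      Differentiable ℂ h ∧ ∀ t : ℝ, (h (character 1 t)).re = (c * p t).re := by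
    intro p hp
    induction hp using Submodule.span_induction with
    | mem p hp =>
      obtain ⟨n, rfl⟩ := hp
      have hn (t : ℝ) : fourier n (t : AddCircle (1 : ℝ)) = character n t := by
        rw [fourier_coe_apply, character]
        push_cast
        ring_nf
      intro c
      rcases le_total 0 n with h | h
      · lift n to ℕ using h
        exact ⟨fun z ↦ c * z ^ n, by fun_prop, fun t ↦ by simp only [hn, character_pow]⟩
      · obtain ⟨m, rfl⟩ : ∃ m : ℕ, n = -m := ⟨n.natAbs, by omega⟩
        refine ⟨fun z ↦ conj c * z ^ m, by fun_prop, fun t ↦ ?_⟩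
        simp only [hn, character_pow]
        rw [← conj_re, map_mul, conj_conj, conj_character]
    | zero => exact fun c ↦ ⟨0, by fun_prop, by simp⟩
    | add p q _ _ hp hq =>
      intro c
      obtain ⟨g, hg, hg'⟩ := hp c
      obtain ⟨h, hh, hh'⟩ := hq c
      exact ⟨fun z ↦ g z + h z, by fun_prop, fun t ↦ by simp [hg', hh', mul_add]⟩
    | smul b p _ hp =>
      intro c
      obtain ⟨g, hg, hg'⟩ := hp (c * b)
      exact ⟨g, hg, fun t ↦ by simp [hg', mul_assoc]⟩
  obtain ⟨h, hh, hh'⟩ := key p hp 1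
  refine ⟨fun z ↦ h z - ((h 0).im : ℂ) * I, by fun_prop, by simp, fun t ↦ ?_⟩
  have h1 : ‖p t - v t‖ ≤ δ := by
    rw [← dist_eq_norm, dist_comm]
    exact (ContinuousMap.dist_apply_le_dist _).trans hpv.le
  have h2 : v t = u t := rfl
  have h3 := (abs_re_le_norm _).trans h1
  simpa [hh', h2] using h3

lemma integral_sq_norm_le {h : ℂ → ℂ} (hh : Differentiable ℂ h) (h0 : (h 0).im = 0) :
    ∫ t in (-(1 / 2) : ℝ)..(1 / 2), ‖h (character 1 t)‖ ^ 2 ≤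
      2 * ∫ t in (-(1 / 2) : ℝ)..(1 / 2), (h (character 1 t)).re ^ 2 := by
  have hc : Continuous h := hh.continuous
  have key := congrArg re (integral_entire_comp_character (g := fun z ↦ h z ^ 2) (by fun_prop))
  rw [← reCLM_apply, ← ContinuousLinearMap.intervalIntegral_comp_comm _
    (Continuous.intervalIntegrable (by fun_prop) _ _)] at key
  have hpos : 0 ≤ (h 0 ^ 2).re := by
    rw [sq, mul_re, h0]
    nlinarith [sq_nonneg (h 0).re]
  rw [← key] at hpos
  rw [← intervalIntegral.integral_const_mul, ← sub_nonneg, ← intervalIntegral.integral_sub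
    (Continuous.intervalIntegrable (by fun_prop) _ _)
    (Continuous.intervalIntegrable (by fun_prop) _ _)]
  refine hpos.trans_eq (intervalIntegral.integral_congr fun t _ ↦ ?_)
  simp only [reCLM_apply, ← normSq_eq_norm_sq, normSq_apply, sq (h _), mul_re]
  ring

lemma exists_entire_majorant {u : ℝ → ℝ} (hu : Continuous u) (hper : Function.Periodic u 1)
    (hu0 : ∀ t, 0 ≤ u t) (hu1 : ∀ t, u t ≤ 1) {η : ℝ} (hη : 0 < η) :
    ∃ h : ℂ → ℂ, Differentiable ℂ h ∧ (∀ t, u t ≤ (h (character 1 t)).re) ∧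
      ∫ t in (-(1 / 2) : ℝ)..(1 / 2), ‖h (character 1 t)‖ ^ 2 ≤
        2 * (∫ t in (-(1 / 2) : ℝ)..(1 / 2), u t ^ 2) + η := by
  obtain ⟨δ, hδ, hδ1, hδη⟩ : ∃ δ : ℝ, 0 < δ ∧ δ ≤ 1 ∧ 16 * δ ≤ η :=
    ⟨min 1 (η / 16), by positivity, min_le_left _ _, by linarith [min_le_right 1 (η / 16)]⟩
  obtain ⟨h, hh, h0, hhu⟩ := exists_entire_re_near (u := fun t ↦ u t + δ) (by fun_prop)
    (fun t ↦ by simp [hper t]) hδ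
  have hc : Continuous h := hh.continuous
  refine ⟨h, hh, fun t ↦ by linarith [abs_le.1 (hhu t)], (integral_sq_norm_le hh h0).trans ?_⟩
  have hle : ∫ t in (-(1 / 2) : ℝ)..(1 / 2), (h (character 1 t)).re ^ 2 ≤
      ∫ t in (-(1 / 2) : ℝ)..(1 / 2), (u t ^ 2 + 8 * δ) := by
    refine intervalIntegral.integral_mono_on (by norm_num)
      (Continuous.intervalIntegrable (by fun_prop) _ _)
      (Continuous.intervalIntegrable (by fun_prop) _ _) fun t _ ↦ ?_
    have h1 := abs_le.1 (hhu t)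
    have h2 : (h (character 1 t)).re ≤ u t + 2 * δ := by linarith
    have h3 : 0 ≤ (h (character 1 t)).re := by linarith [hu0 t]
    nlinarith [hu0 t, hu1 t]
  rw [intervalIntegral.integral_add (Continuous.intervalIntegrable (by fun_prop) _ _)
    (Continuous.intervalIntegrable (by fun_prop) _ _), intervalIntegral.integral_const] at hle
  norm_num at hle ⊢
  linarith

lemma norm_exp_neg_sub_one_le {w : ℂ} (hw : 0 ≤ w.re) : ‖exp (-w) - 1‖ ≤ ‖w‖ := by
  have h := (convex_halfSpace_re_le 0).norm_image_sub_le_of_norm_deriv_le (f := exp) (C := 1)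
    (x := 0) (y := -w) (fun z _ ↦ differentiableAt_exp) (fun z hz ↦ ?_) (by simp) (by simpa using hw)
  · simpa using h
  · simpa [Complex.norm_exp] using hz

/-- Convexity of `x ↦ exp (-c x)` keeps the recursively built test function bounded. -/
lemma mul_exp_add_le {C c x : ℝ} (hC : C * (1 - Real.exp (-c)) = 1) (hC0 : 0 ≤ C)
    (hx0 : 0 ≤ x) (hx1 : x ≤ 1) : C * Real.exp (-(c * x)) + x ≤ C := by
  have h := convexOn_exp.2 (Set.mem_univ 0) (Set.mem_univ (-c)) (sub_nonneg.2 hx1) hx0 (by ring)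
  simp only [smul_eq_mul, mul_zero, zero_add, Real.exp_zero, mul_one] at h
  rw [show -(c * x) = x * -c by ring]
  nlinarith [mul_le_mul_of_nonneg_left h hC0]

/-- The first index of the `j`-th block; this block consists of `64 ^ j` indices. -/
def blockStart (j : ℕ) : ℕ := ∑ i ∈ Finset.range j, 64 ^ i

lemma blockStart_succ (j : ℕ) : blockStart (j + 1) = blockStart j + 64 ^ j :=
  Finset.sum_range_succ _ _

lemma monotone_blockStart : Monotone blockStart :=
  monotone_nat_of_le_succ fun j ↦ by simp [blockStart_succ]

lemma blockStart_mul (j : ℕ) : 63 * blockStart j + 1 = 64 ^ j := by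
  induction j with
  | zero => rfl
  | succ j ih => rw [blockStart_succ, pow_succ]; omega

/-- The normalised sum of the characters of the `j`-th block. -/
noncomputable def blockMean (a : ℕ → ℤ) (j : ℕ) (t : ℝ) : ℂ :=
  (64 ^ j)⁻¹ * ∑ i ∈ Finset.Ico (blockStart j) (blockStart (j + 1)), character (a i) t

@[fun_prop]
lemma continuous_blockMean (a : ℕ → ℤ) (j : ℕ) : Continuous (blockMean a j) := by
  unfold blockMean
  fun_prop

lemma periodic_blockMean (a : ℕ → ℤ) (j : ℕ) : Function.Periodic (blockMean a j) 1 :=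
  fun t ↦ by simp_rw [blockMean, periodic_character _ t]

lemma card_block (j : ℕ) : (Finset.Ico (blockStart j) (blockStart (j + 1))).card = 64 ^ j := by
  simp [blockStart_succ]

lemma norm_blockMean_le (a : ℕ → ℤ) (j : ℕ) (t : ℝ) : ‖blockMean a j t‖ ≤ 1 := by
  have h := norm_sum_le (Finset.Ico (blockStart j) (blockStart (j + 1))) (fun i ↦ character (a i) t)
  simp only [norm_character, Finset.sum_const, card_block, nsmul_eq_mul, mul_one] at h
  rw [blockMean, norm_mul, norm_inv, norm_pow, norm_ofNat]
  exact inv_mul_le_one_of_le₀ (by exact_mod_cast h) (by positivity)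

lemma integral_sq_norm_blockMean {a : ℕ → ℤ} {j : ℕ}
    (ha : Set.InjOn a (Set.Iio (blockStart (j + 1)))) :
    ∫ t in (-(1 / 2) : ℝ)..(1 / 2), ‖blockMean a j t‖ ^ 2 = (64 ^ j)⁻¹ := by
  have h := integral_sq_norm_sum_character (s := Finset.Ico (blockStart j) (blockStart (j + 1)))
    (ha.mono fun i hi ↦ by simp at hi ⊢; omega)
  rw [card_block] at h
  simp_rw [blockMean, norm_mul, mul_pow]
  rw [intervalIntegral.integral_const_mul, h, norm_inv, norm_pow, norm_ofNat]
  push_cast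
  field_simp

/-- The entire factor attached to the `j`-th block in the test function. -/
noncomputable def tailFactor (h : ℕ → ℂ → ℂ) (j M : ℕ) (z : ℂ) : ℂ :=
  exp (-(3 / 2 * ∑ l ∈ Finset.Ico (j + 1) M, h l z))

lemma differentiable_tailFactor {h : ℕ → ℂ → ℂ} (hh : ∀ l, Differentiable ℂ (h l)) (j M : ℕ) :
    Differentiable ℂ (tailFactor h j M) := by
  unfold tailFactor
  fun_prop

/-- The McGehee–Pigno–Smith test function with blocks of size `64 ^ j`. -/
noncomputable def testFunction (a : ℕ → ℤ) (h : ℕ → ℂ → ℂ) (M : ℕ) (t : ℝ) : ℂ :=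
  ∑ j ∈ Finset.range M, blockMean a j t * tailFactor h j M (character 1 t)

lemma testFunction_succ (a : ℕ → ℤ) (h : ℕ → ℂ → ℂ) (M : ℕ) (t : ℝ) :
    testFunction a h (M + 1) t =
      testFunction a h M t * exp (-(3 / 2 * h M (character 1 t))) + blockMean a M t := by
  rw [testFunction, Finset.sum_range_succ, testFunction, Finset.sum_mul]
  congr 1
  · refine Finset.sum_congr rfl fun j hj ↦ ?_
    rw [tailFactor, tailFactor, Finset.sum_Ico_succ_top (by simpa using hj), mul_assoc, ← exp_add]
    ring_nf
  · simp [tailFactor]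

lemma norm_testFunction_le {a : ℕ → ℤ} {h : ℕ → ℂ → ℂ}
    (hh : ∀ l t, ‖blockMean a l t‖ ≤ (h l (character 1 t)).re) (M : ℕ) (t : ℝ) :
    ‖testFunction a h M t‖ ≤ (1 - Real.exp (-(3 / 2)))⁻¹ := by
  have hpos : 0 < 1 - Real.exp (-(3 / 2)) := by simp
  induction M with
  | zero => simpa [testFunction] using hpos.le
  | succ M ih =>
    rw [testFunction_succ]
    refine (norm_add_le _ _).trans (le_trans ?_ (mul_exp_add_le (inv_mul_cancel₀ hpos.ne')
      (by positivity) (norm_nonneg _) (norm_blockMean_le a M t)))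
    rw [norm_mul, Complex.norm_exp]
    gcongr
    simpa using hh M t

lemma norm_tailFactor_sub_one_le {h : ℕ → ℂ → ℂ} {z : ℂ} (hh : ∀ l, 0 ≤ (h l z).re) (j M : ℕ) :
    ‖tailFactor h j M z - 1‖ ≤ 3 / 2 * ∑ l ∈ Finset.Ico (j + 1) M, ‖h l z‖ := by
  refine (norm_exp_neg_sub_one_le ?_).trans ?_
  · simpa using Finset.sum_nonneg fun l _ ↦ hh l
  · rw [norm_mul]
    norm_num
    exact norm_sum_le _ _

lemma sum_Ico_inv_pow_le (j M : ℕ) :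
    ∑ l ∈ Finset.Ico (j + 1) M, ((8 : ℝ) ^ l)⁻¹ ≤ 1 / 7 * (8 ^ j)⁻¹ := by
  rcases le_or_gt (j + 1) M with h | h
  · suffices ∑ l ∈ Finset.Ico (j + 1) M, ((8 : ℝ) ^ l)⁻¹ =
        1 / 7 * (8 ^ j)⁻¹ - 8 / 7 * (8 ^ M)⁻¹ by
      rw [this]
      have : (0 : ℝ) ≤ (8 ^ M)⁻¹ := by positivity
      linarith
    induction M, h using Nat.le_induction with
    | base => rw [Finset.Ico_self, Finset.sum_empty, pow_succ]; field_simp; ring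
    | succ M h ih => rw [Finset.sum_Ico_succ_top h, ih, pow_succ]; field_simp; ring
  · rw [Finset.Ico_eq_empty (by omega), Finset.sum_empty]
    positivity

/-- Weighted arithmetic–geometric mean form of the Cauchy–Schwarz inequality for two blocks. -/
lemma integral_norm_mul_norm_le {D : ℝ → ℂ} {g : ℝ → ℂ} (hD : Continuous D) (hg : Continuous g)
    {j l : ℕ} (hD2 : ∫ t in (-(1 / 2) : ℝ)..(1 / 2), ‖D t‖ ^ 2 ≤ 64 / 63 * 64 ^ j)
    (hg2 : ∫ t in (-(1 / 2) : ℝ)..(1 / 2), ‖g t‖ ^ 2 ≤ 2001 / 1000 * (64 ^ l)⁻¹) :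
    ∫ t in (-(1 / 2) : ℝ)..(1 / 2), ‖D t‖ * ‖g t‖ ≤ 713 / 500 * (8 ^ j * (8 ^ l)⁻¹) := by
  have hj : (64 : ℝ) ^ j = 8 ^ j * 8 ^ j := by rw [← mul_pow]; norm_num
  have hl : (64 : ℝ) ^ l = 8 ^ l * 8 ^ l := by rw [← mul_pow]; norm_num
  obtain ⟨x, hx⟩ : ∃ x : ℝ, x = 8 ^ j := ⟨_, rfl⟩
  obtain ⟨y, hy⟩ : ∃ y : ℝ, y = 8 ^ l := ⟨_, rfl⟩
  have hx0 : 0 < x := hx ▸ by positivity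
  have hy0 : 0 < y := hy ▸ by positivity
  rw [hj, ← hx] at hD2
  rw [hl, ← hy] at hg2
  rw [← hx, ← hy]
  have hs : 0 < 7 / 5 * (x * y)⁻¹ := by positivity
  obtain ⟨s, hs'⟩ : ∃ s : ℝ, s = 7 / 5 * (x * y)⁻¹ := ⟨_, rfl⟩
  rw [← hs'] at hs
  have hle : ∫ t in (-(1 / 2) : ℝ)..(1 / 2), ‖D t‖ * ‖g t‖ ≤
      ∫ t in (-(1 / 2) : ℝ)..(1 / 2), (s / 2 * ‖D t‖ ^ 2 + s⁻¹ / 2 * ‖g t‖ ^ 2) := by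
    refine intervalIntegral.integral_mono_on (by norm_num)
      (Continuous.intervalIntegrable (by fun_prop) _ _)
      (Continuous.intervalIntegrable (by fun_prop) _ _) fun t _ ↦ ?_
    have : s / 2 * ‖D t‖ ^ 2 + s⁻¹ / 2 * ‖g t‖ ^ 2 - ‖D t‖ * ‖g t‖ =
      (s * ‖D t‖ - ‖g t‖) ^ 2 / (2 * s) := by field_simp; ring
    rw [← sub_nonneg, this]
    positivity
  rw [intervalIntegral.integral_add (Continuous.intervalIntegrable (by fun_prop) _ _)
    (Continuous.intervalIntegrable (by fun_prop) _ _), intervalIntegral.integral_const_mul,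
    intervalIntegral.integral_const_mul] at hle
  refine hle.trans ((add_le_add (mul_le_mul_of_nonneg_left hD2 (by positivity))
    (mul_le_mul_of_nonneg_left hg2 (by positivity))).trans ?_)
  have : s / 2 * (64 / 63 * (x * x)) + s⁻¹ / 2 * (2001 / 1000 * (y * y)⁻¹) =
      (7 / 5 * (64 / 63) / 2 + 5 / 7 * (2001 / 1000) / 2) * (x * y⁻¹) := by
    rw [hs']
    field_simp
  rw [this]
  exact mul_le_mul_of_nonneg_right (by norm_num) (by positivity)

lemma le_re_integral_block {a : ℕ → ℤ} {h : ℕ → ℂ → ℂ} {j M N : ℕ} (hjM : j < M)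
    (hMN : blockStart M ≤ N) (ha : StrictAntiOn a (Set.Iio N)) (hd : ∀ l, Differentiable ℂ (h l))
    (hre : ∀ l t, 0 ≤ (h l (character 1 t)).re)
    (hL2 : ∀ l < M, ∫ t in (-(1 / 2) : ℝ)..(1 / 2), ‖h l (character 1 t)‖ ^ 2 ≤
      2001 / 1000 * (64 ^ l)⁻¹) :
    434 / 625 ≤ (∫ t in (-(1 / 2) : ℝ)..(1 / 2), conj (∑ i ∈ Finset.range N, character (a i) t) *
      (blockMean a j t * tailFactor h j M (character 1 t))).re := by
  have hdt := differentiable_tailFactor hd j M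
  have hct : Continuous (tailFactor h j M) := hdt.continuous
  have hc (l : ℕ) : Continuous (h l) := (hd l).continuous
  have hjN : blockStart (j + 1) ≤ N := (monotone_blockStart hjM).trans hMN
  have hinj : Set.InjOn a (Finset.range (blockStart (j + 1))) :=
    ha.injOn.mono fun i hi ↦ by simp at hi ⊢; omega
  set D : ℝ → ℂ := fun t ↦ ∑ i ∈ Finset.range (blockStart (j + 1)), character (a i) t with hD
  have hDc : Continuous D := by fun_prop
  have hfar : ∫ t in (-(1 / 2) : ℝ)..(1 / 2),
      conj (∑ i ∈ Finset.Ico (blockStart (j + 1)) N, character (a i) t) *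
        (blockMean a j t * tailFactor h j M (character 1 t)) = 0 := by
    simp_rw [blockMean, mul_assoc, mul_left_comm _ ((64 ^ j : ℂ)⁻¹), map_sum, conj_character,
      ← mul_assoc _ _ (tailFactor h j M _), mul_assoc ((64 ^ j : ℂ)⁻¹)]
    rw [intervalIntegral.integral_const_mul]
    simp_rw [Finset.sum_mul_sum, ← character_add, Finset.sum_mul]
    rw [intervalIntegral.integral_finsetSum
      fun i _ ↦ Continuous.intervalIntegrable (by fun_prop) _ _, Finset.sum_eq_zero, mul_zero]
    intro i hi
    rw [intervalIntegral.integral_finsetSum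
      fun i _ ↦ Continuous.intervalIntegrable (by fun_prop) _ _]
    refine Finset.sum_eq_zero fun k hk ↦ integral_character_mul_entire hdt ?_
    rw [Finset.mem_Ico] at hi hk
    have := ha (show k < N by omega) (show i < N by omega) (by omega)
    omega
  have hmain : ∫ t in (-(1 / 2) : ℝ)..(1 / 2), conj (D t) * blockMean a j t = 1 := by
    simp_rw [blockMean, mul_left_comm _ ((64 ^ j : ℂ)⁻¹)]
    rw [intervalIntegral.integral_const_mul, integral_conj_sum_character_mul_sum_character
      (fun i hi ↦ by simp at hi ⊢; omega) hinj, card_block]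
    push_cast
    field_simp
  have hD2 : ∫ t in (-(1 / 2) : ℝ)..(1 / 2), ‖D t‖ ^ 2 ≤ 64 / 63 * 64 ^ j := by
    rw [integral_sq_norm_sum_character hinj, Finset.card_range]
    have := congrArg (Nat.cast (R := ℝ)) (blockStart_mul (j + 1))
    push_cast [pow_succ] at this
    linarith
  have herr : ‖∫ t in (-(1 / 2) : ℝ)..(1 / 2),
      conj (D t) * (blockMean a j t * (tailFactor h j M (character 1 t) - 1))‖ ≤ 191 / 625 := by
    calc
      _ ≤ ∫ t in (-(1 / 2) : ℝ)..(1 / 2), 3 / 2 * ∑ l ∈ Finset.Ico (j + 1) M,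
          ‖D t‖ * ‖h l (character 1 t)‖ := by
        refine intervalIntegral.norm_integral_le_of_norm_le (by norm_num)
          (Filter.Eventually.of_forall fun t _ ↦ ?_)
          (Continuous.intervalIntegrable (by fun_prop) _ _)
        rw [norm_mul, norm_mul, norm_conj, ← Finset.mul_sum, mul_left_comm (3 / 2 : ℝ)]
        refine mul_le_mul_of_nonneg_left ?_ (norm_nonneg _)
        exact (mul_le_of_le_one_left (norm_nonneg _) (norm_blockMean_le a j t)).trans
          (norm_tailFactor_sub_one_le (hre · t) j M)
      _ = 3 / 2 * ∑ l ∈ Finset.Ico (j + 1) M,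
          ∫ t in (-(1 / 2) : ℝ)..(1 / 2), ‖D t‖ * ‖h l (character 1 t)‖ := by
        rw [intervalIntegral.integral_const_mul, intervalIntegral.integral_finsetSum
          fun i _ ↦ Continuous.intervalIntegrable (by fun_prop) _ _]
      _ ≤ 3 / 2 * ∑ l ∈ Finset.Ico (j + 1) M, 713 / 500 * (8 ^ j * (8 ^ l)⁻¹) := by
        gcongr with l hl
        exact integral_norm_mul_norm_le hDc (by fun_prop) hD2 (hL2 l (Finset.mem_Ico.1 hl).2)
      _ ≤ 3 / 2 * (713 / 500 * (8 ^ j * (1 / 7 * (8 ^ j)⁻¹))) := by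
        rw [← Finset.mul_sum, ← Finset.mul_sum]
        gcongr
        exact sum_Ico_inv_pow_le j M
      _ ≤ 191 / 625 := by
        rw [mul_left_comm (8 ^ j : ℝ), mul_inv_cancel₀ (by positivity)]
        norm_num
  have hsplit : ∫ t in (-(1 / 2) : ℝ)..(1 / 2),
      conj (∑ i ∈ Finset.range N, character (a i) t) *
        (blockMean a j t * tailFactor h j M (character 1 t)) =
      (∫ t in (-(1 / 2) : ℝ)..(1 / 2), conj (D t) * blockMean a j t) +
      (∫ t in (-(1 / 2) : ℝ)..(1 / 2),
        conj (D t) * (blockMean a j t * (tailFactor h j M (character 1 t) - 1))) +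
      ∫ t in (-(1 / 2) : ℝ)..(1 / 2),
        conj (∑ i ∈ Finset.Ico (blockStart (j + 1)) N, character (a i) t) *
          (blockMean a j t * tailFactor h j M (character 1 t)) := by
    rw [← intervalIntegral.integral_add
      (Continuous.intervalIntegrable (by fun_prop) _ _)
      (Continuous.intervalIntegrable (by fun_prop) _ _), ← intervalIntegral.integral_add
      (Continuous.intervalIntegrable (by fun_prop) _ _)
      (Continuous.intervalIntegrable (by fun_prop) _ _)]
    refine intervalIntegral.integral_congr fun t _ ↦ ?_
    simp only [hD]
    rw [← Finset.sum_range_add_sum_Ico _ hjN, map_add]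
    ring
  rw [hsplit, hmain, hfar, add_zero, add_re, one_re]
  linarith [(abs_le.1 ((abs_re_le_norm _).trans herr)).1]

lemma mul_le_integral_norm_sum_character {a : ℕ → ℤ} {M N : ℕ} (hMN : blockStart M ≤ N)
    (ha : StrictAntiOn a (Set.Iio N)) :
    M * (434 / 625 * (1 - Real.exp (-(3 / 2)))) ≤
      ∫ t in (-(1 / 2) : ℝ)..(1 / 2), ‖∑ i ∈ Finset.range N, character (a i) t‖ := by
  have hpos : 0 < 1 - Real.exp (-(3 / 2)) := by simp
  choose h hd hre hL2 using fun j ↦ exists_entire_majorant (u := fun t ↦ ‖blockMean a j t‖)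
    (by fun_prop) (fun t ↦ by simp [periodic_blockMean a j t]) (fun t ↦ norm_nonneg _)
    (norm_blockMean_le a j) (η := (64 ^ j)⁻¹ / 1000) (by positivity)
  have hc (l : ℕ) : Continuous (h l) := (hd l).continuous
  have hct (j : ℕ) : Continuous (tailFactor h j M) := (differentiable_tailFactor hd j M).continuous
  have hL2' (l : ℕ) (hl : l < M) : ∫ t in (-(1 / 2) : ℝ)..(1 / 2), ‖h l (character 1 t)‖ ^ 2 ≤
      2001 / 1000 * (64 ^ l)⁻¹ := by
    have hlN : blockStart (l + 1) ≤ N := (monotone_blockStart hl).trans hMN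
    refine (hL2 l).trans_eq ?_
    rw [integral_sq_norm_blockMean (ha.injOn.mono (Set.Iio_subset_Iio hlN))]
    ring
  have hlower : M * (434 / 625) ≤ (∫ t in (-(1 / 2) : ℝ)..(1 / 2),
      conj (∑ i ∈ Finset.range N, character (a i) t) * testFunction a h M t).re := by
    simp_rw [testFunction, Finset.mul_sum]
    rw [intervalIntegral.integral_finsetSum
      fun i _ ↦ Continuous.intervalIntegrable (by fun_prop) _ _, re_sum]
    simpa using Finset.card_nsmul_le_sum (Finset.range M) _ _ fun j hj ↦
      le_re_integral_block (Finset.mem_range.1 hj) hMN ha hd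
        (fun l t ↦ (norm_nonneg _).trans (hre l t)) hL2'
  have hupper : ‖∫ t in (-(1 / 2) : ℝ)..(1 / 2),
      conj (∑ i ∈ Finset.range N, character (a i) t) * testFunction a h M t‖ ≤
      ∫ t in (-(1 / 2) : ℝ)..(1 / 2), ‖∑ i ∈ Finset.range N, character (a i) t‖ *
        (1 - Real.exp (-(3 / 2)))⁻¹ := by
    refine intervalIntegral.norm_integral_le_of_norm_le (by norm_num)
      (Filter.Eventually.of_forall fun t _ ↦ ?_) (Continuous.intervalIntegrable (by fun_prop) _ _)
    rw [norm_mul, norm_conj]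
    gcongr
    exact norm_testFunction_le hre M t
  rw [intervalIntegral.integral_mul_const] at hupper
  rw [← mul_assoc, ← le_div_iff₀ hpos, div_eq_mul_inv]
  exact hlower.trans ((re_le_norm _).trans hupper)

lemma log_le_of_lt_blockStart {M N : ℕ} (hN : 0 < N) (hNM : N < blockStart (M + 1)) :
    Real.log N ≤ M * (6 * Real.log 2) + 1 / 63 := by
  have h1 : (N : ℝ) ≤ 2 ^ (6 * M) * (64 / 63) := by
    have h2 : 63 * N ≤ 64 * 64 ^ M := by
      have := blockStart_mul (M + 1)
      rw [pow_succ] at this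
      omega
    have h3 : (63 * N : ℝ) ≤ 64 * 64 ^ M := by exact_mod_cast h2
    rw [pow_mul]
    norm_num
    linarith
  have h4 := Real.log_le_log (by positivity) h1
  rw [Real.log_mul (by positivity) (by norm_num), Real.log_pow] at h4
  have h5 := Real.log_le_sub_one_of_pos (show (0 : ℝ) < 64 / 63 by norm_num)
  push_cast at h4
  linarith

lemma exp_neg_three_halves_lt : Real.exp (-(3 / 2)) < 2232 / 10000 := by
  refine lt_of_pow_lt_pow_left₀ 2 (by norm_num) ?_
  rw [← Real.exp_nat_mul, show ((2 : ℕ) : ℝ) * -(3 / 2) = -((3 : ℕ) * 1) by norm_num,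
    Real.exp_neg, Real.exp_nat_mul]
  have h : (2.718 : ℝ) ^ 3 ≤ Real.exp 1 ^ 3 :=
    pow_le_pow_left₀ (by norm_num) (by linarith [Real.exp_one_gt_d9]) 3
  exact (inv_anti₀ (by norm_num) h).trans_lt (by norm_num)

lemma four_div_pi_pow_three_lt : 4 / Real.pi ^ 3 < 129025 / 1000000 := by
  have h : (3.1415 : ℝ) ^ 3 ≤ Real.pi ^ 3 :=
    pow_le_pow_left₀ (by norm_num) (by linarith [Real.pi_gt_d4]) 3
  exact (div_le_div_of_nonneg_left (by norm_num) (by norm_num) h).trans_lt (by norm_num)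

end Littlewood

/-- Stegeman–Yabuta improvement of the constant in the Littlewood conjecture. -/
theorem stegeman_yabuta (N : ℕ) (hN : 4 ≤ N) (n : Fin N → ℤ) (hn : StrictMono n) :
    (4 / Real.pi ^ 3) * Real.log N ≤
      ∫ t in (-(1/2) : ℝ)..(1/2 : ℝ),
        ‖∑ k : Fin N, Complex.exp (((2 * Real.pi * (n k : ℝ) * t : ℝ) : ℂ) * Complex.I)‖ := by
  set a : ℕ → ℤ := fun i ↦ if hi : i < N then n (Fin.rev ⟨i, hi⟩) else 0 with ha_def
  have ha : StrictAntiOn a (Set.Iio N) := by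
    intro i hi k hk hik
    rw [Set.mem_Iio] at hi hk
    simp only [ha_def, hi, hk, dif_pos]
    exact hn (Fin.rev_lt_rev.2 hik)
  have hsum (t : ℝ) : ∑ i ∈ Finset.range N, Littlewood.character (a i) t =
      ∑ k : Fin N, Complex.exp (((2 * Real.pi * (n k : ℝ) * t : ℝ) : ℂ) * Complex.I) := by
    simp only [Finset.sum_range, ha_def, Fin.is_lt, dif_pos, Fin.eta]
    exact Equiv.sum_comp Fin.revPerm fun k ↦ Littlewood.character (n k) t
  simp_rw [← hsum]
  obtain ⟨M, hM, hMN, hNM⟩ : ∃ M, 1 ≤ M ∧ Littlewood.blockStart M ≤ N ∧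
      N < Littlewood.blockStart (M + 1) := by
    have hex : ∃ M, N < Littlewood.blockStart (M + 1) :=
      ⟨N, by
        have := Littlewood.blockStart_mul (N + 1)
        have := Nat.lt_pow_self (n := N) (a := 64) (by norm_num)
        rw [pow_succ] at *
        omega⟩
    have hspec := Nat.find_spec hex
    have hpos : 1 ≤ Nat.find hex := by
      rw [Nat.one_le_iff_ne_zero]
      intro h0
      rw [h0] at hspec
      simp [Littlewood.blockStart] at hspec
      omega
    refine ⟨Nat.find hex, hpos, ?_, hspec⟩
    have := Nat.find_min hex (m := Nat.find hex - 1) (by omega)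
    rw [Nat.sub_add_cancel hpos] at this
    omega
  refine le_trans ?_ (Littlewood.mul_le_integral_norm_sum_character hMN ha)
  have hM' : (1 : ℝ) ≤ M := by exact_mod_cast hM
  have hlog : Real.log N ≤ M * (4159 / 1000 + 1 / 63) := by
    have := Littlewood.log_le_of_lt_blockStart (by omega) hNM
    nlinarith [Real.log_two_lt_d9]
  calc
    _ ≤ (129025 / 1000000 : ℝ) * (M * (4159 / 1000 + 1 / 63)) :=
      mul_le_mul Littlewood.four_div_pi_pow_three_lt.le hlog
        (Real.log_nonneg (by exact_mod_cast (by omega : 1 ≤ N))) (by norm_num)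
    _ ≤ M * (434 / 625 * (1 - Real.exp (-(3 / 2)))) := by
      nlinarith [Littlewood.exp_neg_three_halves_lt]
end

section
/- For distinct real numbers λ_1, ..., λ_N and complex numbers a_1, ..., a_N, the limit as T → ∞ of (1/T) ∫_{-T/2}^{T/2} |∑_{k=1}^N a_k e^{2πi λ_k t}| dt exists and is at least (1/26) ∑_{k=1}^N |a_k|/(k+1), where the λ_k are listed in increasing order. -/
open MeasureTheory intervalIntegral Filter

open scoped BoundedContinuousFunction Topology ComplexConjugate

namespace TrigPoly

/-- The character `t ↦ exp (2 π i x t)` of `ℝ`. -/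
noncomputable def bohrChar (x : ℝ) : ℝ →ᵇ ℂ :=
  BoundedContinuousFunction.ofNormedAddCommGroup
    (fun t : ℝ => Complex.exp (((2 * Real.pi * x * t : ℝ) : ℂ) * Complex.I))
    (by fun_prop) 1 (fun t => (Complex.norm_exp_ofReal_mul_I _).le)

lemma bohrChar_apply (x t : ℝ) :
    bohrChar x t = Complex.exp (((2 * Real.pi * x * t : ℝ) : ℂ) * Complex.I) := rfl

lemma norm_bohrChar_apply (x t : ℝ) : ‖bohrChar x t‖ = 1 :=
  Complex.norm_exp_ofReal_mul_I _

lemma bohrChar_zero : bohrChar 0 = 1 := by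
  ext t
  simp [bohrChar_apply]

lemma bohrChar_add (x y : ℝ) : bohrChar (x + y) = bohrChar x * bohrChar y := by
  ext t
  rw [BoundedContinuousFunction.mul_apply, bohrChar_apply, bohrChar_apply, bohrChar_apply,
    ← Complex.exp_add]
  push_cast
  ring_nf

lemma star_bohrChar (x : ℝ) : star (bohrChar x) = bohrChar (-x) := by
  ext t
  simp only [BoundedContinuousFunction.star_apply, bohrChar_apply, RCLike.star_def,
    ← Complex.exp_conj, map_mul, Complex.conj_I, Complex.conj_ofReal]
  push_cast
  ring_nf

/-- The characters with frequency in `S`. -/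
def charSubmonoid (S : AddSubmonoid ℝ) : Submonoid (ℝ →ᵇ ℂ) where
  carrier := Set.image bohrChar S
  one_mem' := ⟨0, S.zero_mem, bohrChar_zero⟩
  mul_mem' := by
    rintro _ _ ⟨x, hx, rfl⟩ ⟨y, hy, rfl⟩
    exact ⟨x + y, S.add_mem hx hy, bohrChar_add x y⟩

/-- The algebra of trigonometric polynomials with frequencies in `S`. -/
noncomputable def trigAlgebra (S : AddSubmonoid ℝ) : Subalgebra ℂ (ℝ →ᵇ ℂ) :=
  Algebra.adjoin ℂ (charSubmonoid S : Set (ℝ →ᵇ ℂ))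

lemma bohrChar_mem {S : AddSubmonoid ℝ} {x : ℝ} (hx : x ∈ S) : bohrChar x ∈ trigAlgebra S :=
  Algebra.subset_adjoin ⟨x, hx, rfl⟩

lemma trigAlgebra_induction {S : AddSubmonoid ℝ} {P : (ℝ →ᵇ ℂ) → Prop}
    (char : ∀ x ∈ S, P (bohrChar x)) (zero : P 0) (add : ∀ f g, P f → P g → P (f + g))
    (smul : ∀ (c : ℂ) f, P f → P (c • f)) {f : ℝ →ᵇ ℂ} (hf : f ∈ trigAlgebra S) : P f := by
  have hf' : f ∈ Submodule.span ℂ (charSubmonoid S : Set (ℝ →ᵇ ℂ)) := by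
    have := Algebra.adjoin_eq_span ℂ (charSubmonoid S : Set (ℝ →ᵇ ℂ))
    rw [Submonoid.closure_eq] at this
    rw [← this]
    exact hf
  clear hf
  induction hf' using Submodule.span_induction with
  | mem f hf' =>
    obtain ⟨x, hx, rfl⟩ := hf'
    exact char x hx
  | zero => exact zero
  | add f g _ _ hf hg => exact add f g hf hg
  | smul c f _ hf => exact smul c f hf

lemma star_mem_trigAlgebra {f : ℝ →ᵇ ℂ} (hf : f ∈ trigAlgebra ⊤) : star f ∈ trigAlgebra ⊤ := by
  refine trigAlgebra_induction (P := fun f => star f ∈ trigAlgebra ⊤) (fun x _ => ?_) ?_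
    (fun f g hf hg => ?_) (fun c f hf => ?_) hf
  · rw [star_bohrChar]
    exact bohrChar_mem (AddSubmonoid.mem_top _)
  · simp
  · rw [star_add]
    exact add_mem hf hg
  · rw [star_smul]
    exact Subalgebra.smul_mem _ hf _

/-- The modulus of a trigonometric polynomial is approximated from above, uniformly,
by real-valued trigonometric polynomials. -/
lemma exists_trig_near_norm {f : ℝ →ᵇ ℂ} (hf : f ∈ trigAlgebra ⊤) {δ : ℝ} (hδ : 0 < δ) :
    ∃ p ∈ trigAlgebra ⊤, ∀ t, ((p t).re : ℂ) = p t ∧ ‖f t‖ ≤ (p t).re ∧ (p t).re ≤ ‖f t‖ + δ := by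
  obtain ⟨q, hq⟩ := exists_polynomial_near_of_continuousOn 0 (‖f‖ ^ 2) Real.sqrt
    Real.continuous_sqrt.continuousOn (δ / 2) (by positivity)
  have hval : ∀ t, (Polynomial.aeval (f * star f) (q.map Complex.ofRealHom)) t
      = ((q.eval (‖f t‖ ^ 2) : ℝ) : ℂ) := by
    intro t
    have hsq : (f * star f) t = ((‖f t‖ ^ 2 : ℝ) : ℂ) := by
      simp [Complex.mul_conj, Complex.normSq_eq_norm_sq]
    generalize ‖f t‖ ^ 2 = y at hsq
    generalize f * star f = g at hsq
    clear hq
    induction q using Polynomial.induction_on' with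
    | add p q hp hq =>
      simp only [Polynomial.map_add, map_add, BoundedContinuousFunction.add_apply,
        Polynomial.eval_add, Complex.ofReal_add, hp, hq]
    | monomial n a =>
      simp [Polynomial.map_monomial, Polynomial.aeval_monomial, hsq]
  refine ⟨Polynomial.aeval (f * star f) (q.map Complex.ofRealHom) + ((δ / 2 : ℝ) : ℂ) • 1,
    ?_, ?_⟩
  · refine add_mem ?_ (Subalgebra.smul_mem _ (one_mem _) _)
    exact Algebra.adjoin_le (Set.singleton_subset_iff.2 (mul_mem hf (star_mem_trigAlgebra hf)))
      (Polynomial.aeval_mem_adjoin_singleton ℂ _)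
  · intro t
    have hb := hq (‖f t‖ ^ 2) ⟨by positivity, by gcongr; exact f.norm_coe_le_norm t⟩
    rw [Real.sqrt_sq (norm_nonneg _), abs_lt] at hb
    rw [BoundedContinuousFunction.add_apply, hval, BoundedContinuousFunction.smul_apply]
    simp only [BoundedContinuousFunction.coe_one, Pi.one_apply, smul_eq_mul, mul_one,
      ← Complex.ofReal_add, Complex.ofReal_re, true_and]
    constructor <;> linarith

/-- Averaging over `[-T/2, T/2]`. -/
noncomputable def avg (T : ℝ) (f : ℝ →ᵇ ℂ) : ℂ :=
  ((1 / T : ℝ) : ℂ) * ∫ t in (-(T / 2))..(T / 2), f t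

lemma avg_add (T : ℝ) (f g : ℝ →ᵇ ℂ) : avg T (f + g : ℝ →ᵇ ℂ) = avg T f + avg T g := by
  unfold avg
  rw [← mul_add, ← intervalIntegral.integral_add (f.continuous.intervalIntegrable _ _)
    (g.continuous.intervalIntegrable _ _)]
  rfl

lemma avg_smul (T : ℝ) (c : ℂ) (f : ℝ →ᵇ ℂ) : avg T (c • f : ℝ →ᵇ ℂ) = c * avg T f := by
  unfold avg
  rw [mul_left_comm]
  congr 1
  exact intervalIntegral.integral_const_mul c f

lemma norm_avg_le {T : ℝ} (hT : 0 < T) {f h : ℝ →ᵇ ℂ} (hfh : ∀ t, ‖f t‖ ≤ (h t).re) :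
    ‖avg T f‖ ≤ (avg T h).re := by
  unfold avg
  rw [Complex.re_ofReal_mul, norm_mul, Complex.norm_real, Real.norm_of_nonneg (by positivity)]
  gcongr
  have hre : (∫ t in (-(T / 2))..(T / 2), h t).re = ∫ t in (-(T / 2))..(T / 2), (h t).re :=
    (intervalIntegral_re (h.continuous.intervalIntegrable _ _)).symm
  rw [hre]
  exact intervalIntegral.norm_integral_le_of_norm_le (by linarith)
    (Eventually.of_forall fun t _ => hfh t)
    ((Complex.continuous_re.comp h.continuous).intervalIntegrable _ _)

lemma avg_const {T : ℝ} (hT : 0 < T) (c : ℂ) : avg T (c • 1 : ℝ →ᵇ ℂ) = c := by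
  have : (T : ℂ) ≠ 0 := by exact_mod_cast hT.ne'
  simp [avg]
  field_simp

lemma norm_avg_le_norm {T : ℝ} (hT : 0 < T) (f : ℝ →ᵇ ℂ) : ‖avg T f‖ ≤ ‖f‖ := by
  have := norm_avg_le (f := f) (h := (‖f‖ : ℂ) • 1) hT (fun t => by
    simpa using f.norm_coe_le_norm t)
  rwa [avg_const hT, Complex.ofReal_re] at this

lemma tendsto_avg_bohrChar {x : ℝ} (hx : x ≠ 0) :
    Tendsto (fun T => avg T (bohrChar x)) atTop (𝓝 0) := by
  have hc : (((2 * Real.pi * x : ℝ) : ℂ) * Complex.I) ≠ 0 := by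
    simp [hx, Real.pi_ne_zero]
  set c : ℂ := ((2 * Real.pi * x : ℝ) : ℂ) * Complex.I with hc_def
  have key : ∀ T : ℝ, 0 < T → ‖avg T (bohrChar x)‖ ≤ (2 / ‖c‖) * (1 / T) := by
    intro T hT
    unfold avg
    have h1 : ∀ t : ℝ, bohrChar x t = Complex.exp (c * t) := by
      intro t
      rw [bohrChar_apply, hc_def]
      push_cast
      ring_nf
    have hn : ∀ t : ℝ, ‖Complex.exp (c * t)‖ = 1 := fun t => by
      rw [← h1, norm_bohrChar_apply]
    simp_rw [h1]
    rw [integral_exp_mul_complex hc, norm_mul, Complex.norm_real,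
      Real.norm_of_nonneg (by positivity), mul_comm, norm_div]
    gcongr
    refine (norm_sub_le _ _).trans ?_
    rw [hn, hn]
    norm_num
  refine squeeze_zero_norm' (eventually_gt_atTop 0 |>.mono key) ?_
  simpa using (tendsto_inv_atTop_zero (𝕜 := ℝ)).const_mul (2 / ‖c‖)

lemma exists_tendsto_avg_of_trig {f : ℝ →ᵇ ℂ} (hf : f ∈ trigAlgebra ⊤) :
    ∃ c, Tendsto (fun T => avg T f) atTop (𝓝 c) := by
  refine trigAlgebra_induction (P := fun f => ∃ c, Tendsto (fun T => avg T f) atTop (𝓝 c))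
    (fun x _ => ?_) ⟨0, by simp [avg]⟩ ?_ ?_ hf
  · rcases eq_or_ne x 0 with rfl | hx
    · refine ⟨1, tendsto_const_nhds.congr' ?_⟩
      filter_upwards [eventually_gt_atTop 0] with T hT
      have := avg_const hT 1
      rw [one_smul] at this
      rw [bohrChar_zero, this]
    · exact ⟨0, tendsto_avg_bohrChar hx⟩
  · rintro f g ⟨c, hc⟩ ⟨d, hd⟩
    exact ⟨c + d, by simpa only [avg_add] using hc.add hd⟩
  · rintro a f ⟨c, hc⟩
    exact ⟨a * c, by simpa only [avg_smul] using hc.const_mul a⟩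

lemma exists_tendsto_avg_of_approx {g : ℝ →ᵇ ℂ}
    (hg : ∀ δ > 0, ∃ p ∈ trigAlgebra ⊤, ‖g - p‖ ≤ δ) :
    ∃ c, Tendsto (fun T => avg T g) atTop (𝓝 c) := by
  refine cauchy_map_iff_exists_tendsto.1 ?_
  rw [Metric.cauchy_iff]
  refine ⟨inferInstance, fun ε hε => ?_⟩
  obtain ⟨p, hp, hgp⟩ := hg (ε / 8) (by positivity)
  obtain ⟨c, hc⟩ := exists_tendsto_avg_of_trig hp
  have hev : ∀ᶠ T in atTop, avg T g ∈ Metric.ball c (ε / 2) := by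
    filter_upwards [Metric.tendsto_nhds.1 hc (ε / 4) (by positivity), eventually_gt_atTop 0]
      with T hT hT0
    have h1 := norm_avg_le_norm hT0 (g - p)
    have h2 : avg T g = avg T (g - p : ℝ →ᵇ ℂ) + avg T p := by rw [← avg_add, sub_add_cancel]
    rw [Metric.mem_ball, dist_eq_norm] at *
    calc ‖avg T g - c‖ = ‖avg T (g - p : ℝ →ᵇ ℂ) + (avg T p - c)‖ := by rw [h2]; ring_nf
      _ ≤ _ := norm_add_le _ _
      _ < _ := by linarith
  refine ⟨Metric.ball c (ε / 2), hev, fun x hx y hy => ?_⟩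
  rw [Metric.mem_ball] at hx hy
  linarith [dist_triangle_right x y c]

/-- A positive, normalised functional on bounded continuous functions for which
the characters are orthonormal. -/
structure IsBohrMean (M : (ℝ →ᵇ ℂ) →ₗ[ℂ] ℂ) : Prop where
  norm_le : ∀ f h : ℝ →ᵇ ℂ, (∀ t, ‖f t‖ ≤ (h t).re) → ‖M f‖ ≤ (M h).re
  map_one : M 1 = 1
  map_char : ∀ x ≠ 0, M (bohrChar x) = 0

lemma exists_isBohrMean : ∃ M : (ℝ →ᵇ ℂ) →ₗ[ℂ] ℂ, IsBohrMean M ∧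
    ∀ g c, Tendsto (fun T => avg T g) atTop (𝓝 c) → M g = c := by
  let U : Ultrafilter ℝ := Ultrafilter.of atTop
  have hU : (U : Filter ℝ) ≤ atTop := Ultrafilter.of_le _
  have hpos : ∀ᶠ T in (U : Filter ℝ), 0 < T := hU (eventually_gt_atTop 0)
  have hex : ∀ g : ℝ →ᵇ ℂ, ∃ c, Tendsto (fun T => avg T g) U (𝓝 c) := by
    intro g
    obtain ⟨c, -, hc⟩ := (isCompact_closedBall (0 : ℂ) ‖g‖).ultrafilter_le_nhds
      (U.map fun T => avg T g) (by
        rw [le_principal_iff]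
        change ∀ᶠ T in (U : Filter ℝ), avg T g ∈ Metric.closedBall 0 ‖g‖
        filter_upwards [hpos] with T hT
        simpa using norm_avg_le_norm hT g)
    exact ⟨c, hc⟩
  choose m hm using hex
  have huniq : ∀ g c, Tendsto (fun T => avg T g) U (𝓝 c) → m g = c := fun g c hc =>
    tendsto_nhds_unique (hm g) hc
  refine ⟨{ toFun := m
            map_add' := fun f g => huniq _ _ (by simpa only [avg_add] using (hm f).add (hm g))
            map_smul' := fun c f => huniq _ _ (by
              simpa only [avg_smul, RingHom.id_apply, smul_eq_mul] using (hm f).const_mul c) },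
    ⟨?_, ?_, ?_⟩, ?_⟩
  · intro f h hfh
    refine le_of_tendsto_of_tendsto (hm f).norm ((Complex.continuous_re.tendsto _).comp (hm h)) ?_
    filter_upwards [hpos] with T hT using norm_avg_le hT hfh
  · refine huniq _ _ (tendsto_const_nhds.congr' ?_)
    filter_upwards [hpos] with T hT
    simpa using (avg_const hT 1).symm
  · exact fun x hx => huniq _ _ ((tendsto_avg_bohrChar hx).mono_left hU)
  · exact fun g c hc => huniq _ _ (hc.mono_left hU)

namespace IsBohrMean

variable {M : (ℝ →ᵇ ℂ) →ₗ[ℂ] ℂ}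

lemma norm_map_le (hM : IsBohrMean M) (f : ℝ →ᵇ ℂ) : ‖M f‖ ≤ ‖f‖ := by
  have := hM.norm_le f ((‖f‖ : ℂ) • 1) (fun t => by simpa using f.norm_coe_le_norm t)
  rwa [map_smul, hM.map_one, smul_eq_mul, mul_one, Complex.ofReal_re] at this

lemma continuous (hM : IsBohrMean M) : Continuous M :=
  (M.mkContinuous 1 (fun f => by simpa using hM.norm_map_le f)).continuous

lemma map_mul (hM : IsBohrMean M) {f g : ℝ →ᵇ ℂ}
    (hf : f ∈ trigAlgebra (AddSubmonoid.nonneg ℝ)) (hg : g ∈ trigAlgebra (AddSubmonoid.nonneg ℝ)) :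
    M (f * g) = M f * M g := by
  refine trigAlgebra_induction (P := fun f => M (f * g) = M f * M g) (fun x hx => ?_) (by simp)
    (fun f₁ f₂ h₁ h₂ => by rw [add_mul, map_add, map_add, h₁, h₂, add_mul])
    (fun c f₁ h₁ => by rw [smul_mul_assoc, map_smul, map_smul, h₁, smul_mul_assoc]) hf
  refine trigAlgebra_induction (P := fun g => M (bohrChar x * g) = M (bohrChar x) * M g)
    (fun y hy => ?_) (by simp)
    (fun f₁ f₂ h₁ h₂ => by rw [mul_add, map_add, map_add, h₁, h₂, mul_add])
    (fun c f₁ h₁ => by rw [mul_smul_comm, map_smul, map_smul, h₁, mul_smul_comm]) hg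
  rw [AddSubmonoid.mem_nonneg] at hx hy
  rcases hx.eq_or_lt with rfl | hx
  · rw [bohrChar_zero, hM.map_one, one_mul, one_mul]
  · rw [← bohrChar_add, hM.map_char x hx.ne', hM.map_char _ (by positivity), zero_mul]

lemma map_char_mul_eq_zero (hM : IsBohrMean M) {x : ℝ} (hx : 0 < x) {g : ℝ →ᵇ ℂ}
    (hg : g ∈ (trigAlgebra (AddSubmonoid.nonneg ℝ)).topologicalClosure) :
    M (bohrChar x * g) = 0 := by
  have hclosed : IsClosed {g : ℝ →ᵇ ℂ | M (bohrChar x * g) = 0} :=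
    isClosed_eq (hM.continuous.comp (continuous_const.mul continuous_id)) continuous_const
  refine closure_minimal (fun g hg => ?_) hclosed hg
  change M (bohrChar x * g) = 0
  rw [hM.map_mul (bohrChar_mem hx.le) hg, hM.map_char x hx.ne', zero_mul]

/-- A real-valued trigonometric polynomial is the real part of one with nonnegative frequencies. -/
lemma exists_re_eq (hM : IsBohrMean M) {p : ℝ →ᵇ ℂ} (hp : p ∈ trigAlgebra ⊤) :
    ∃ h ∈ trigAlgebra (AddSubmonoid.nonneg ℝ), (∀ t, (h t).re = (p t).re) ∧ (M h).im = 0 := by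
  suffices H : ∀ c : ℂ, ∃ h ∈ trigAlgebra (AddSubmonoid.nonneg ℝ),
      (∀ t, (h t).re = (c * p t).re) ∧ (M h).im = 0 by simpa using H 1
  refine trigAlgebra_induction (P := fun p => ∀ c : ℂ, ∃ h ∈ trigAlgebra (AddSubmonoid.nonneg ℝ),
      (∀ t, (h t).re = (c * p t).re) ∧ (M h).im = 0) (fun x _ c => ?_) (fun c => ?_)
      (fun f g hf hg c => ?_) (fun d f hf c => ?_) hp
  · rcases lt_trichotomy x 0 with hx | rfl | hx
    · refine ⟨conj c • bohrChar (-x), Subalgebra.smul_mem _ (bohrChar_mem ?_) _, fun t => ?_, ?_⟩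
      · exact (neg_pos.2 hx).le
      · rw [← star_bohrChar]
        simp
      · rw [map_smul, hM.map_char _ (neg_ne_zero.2 hx.ne)]
        simp
    · refine ⟨(c.re : ℂ) • 1, Subalgebra.smul_mem _ (one_mem _) _, fun t => ?_, ?_⟩
      · simp [bohrChar_zero]
      · simp [hM.map_one]
    · refine ⟨c • bohrChar x, Subalgebra.smul_mem _ (bohrChar_mem hx.le) _, fun t => by simp, ?_⟩
      rw [map_smul, hM.map_char _ hx.ne']
      simp
  · exact ⟨0, zero_mem _, by simp, by simp⟩
  · obtain ⟨h₁, hm₁, hr₁, hi₁⟩ := hf c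
    obtain ⟨h₂, hm₂, hr₂, hi₂⟩ := hg c
    refine ⟨h₁ + h₂, add_mem hm₁ hm₂, fun t => ?_, by simp [hi₁, hi₂]⟩
    rw [BoundedContinuousFunction.add_apply, BoundedContinuousFunction.add_apply, mul_add,
      Complex.add_re, Complex.add_re, hr₁, hr₂]
  · obtain ⟨h, hm, hr, hi⟩ := hf (c * d)
    refine ⟨h, hm, fun t => ?_, hi⟩
    rw [hr, BoundedContinuousFunction.smul_apply, smul_eq_mul, mul_assoc]

lemma exists_analytic_majorant (hM : IsBohrMean M) {f : ℝ →ᵇ ℂ} (hf : f ∈ trigAlgebra ⊤) {η : ℝ}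
    (hη : 0 < η) :
    ∃ h ∈ trigAlgebra (AddSubmonoid.nonneg ℝ), (∀ t, ‖f t‖ ≤ (h t).re) ∧
      (M (h * star h)).re ≤ 2 * ((M (f * star f)).re + η) := by
  obtain ⟨δ, hδ, hδη⟩ : ∃ δ > 0, δ * (2 * ‖f‖ + 1) ≤ η ∧ δ ≤ 1 := by
    refine ⟨min 1 (η / (2 * ‖f‖ + 1)), by positivity, ?_, min_le_left _ _⟩
    rw [← le_div_iff₀ (by positivity)]
    exact min_le_right _ _
  obtain ⟨p, hp, hpt⟩ := exists_trig_near_norm hf hδ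
  obtain ⟨h, hh, hre, him⟩ := hM.exists_re_eq hp
  refine ⟨h, hh, fun t => (hre t).symm ▸ (hpt t).2.1, ?_⟩
  have hp2 : (M (p * p)).re ≤ (M (f * star f)).re + η := by
    have := hM.norm_le (p * p) (f * star f + (η : ℂ) • 1) (fun t => by
      obtain ⟨h1, h2, h3⟩ := hpt t
      have hft := f.norm_coe_le_norm t
      have h0 := norm_nonneg (f t)
      rw [BoundedContinuousFunction.mul_apply, ← h1]
      simp only [← Complex.ofReal_mul, Complex.norm_real, BoundedContinuousFunction.add_apply,
        BoundedContinuousFunction.mul_apply, BoundedContinuousFunction.star_apply,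
        RCLike.star_def, Complex.mul_conj, Complex.normSq_eq_norm_sq,
        BoundedContinuousFunction.smul_apply, BoundedContinuousFunction.coe_one, Pi.one_apply,
        smul_eq_mul, mul_one, ← Complex.ofReal_add, Complex.ofReal_re, norm_mul, Real.norm_eq_abs,
        abs_mul_abs_self]
      nlinarith [mul_nonneg hδ.le (sub_nonneg.2 hft)])
    rw [map_add, map_smul, hM.map_one, smul_eq_mul, mul_one, Complex.add_re,
      Complex.ofReal_re] at this
    exact (Complex.re_le_norm _).trans this
  have hh2 := hM.norm_le (h * star h) ((2 : ℂ) • (p * p) - h * h) (fun t => by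
    obtain ⟨h1, -, -⟩ := hpt t
    have hpim : (p t).im = 0 := by rw [← h1, Complex.ofReal_im]
    simp only [BoundedContinuousFunction.mul_apply, BoundedContinuousFunction.star_apply,
      RCLike.star_def, BoundedContinuousFunction.sub_apply, BoundedContinuousFunction.smul_apply,
      smul_eq_mul, Complex.sub_re, Complex.mul_re, hpim, norm_mul, RCLike.norm_conj, ← hre t]
    rw [← sq, Complex.sq_norm, Complex.normSq_apply]
    simp
    linarith)
  rw [map_sub, map_smul, hM.map_mul hh hh, Complex.sub_re, smul_eq_mul, Complex.mul_re,
    Complex.mul_re (M h), him] at hh2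
  have := Complex.re_le_norm (M (h * star h))
  simp at hh2
  nlinarith [mul_self_nonneg (M h).re]

end IsBohrMean

lemma exp_apply (g : ℝ →ᵇ ℂ) (t : ℝ) : (NormedSpace.exp g) t = Complex.exp (g t) := by
  rw [Complex.exp_eq_exp_ℂ]
  have hs := NormedSpace.exp_series_hasSum_exp' (𝕂 := ℂ) g
  have ht := hs.mapL (BoundedContinuousFunction.evalCLM ℂ t)
  refine ht.unique ?_
  have := NormedSpace.exp_series_hasSum_exp' (𝕂 := ℂ) (g t)
  simpa using this

lemma exp_mem_topologicalClosure {A : Subalgebra ℂ (ℝ →ᵇ ℂ)} {g : ℝ →ᵇ ℂ} (hg : g ∈ A) :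
    NormedSpace.exp g ∈ A.topologicalClosure := by
  have hs := NormedSpace.exp_series_hasSum_exp' (𝕂 := ℂ) g
  refine A.isClosed_topologicalClosure.mem_of_tendsto hs (Eventually.of_forall fun s => ?_)
  exact sum_mem fun n _ => Subalgebra.smul_mem _ (pow_mem (A.le_topologicalClosure hg) n) _

lemma norm_exp_neg_sub_one_le {z : ℂ} (hz : 0 ≤ z.re) : ‖Complex.exp (-z) - 1‖ ≤ ‖z‖ := by
  have hconv : Convex ℝ {w : ℂ | w.re ≤ 0} := convex_halfSpace_re_le 0
  have := hconv.norm_image_sub_le_of_norm_deriv_le (f := Complex.exp) (C := 1) (x := 0) (y := -z)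
    (fun w _ => Complex.differentiableAt_exp) (fun w hw => by
      rw [Complex.deriv_exp, Complex.norm_exp, Real.exp_le_one_iff]
      exact hw) (by simp) (by simpa using hz)
  simpa using this

/-- One step of the recursion bounding the dual function. -/
lemma add_mul_exp_neg_le {x : ℝ} (hx : 0 ≤ x) (hx3 : x ≤ 3) :
    x + 68 / 5 * Real.exp (-(x / 12)) ≤ 68 / 5 := by
  have hexp : Real.exp (-(1 / 4)) ≤ 1 - 15 / 68 := by
    have h := Real.sum_le_exp_of_nonneg (x := 1 / 4) (by norm_num) 4
    rw [Real.exp_neg, inv_le_comm₀ (Real.exp_pos _) (by norm_num)]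
    refine le_trans ?_ h
    norm_num [Finset.sum_range_succ, Nat.factorial]
  have hc := convexOn_exp.2 (Set.mem_univ (0 : ℝ)) (Set.mem_univ (-(1 / 4) : ℝ))
    (show 0 ≤ 1 - x / 3 by linarith) (show 0 ≤ x / 3 by linarith) (by ring)
  simp only [smul_eq_mul, Real.exp_zero, mul_zero, zero_add, mul_one] at hc
  rw [show x / 3 * -(1 / 4) = -(x / 12) by ring] at hc
  nlinarith

lemma norm_sum_mul_exp_le (w z : ℕ → ℂ) (hw : ∀ j, ‖w j‖ ≤ 3) (hz : ∀ j, ‖w j‖ ≤ (z j).re)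
    (m : ℕ) :
    ‖∑ j ∈ Finset.range m, w j * Complex.exp (-((1 / 12) * ∑ i ∈ Finset.Ico (j + 1) m, z i))‖
      ≤ 68 / 5 := by
  induction m with
  | zero => simp; norm_num
  | succ m ih =>
    have hstep : ∑ j ∈ Finset.range (m + 1),
          w j * Complex.exp (-((1 / 12) * ∑ i ∈ Finset.Ico (j + 1) (m + 1), z i))
        = (∑ j ∈ Finset.range m,
          w j * Complex.exp (-((1 / 12) * ∑ i ∈ Finset.Ico (j + 1) m, z i)))
            * Complex.exp (-((1 / 12) * z m)) + w m := by
      rw [Finset.sum_range_succ, Finset.sum_mul]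
      congr 1
      · refine Finset.sum_congr rfl fun j hj => ?_
        rw [Finset.sum_Ico_succ_top (Finset.mem_range.1 hj), mul_assoc, ← Complex.exp_add,
          mul_add, neg_add]
      · simp
    rw [hstep]
    have hE : ‖Complex.exp (-((1 / 12) * z m))‖ ≤ Real.exp (-(‖w m‖ / 12)) := by
      rw [Complex.norm_exp, Real.exp_le_exp]
      have := hz m
      have h2 : (-((1 / 12) * z m)).re = -((z m).re / 12) := by
        rw [show -((1 / 12) * z m) = ((-(1 / 12) : ℝ) : ℂ) * z m by push_cast; ring,
          Complex.re_ofReal_mul]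
        ring
      rw [h2]
      linarith
    refine (norm_add_le _ _).trans ?_
    rw [norm_mul]
    have h1 := mul_le_mul ih hE (norm_nonneg _) (by norm_num)
    have h2 := add_mul_exp_neg_le (norm_nonneg (w m)) (hw m)
    linarith

lemma sum_Ico_half_pow_le (j m : ℕ) :
    ∑ i ∈ Finset.Ico (j + 1) m, ((1 : ℝ) / 2) ^ i ≤ (1 / 2) ^ j := by
  have h : ∀ n, ∑ i ∈ Finset.Ico (j + 1) (j + 1 + n), ((1 : ℝ) / 2) ^ i
      = (1 / 2) ^ j - (1 / 2) ^ (j + n) := by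
    intro n
    induction n with
    | zero => simp
    | succ n ih =>
      rw [← add_assoc, Finset.sum_Ico_succ_top (by omega), ih]
      ring
  rcases le_total m (j + 1) with hm | hm
  · rw [Finset.Ico_eq_empty_of_le hm]
    positivity
  · obtain ⟨n, rfl⟩ := Nat.exists_eq_add_of_le hm
    rw [h]
    have : (0 : ℝ) ≤ (1 / 2) ^ (j + n) := by positivity
    linarith

lemma sum_Ico_quarter_pow_le (l m : ℕ) :
    ∑ i ∈ Finset.Ico l m, ((1 : ℝ) / 4) ^ i ≤ 4 / 3 * (1 / 4) ^ l := by
  have h : ∀ n, ∑ i ∈ Finset.Ico l (l + n), ((1 : ℝ) / 4) ^ i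
      = 4 / 3 * ((1 / 4) ^ l - (1 / 4) ^ (l + n)) := by
    intro n
    induction n with
    | zero => simp
    | succ n ih =>
      rw [← add_assoc, Finset.sum_Ico_succ_top (by omega), ih]
      ring
  rcases le_total m l with hm | hm
  · rw [Finset.Ico_eq_empty_of_le hm]
    positivity
  · obtain ⟨n, rfl⟩ := Nat.exists_eq_add_of_le hm
    rw [h]
    have : (0 : ℝ) ≤ (1 / 4) ^ (l + n) := by positivity
    linarith

lemma mul_star_apply (f : ℝ →ᵇ ℂ) (t : ℝ) : (f * star f) t = ((‖f t‖ ^ 2 : ℝ) : ℂ) := by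
  simp [Complex.mul_conj, Complex.normSq_eq_norm_sq]

namespace IsBohrMean

variable {M : (ℝ →ᵇ ℂ) →ₗ[ℂ] ℂ}

lemma re_map_sum_mul_star_le (hM : IsBohrMean M) (h : ℕ → ℝ →ᵇ ℂ) {B : ℝ} (hB : 0 ≤ B)
    (hh : ∀ i, (M (h i * star (h i))).re ≤ B * (1 / 4) ^ i) (j m : ℕ) :
    (M ((∑ i ∈ Finset.Ico (j + 1) m, h i) * star (∑ i ∈ Finset.Ico (j + 1) m, h i))).re
      ≤ B * (1 / 4) ^ j := by
  set s := Finset.Ico (j + 1) m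
  have key := hM.norm_le ((∑ i ∈ s, h i) * star (∑ i ∈ s, h i))
    ((((1 / 2) ^ j : ℝ) : ℂ) • ∑ i ∈ s, (((2 : ℝ) ^ i : ℝ) : ℂ) • (h i * star (h i)))
    (fun t => by
      have hR : ((∑ i ∈ s, (((2 : ℝ) ^ i : ℝ) : ℂ) • (h i * star (h i)) : ℝ →ᵇ ℂ) t)
          = ((∑ i ∈ s, (2 : ℝ) ^ i * ‖h i t‖ ^ 2 : ℝ) : ℂ) := by
        rw [BoundedContinuousFunction.sum_apply, Complex.ofReal_sum]
        refine Finset.sum_congr rfl fun i _ => ?_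
        rw [BoundedContinuousFunction.smul_apply, mul_star_apply, smul_eq_mul,
          ← Complex.ofReal_mul]
      rw [mul_star_apply, BoundedContinuousFunction.smul_apply, hR, smul_eq_mul,
        ← Complex.ofReal_mul, Complex.ofReal_re, Complex.norm_real,
        Real.norm_of_nonneg (by positivity), BoundedContinuousFunction.sum_apply]
      calc ‖∑ i ∈ s, h i t‖ ^ 2 ≤ (∑ i ∈ s, ‖h i t‖) ^ 2 := by gcongr; exact norm_sum_le _ _
        _ ≤ (∑ i ∈ s, ((1 : ℝ) / 2) ^ i) * ∑ i ∈ s, (2 : ℝ) ^ i * ‖h i t‖ ^ 2 := by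
          refine Finset.sum_sq_le_sum_mul_sum_of_sq_le_mul _ (fun i _ => by positivity)
            (fun i _ => by positivity) (fun i _ => le_of_eq ?_)
          rw [← mul_assoc, ← mul_pow]
          norm_num
        _ ≤ _ := by
          gcongr
          exact sum_Ico_half_pow_le j m)
  rw [map_smul, map_sum, smul_eq_mul, Complex.re_ofReal_mul, Complex.re_sum] at key
  refine (Complex.re_le_norm _).trans (key.trans ?_)
  calc (1 / 2 : ℝ) ^ j * ∑ i ∈ s, (M ((((2 : ℝ) ^ i : ℝ) : ℂ) • (h i * star (h i)))).re
      ≤ (1 / 2 : ℝ) ^ j * ∑ i ∈ s, B * (1 / 2) ^ i := by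
        gcongr with i _
        rw [map_smul, smul_eq_mul, Complex.re_ofReal_mul]
        refine (mul_le_mul_of_nonneg_left (hh i) (by positivity)).trans (le_of_eq ?_)
        rw [mul_left_comm, ← mul_pow]
        norm_num
    _ ≤ (1 / 2 : ℝ) ^ j * (B * (1 / 2) ^ j) := by
        rw [← Finset.mul_sum]
        gcongr
        exact sum_Ico_half_pow_le j m
    _ = B * (1 / 4) ^ j := by
        rw [mul_left_comm, ← mul_pow]
        norm_num

lemma norm_map_char_mul_exp_sub_one_le (hM : IsBohrMean M) (x : ℝ) (f H : ℝ →ᵇ ℂ)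
    (hH : ∀ t, 0 ≤ (H t).re) {ε s : ℝ} (hε : 0 ≤ ε) (hs : 0 < s) :
    ‖M (bohrChar x * (f * (NormedSpace.exp (-((ε : ℂ) • H)) - 1)))‖ ≤
      (s * (M (f * star f)).re + ε ^ 2 / s * (M (H * star H)).re) / 2 := by
  have key := hM.norm_le (bohrChar x * (f * (NormedSpace.exp (-((ε : ℂ) • H)) - 1)))
    (((s / 2 : ℝ) : ℂ) • (f * star f) + ((ε ^ 2 / s / 2 : ℝ) : ℂ) • (H * star H)) (fun t => by
      rw [BoundedContinuousFunction.add_apply, BoundedContinuousFunction.smul_apply,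
        BoundedContinuousFunction.smul_apply, mul_star_apply, mul_star_apply, smul_eq_mul,
        smul_eq_mul, ← Complex.ofReal_mul, ← Complex.ofReal_mul, ← Complex.ofReal_add,
        Complex.ofReal_re, BoundedContinuousFunction.mul_apply,
        BoundedContinuousFunction.mul_apply, BoundedContinuousFunction.sub_apply, exp_apply,
        norm_mul, norm_mul, norm_bohrChar_apply, one_mul]
      have h1 : ‖Complex.exp ((-((ε : ℂ) • H) : ℝ →ᵇ ℂ) t) - 1‖ ≤ ε * ‖H t‖ := by
        have := norm_exp_neg_sub_one_le (z := ε * H t) (by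
          rw [Complex.re_ofReal_mul]
          exact mul_nonneg hε (hH t))
        rwa [norm_mul, Complex.norm_real, Real.norm_of_nonneg hε] at this
      calc ‖f t‖ * ‖Complex.exp ((-((ε : ℂ) • H) : ℝ →ᵇ ℂ) t) - 1‖
          ≤ ‖f t‖ * (ε * ‖H t‖) := by gcongr
        _ ≤ _ := by
          have h2 : s / 2 * ‖f t‖ ^ 2 + ε ^ 2 / s / 2 * ‖H t‖ ^ 2 - ‖f t‖ * (ε * ‖H t‖)
              = (s * ‖f t‖ - ε * ‖H t‖) ^ 2 / (2 * s) := by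
            field_simp
            ring
          have h3 : 0 ≤ (s * ‖f t‖ - ε * ‖H t‖) ^ 2 / (2 * s) := by positivity
          linarith)
  refine key.trans (le_of_eq ?_)
  rw [map_add, map_smul, map_smul, Complex.add_re, smul_eq_mul, smul_eq_mul,
    Complex.re_ofReal_mul, Complex.re_ofReal_mul]
  ring

end IsBohrMean

namespace IsBohrMean

variable {M : (ℝ →ᵇ ℂ) →ₗ[ℂ] ℂ}

/-- Bessel-type identity, for a finite sum of distinct characters. -/
lemma re_map_sum_char_mul_star (hM : IsBohrMean M) {ι : Type*} (s : Finset ι) (v : ι → ℂ)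
    {x : ι → ℝ} (hx : Function.Injective x) :
    (M ((∑ k ∈ s, v k • bohrChar (x k)) * star (∑ k ∈ s, v k • bohrChar (x k)))).re
      = ∑ k ∈ s, ‖v k‖ ^ 2 := by
  classical
  rw [star_sum, Finset.sum_mul_sum, map_sum, Complex.re_sum]
  refine Finset.sum_congr rfl fun k hk => ?_
  rw [map_sum, Finset.sum_eq_single_of_mem k hk]
  · rw [star_smul, star_bohrChar, smul_mul_smul_comm, ← bohrChar_add, add_neg_cancel, bohrChar_zero,
      map_smul, hM.map_one, smul_eq_mul, mul_one, RCLike.star_def, Complex.mul_conj,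
      Complex.normSq_eq_norm_sq, Complex.ofReal_re]
  · intro l _ hlk
    rw [star_smul, star_bohrChar, smul_mul_smul_comm, ← bohrChar_add, map_smul, hM.map_char,
      smul_zero]
    rw [← sub_eq_add_neg, sub_ne_zero]
    exact fun h => hlk (hx h).symm

end IsBohrMean

/-- The index `k` lies in the block number `log₄ (k + 1)`. -/
def blockIndices (N j : ℕ) : Finset (Fin N) := {k | Nat.log 4 (k + 1) = j}

lemma mem_blockIndices {N j : ℕ} {k : Fin N} : k ∈ blockIndices N j ↔ Nat.log 4 (k + 1) = j := by
  simp [blockIndices]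

lemma card_blockIndices_le (N j : ℕ) : (blockIndices N j).card ≤ 3 * 4 ^ j := by
  have h : (blockIndices N j).card ≤ (Finset.Ico (4 ^ j) (4 ^ (j + 1))).card := by
    refine Finset.card_le_card_of_injOn (fun k => (k : ℕ) + 1) (fun k hk => ?_) ?_
    · have hk' := mem_blockIndices.1 hk
      rw [Finset.coe_Ico, Set.mem_Ico]
      subst hk'
      exact ⟨Nat.pow_log_le_self 4 (by omega), Nat.lt_pow_succ_log_self (by norm_num) _⟩
    · intro k _ l _ hkl
      exact Fin.ext (by simpa using hkl)
  rw [Nat.card_Ico, pow_succ] at h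
  omega

/-- The normalised sum of the characters of a block. -/
noncomputable def blockSum {N : ℕ} (lam : Fin N → ℝ) (v : Fin N → ℂ) (j : ℕ) : ℝ →ᵇ ℂ :=
  ∑ k ∈ blockIndices N j, (((1 / 4 : ℝ) ^ j : ℝ) * v k) • bohrChar (-lam k)

lemma blockSum_mem {N : ℕ} (lam : Fin N → ℝ) (v : Fin N → ℂ) (j : ℕ) :
    blockSum lam v j ∈ trigAlgebra ⊤ :=
  sum_mem fun _ _ => Subalgebra.smul_mem _ (bohrChar_mem (AddSubmonoid.mem_top _)) _

lemma norm_blockSum_apply_le {N : ℕ} (lam : Fin N → ℝ) {v : Fin N → ℂ} (hv : ∀ k, ‖v k‖ ≤ 1)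
    (j : ℕ) (t : ℝ) : ‖blockSum lam v j t‖ ≤ 3 := by
  rw [blockSum, BoundedContinuousFunction.sum_apply]
  refine (norm_sum_le _ _).trans ?_
  have hterm : ∀ k ∈ blockIndices N j,
      ‖((((1 / 4 : ℝ) ^ j : ℝ) * v k) • bohrChar (-lam k) : ℝ →ᵇ ℂ) t‖ ≤ (1 / 4) ^ j := by
    intro k _
    rw [BoundedContinuousFunction.smul_apply, norm_smul, norm_bohrChar_apply, mul_one, norm_mul,
      Complex.norm_real, Real.norm_of_nonneg (by positivity)]
    exact mul_le_of_le_one_right (by positivity) (hv k)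
  refine (Finset.sum_le_card_nsmul _ _ _ hterm).trans ?_
  have hc : ((blockIndices N j).card : ℝ) ≤ 3 * 4 ^ j := by
    exact_mod_cast card_blockIndices_le N j
  rw [nsmul_eq_mul]
  calc ((blockIndices N j).card : ℝ) * (1 / 4) ^ j ≤ 3 * 4 ^ j * (1 / 4) ^ j := by gcongr
    _ = 3 := by rw [mul_assoc, ← mul_pow]; norm_num

namespace IsBohrMean

variable {M : (ℝ →ᵇ ℂ) →ₗ[ℂ] ℂ}

lemma re_map_blockSum_mul_star_le (hM : IsBohrMean M) {N : ℕ} {lam : Fin N → ℝ}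
    (hlam : StrictMono lam) {v : Fin N → ℂ} (hv : ∀ k, ‖v k‖ ≤ 1) (j : ℕ) :
    (M (blockSum lam v j * star (blockSum lam v j))).re ≤ 3 * (1 / 4) ^ j := by
  rw [blockSum, hM.re_map_sum_char_mul_star (x := fun k => -lam k) _ _
    (neg_injective.comp hlam.injective)]
  have hterm : ∀ k ∈ blockIndices N j, ‖(((1 / 4 : ℝ) ^ j : ℝ) : ℂ) * v k‖ ^ 2 ≤ (1 / 16) ^ j := by
    intro k _
    rw [norm_mul, Complex.norm_real, Real.norm_of_nonneg (by positivity)]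
    calc ((1 / 4 : ℝ) ^ j * ‖v k‖) ^ 2 ≤ ((1 / 4 : ℝ) ^ j * 1) ^ 2 := by gcongr; exact hv k
      _ = (1 / 16) ^ j := by rw [mul_one, ← pow_mul, mul_comm, pow_mul]; norm_num
  refine (Finset.sum_le_card_nsmul _ _ _ hterm).trans ?_
  have hc : ((blockIndices N j).card : ℝ) ≤ 3 * 4 ^ j := by
    exact_mod_cast card_blockIndices_le N j
  rw [nsmul_eq_mul]
  calc ((blockIndices N j).card : ℝ) * (1 / 16) ^ j ≤ 3 * 4 ^ j * (1 / 16) ^ j := by gcongr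
    _ = 3 * (1 / 4) ^ j := by rw [mul_assoc, ← mul_pow]; norm_num

lemma map_char_mul_blockSum (hM : IsBohrMean M) {N : ℕ} {lam : Fin N → ℝ}
    (hlam : StrictMono lam) (v : Fin N → ℂ) (j : ℕ) (k : Fin N) :
    M (bohrChar (lam k) * blockSum lam v j)
      = if Nat.log 4 (k + 1) = j then (((1 / 4 : ℝ) ^ j : ℝ) : ℂ) * v k else 0 := by
  classical
  have hterm : ∀ l, M (bohrChar (lam k) * ((((1 / 4 : ℝ) ^ j : ℝ) * v l) • bohrChar (-lam l)))
      = if k = l then (((1 / 4 : ℝ) ^ j : ℝ) : ℂ) * v l else 0 := by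
    intro l
    rw [mul_smul_comm, ← bohrChar_add, map_smul]
    split_ifs with h
    · rw [h, add_neg_cancel, bohrChar_zero, hM.map_one, smul_eq_mul, mul_one]
    · rw [hM.map_char, smul_zero]
      rw [← sub_eq_add_neg, sub_ne_zero]
      exact fun hl => h (hlam.injective hl)
  rw [blockSum, Finset.mul_sum, map_sum, Finset.sum_congr rfl fun l _ => hterm l,
    Finset.sum_ite_eq]
  simp only [mem_blockIndices]

lemma map_char_mul_blockSum_mul_eq_zero (hM : IsBohrMean M) {N : ℕ} {lam : Fin N → ℝ}
    (hlam : StrictMono lam) (v : Fin N → ℂ) {j : ℕ} {k : Fin N} (hjk : j < Nat.log 4 (k + 1))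
    {g : ℝ →ᵇ ℂ} (hg : g ∈ (trigAlgebra (AddSubmonoid.nonneg ℝ)).topologicalClosure) :
    M (bohrChar (lam k) * (blockSum lam v j * g)) = 0 := by
  rw [blockSum, Finset.sum_mul, Finset.mul_sum, map_sum]
  refine Finset.sum_eq_zero fun l hl => ?_
  rw [mem_blockIndices] at hl
  have hlk : l < k := by
    by_contra! h
    have := Nat.log_mono_right (b := 4) (Nat.add_le_add_right (Fin.le_def.1 h) 1)
    omega
  rw [smul_mul_assoc, mul_smul_comm, ← mul_assoc, ← bohrChar_add, map_smul,
    hM.map_char_mul_eq_zero _ hg, smul_zero]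
  rw [← sub_eq_add_neg, sub_pos]
  exact hlam hlk

/-- The dual function: bounded, with prescribed phases of its correlations with the characters. -/
lemma exists_dual (hM : IsBohrMean M) {N : ℕ} {lam : Fin N → ℝ}
    (hlam : StrictMono lam) {v : Fin N → ℂ} (hv : ∀ k, ‖v k‖ ≤ 1) :
    ∃ F : ℝ →ᵇ ℂ, (∀ t, ‖F t‖ ≤ 68 / 5) ∧ ∀ k : Fin N,
      ‖M (bohrChar (lam k) * F) - (((1 / 4 : ℝ) ^ Nat.log 4 (k + 1) : ℝ) : ℂ) * v k‖
        ≤ 4 / 3 * (3571 / 10000) * (1 / 4) ^ Nat.log 4 (k + 1) := by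
  set f := blockSum lam v
  have hf2 := hM.re_map_blockSum_mul_star_le hlam hv
  have hex : ∀ j, ∃ h ∈ trigAlgebra (AddSubmonoid.nonneg ℝ), (∀ t, ‖f j t‖ ≤ (h t).re) ∧
      (M (h * star h)).re ≤ 153 / 25 * (1 / 4) ^ j := by
    intro j
    obtain ⟨h, hh, hre, hM2⟩ := hM.exists_analytic_majorant (blockSum_mem lam v j)
      (η := 3 / 50 * (1 / 4) ^ j) (by positivity)
    exact ⟨h, hh, hre, hM2.trans (by linarith [hf2 j])⟩
  choose h hh hre hM2 using hex
  set H : ℕ → ℝ →ᵇ ℂ := fun j => ∑ i ∈ Finset.Ico (j + 1) N, h i with hH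
  set E : ℕ → ℝ →ᵇ ℂ := fun j => NormedSpace.exp (-(((1 / 12 : ℝ) : ℂ) • H j)) with hE
  have hHmem : ∀ j, H j ∈ trigAlgebra (AddSubmonoid.nonneg ℝ) := fun j => sum_mem fun i _ => hh i
  have hHre : ∀ j t, 0 ≤ (H j t).re := by
    intro j t
    rw [hH, BoundedContinuousFunction.sum_apply, Complex.re_sum]
    exact Finset.sum_nonneg fun i _ => (norm_nonneg _).trans (hre i t)
  refine ⟨∑ j ∈ Finset.range N, f j * E j, fun t => ?_, fun k => ?_⟩
  · have := norm_sum_mul_exp_le (fun j => f j t) (fun j => h j t)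
      (fun j => norm_blockSum_apply_le lam hv j t) (fun j => hre j t) N
    rw [BoundedContinuousFunction.sum_apply]
    convert this using 4 with j hj
    rw [BoundedContinuousFunction.mul_apply, hE, exp_apply]
    simp [hH]
  · set l := Nat.log 4 ((k : ℕ) + 1) with hl
    have hlN : l < N := (Nat.log_lt_self 4 (Nat.succ_ne_zero _)).trans_le k.2
    have hterm : ∀ j ∈ Finset.range N, M (bohrChar (lam k) * (f j * E j))
        = (if l = j then (((1 / 4 : ℝ) ^ j : ℝ) : ℂ) * v k else 0)
          + if l ≤ j then M (bohrChar (lam k) * (f j * (E j - 1))) else 0 := by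
      intro j _
      by_cases hj : l ≤ j
      · rw [if_pos hj, ← hM.map_char_mul_blockSum hlam, ← map_add, ← mul_add]
        congr 2
        change f j * E j = f j + f j * (E j - 1)
        ring
      · rw [if_neg hj, if_neg (by omega), add_zero]
        refine hM.map_char_mul_blockSum_mul_eq_zero hlam v (by omega)
          (exp_mem_topologicalClosure ?_)
        exact neg_mem (Subalgebra.smul_mem _ (hHmem j) _)
    rw [Finset.mul_sum, map_sum, Finset.sum_congr rfl hterm, Finset.sum_add_distrib,
      Finset.sum_ite_eq, if_pos (Finset.mem_range.2 hlN), add_sub_cancel_left, ← Finset.sum_filter]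
    have hfilter : (Finset.range N).filter (fun j => l ≤ j) = Finset.Ico l N := by
      ext j
      simp [and_comm]
    rw [hfilter]
    calc ‖∑ j ∈ Finset.Ico l N, M (bohrChar (lam k) * (f j * (E j - 1)))‖
        ≤ ∑ j ∈ Finset.Ico l N, (3571 / 10000 : ℝ) * (1 / 4) ^ j := by
          refine norm_sum_le_of_le _ fun j _ => ?_
          refine (hM.norm_map_char_mul_exp_sub_one_le (lam k) (f j) (H j) (hHre j)
            (ε := 1 / 12) (s := 119 / 1000) (by norm_num) (by norm_num)).trans ?_
          have h1 := hf2 j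
          have h2 := hM.re_map_sum_mul_star_le h (by norm_num) hM2 j N
          have h3 : (0 : ℝ) ≤ (1 / 4) ^ j := by positivity
          change (M (f j * star (f j))).re ≤ _ at h1
          change (M (H j * star (H j))).re ≤ _ at h2
          linarith
      _ ≤ _ := by
          rw [← Finset.mul_sum]
          have := sum_Ico_quarter_pow_le l N
          linarith

/-- The McGehee–Pigno–Smith inequality for a mean on bounded continuous functions. -/
theorem sum_norm_div_le (hM : IsBohrMean M) {N : ℕ} {lam : Fin N → ℝ} (hlam : StrictMono lam)
    (a : Fin N → ℂ) {G : ℝ →ᵇ ℂ}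
    (hG : ∀ t, ‖(∑ k, a k • bohrChar (lam k) : ℝ →ᵇ ℂ) t‖ ≤ (G t).re) :
    (1 / 26 : ℝ) * ∑ k : Fin N, ‖a k‖ / ((k : ℕ) + 2 : ℝ) ≤ (M G).re := by
  have hphase : ∀ z : ℂ, ∃ w : ℂ, ‖w‖ ≤ 1 ∧ z * w = ‖z‖ := by
    intro z
    rcases eq_or_ne z 0 with rfl | hz
    · exact ⟨0, by simp, by simp⟩
    · refine ⟨‖z‖ / z, ?_, mul_div_cancel₀ _ hz⟩
      rw [norm_div, Complex.norm_real, norm_norm, div_self (norm_ne_zero_iff.2 hz)]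
  choose w hw hzw using hphase
  obtain ⟨F, hFb, hF⟩ := hM.exists_dual hlam (v := fun k => w (a k)) (fun k => hw _)
  set f : ℝ →ᵇ ℂ := ∑ k, a k • bohrChar (lam k)
  have hup : ‖M (f * F)‖ ≤ 68 / 5 * (M G).re := by
    have := hM.norm_le (f * F) (((68 / 5 : ℝ) : ℂ) • G) (fun t => by
      rw [BoundedContinuousFunction.mul_apply, BoundedContinuousFunction.smul_apply, smul_eq_mul,
        Complex.re_ofReal_mul, norm_mul, mul_comm]
      exact mul_le_mul (hFb t) (hG t) (norm_nonneg _) (by norm_num))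
    rwa [map_smul, smul_eq_mul, Complex.re_ofReal_mul] at this
  have hlow : ∑ k : Fin N, 68 / 5 * (1 / 26) * (‖a k‖ / ((k : ℕ) + 2 : ℝ)) ≤ (M (f * F)).re := by
    rw [Finset.sum_mul, map_sum, Complex.re_sum]
    refine Finset.sum_le_sum fun k _ => ?_
    rw [smul_mul_assoc, map_smul, smul_eq_mul]
    set l := Nat.log 4 ((k : ℕ) + 1)
    have hk := hF k
    set D := M (bohrChar (lam k) * F) - (((1 / 4 : ℝ) ^ l : ℝ) : ℂ) * w (a k) with hD
    have hsplit : a k * M (bohrChar (lam k) * F)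
        = (((1 / 4 : ℝ) ^ l * ‖a k‖ : ℝ) : ℂ) + a k * D := by
      rw [hD, Complex.ofReal_mul, ← hzw (a k)]
      ring
    have hDre : -(‖a k‖ * ‖D‖) ≤ (a k * D).re := by
      rw [← norm_mul]
      exact (abs_le.1 (Complex.abs_re_le_norm _)).1
    have hweight : 1 / ((k : ℕ) + 2 : ℝ) ≤ (1 / 4) ^ l := by
      rw [one_div_pow]
      refine one_div_le_one_div_of_le (by positivity) ?_
      have : 4 ^ l ≤ (k : ℕ) + 1 := Nat.pow_log_le_self 4 (by omega)
      have : ((4 ^ l : ℕ) : ℝ) ≤ ((k : ℕ) + 1 : ℕ) := by exact_mod_cast this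
      push_cast at this
      linarith
    rw [hsplit, Complex.add_re, Complex.ofReal_re]
    have h1 := mul_le_mul_of_nonneg_left hk (norm_nonneg (a k))
    have h2 := mul_le_mul_of_nonneg_left hweight (norm_nonneg (a k))
    have h3 : 0 ≤ ‖a k‖ * (1 / 4) ^ l := by positivity
    rw [div_eq_mul_one_div ‖a k‖]
    linarith
  rw [← Finset.mul_sum] at hlow
  have := Complex.re_le_norm (M (f * F))
  linarith

end IsBohrMean

/-- The pointwise modulus of a bounded continuous function. -/
noncomputable def modulus (f : ℝ →ᵇ ℂ) : ℝ →ᵇ ℂ :=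
  BoundedContinuousFunction.ofNormedAddCommGroup (fun t => ((‖f t‖ : ℝ) : ℂ))
    (by fun_prop) ‖f‖ (fun t => by simpa using f.norm_coe_le_norm t)

lemma modulus_apply (f : ℝ →ᵇ ℂ) (t : ℝ) : modulus f t = ((‖f t‖ : ℝ) : ℂ) := rfl

lemma avg_modulus (f : ℝ →ᵇ ℂ) (T : ℝ) :
    avg T (modulus f) = (((1 / T) * ∫ t in (-(T / 2))..(T / 2), ‖f t‖ : ℝ) : ℂ) := by
  rw [avg, Complex.ofReal_mul, ← intervalIntegral.integral_ofReal]
  rfl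

lemma exists_tendsto_avg_modulus {f : ℝ →ᵇ ℂ} (hf : f ∈ trigAlgebra ⊤) :
    ∃ c, Tendsto (fun T => avg T (modulus f)) atTop (𝓝 c) := by
  refine exists_tendsto_avg_of_approx fun δ hδ => ?_
  obtain ⟨p, hp, hpt⟩ := exists_trig_near_norm hf hδ
  refine ⟨p, hp, (BoundedContinuousFunction.norm_le hδ.le).2 fun t => ?_⟩
  obtain ⟨h1, h2, h3⟩ := hpt t
  rw [BoundedContinuousFunction.sub_apply, modulus_apply, ← h1, ← Complex.ofReal_sub,
    Complex.norm_real, Real.norm_eq_abs, abs_le]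
  constructor <;> linarith

end TrigPoly

open TrigPoly in
/-- Main theorem (i): Besikovitch L¹ norm lower bound for non-harmonic
trigonometric polynomials. -/
theorem besikovitch_littlewood (N : ℕ) (lam : Fin N → ℝ) (hlam : StrictMono lam)
    (a : Fin N → ℂ) :
    ∃ L : ℝ,
      Tendsto (fun T : ℝ => (1 / T) *
          ∫ t in (-(T/2))..(T/2),
            ‖∑ k : Fin N, a k * Complex.exp (((2 * Real.pi * lam k * t : ℝ) : ℂ) * Complex.I)‖)
        atTop (nhds L) ∧
      (1 / 26 : ℝ) * ∑ k : Fin N, ‖a k‖ / ((k : ℕ) + 2 : ℝ) ≤ L := by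
  set f := ∑ k, a k • bohrChar (lam k) with hf
  have hft : ∀ t, f t
      = ∑ k : Fin N, a k * Complex.exp (((2 * Real.pi * lam k * t : ℝ) : ℂ) * Complex.I) := by
    intro t
    rw [hf, BoundedContinuousFunction.sum_apply]
    rfl
  obtain ⟨c, hc⟩ := exists_tendsto_avg_modulus (f := f)
    (sum_mem fun k _ => Subalgebra.smul_mem _ (bohrChar_mem (AddSubmonoid.mem_top _)) _)
  obtain ⟨M, hM, hMc⟩ := exists_isBohrMean
  refine ⟨c.re, ?_, ?_⟩
  · have := (Complex.continuous_re.tendsto c).comp hc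
    simpa only [Function.comp_def, avg_modulus, Complex.ofReal_re, hft] using this
  · rw [← hMc _ _ hc]
    exact hM.sum_norm_div_le hlam a fun t => by rw [modulus_apply, Complex.ofReal_re]
end

section
/- For distinct real numbers λ_1 < ... < λ_N and complex numbers a_1, ..., a_N all of modulus at least 1, the limit as T → ∞ of (1/T) ∫_{-T/2}^{T/2} |∑_{k=1}^N a_k e^{2πi λ_k t}| dt is at least (4/π³) ln N. -/
open MeasureTheory intervalIntegral Filter

namespace Besikovitch

/-- The character `t ↦ exp (2π i x t)` of the real line. -/
noncomputable def character (x : ℝ) : ℝ → ℂ :=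
  fun t => Complex.exp (((2 * Real.pi * x * t : ℝ) : ℂ) * Complex.I)

/-- Generalized trigonometric polynomials with frequencies in `S`. -/
noncomputable def trigPoly (S : AddSubmonoid ℝ) : Subalgebra ℂ (ℝ → ℂ) :=
  Algebra.adjoin ℂ (Set.image character S)

/-- The average of `f` over the interval of length `T` centred at the origin. -/
noncomputable def average {E : Type*} [NormedAddCommGroup E] [NormedSpace ℝ E]
    (f : ℝ → E) (T : ℝ) : E :=
  (1 / T) • ∫ t in (-(T / 2))..(T / 2), f t

/-- The Bohr mean of `f`. -/
noncomputable def mean (f : ℝ → ℂ) : ℂ := limUnder atTop (average f)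

/-- The mean of `‖f‖ ^ 2`. -/
noncomputable def meanSq (f : ℝ → ℂ) : ℝ := (mean (f * star f)).re

lemma character_zero : character 0 = 1 := by
  funext t; simp [character]

lemma character_add (x y : ℝ) : character (x + y) = character x * character y := by
  funext t
  simp only [character, Pi.mul_apply, ← Complex.exp_add]
  congr 1
  push_cast
  ring

lemma star_character (x : ℝ) : star (character x) = character (-x) := by
  funext t
  simp only [character, Pi.star_apply, Complex.star_def, ← Complex.exp_conj, map_mul,
    Complex.conj_ofReal, Complex.conj_I]
  congr 1
  push_cast
  ring

lemma norm_character (x t : ℝ) : ‖character x t‖ = 1 := by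
  rw [character, Complex.norm_exp_ofReal_mul_I]

lemma continuous_character (x : ℝ) : Continuous (character x) := by
  unfold character
  fun_prop

lemma character_mem {S : AddSubmonoid ℝ} {x : ℝ} (hx : x ∈ S) : character x ∈ trigPoly S :=
  Algebra.subset_adjoin ⟨x, hx, rfl⟩

lemma trigPoly_induction {S : AddSubmonoid ℝ} {P : (ℝ → ℂ) → Prop}
    (hsmul : ∀ (c : ℂ), ∀ x ∈ S, P (c • character x))
    (hadd : ∀ f ∈ trigPoly S, ∀ g ∈ trigPoly S, P f → P g → P (f + g))
    {f : ℝ → ℂ} (hf : f ∈ trigPoly S) : P f := by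
  let M : Submonoid (ℝ → ℂ) :=
    { carrier := Set.image character S
      one_mem' := ⟨0, S.zero_mem, character_zero⟩
      mul_mem' := by
        rintro _ _ ⟨x, hx, rfl⟩ ⟨y, hy, rfl⟩
        exact ⟨x + y, S.add_mem hx hy, character_add x y⟩ }
  have hspan : f ∈ Submodule.span ℂ (Set.image character S) := by
    have h : f ∈ (Algebra.adjoin ℂ (Set.image character S)).toSubmodule := hf
    rw [Algebra.adjoin_eq_span] at h
    have hM : Submonoid.closure (Set.image character S) = M := M.closure_eq
    rwa [hM] at h
  have hle : ∀ g ∈ Submodule.span ℂ (Set.image character S), g ∈ trigPoly S := fun g hg =>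
    (Submodule.span_le (p := (trigPoly S).toSubmodule)).2 Algebra.subset_adjoin hg
  refine (Submodule.closure_induction (p := fun g _ => P g) (s := (Set.image character S))
    ?_ ?_ ?_ hspan)
  · simpa using hsmul 0 0 S.zero_mem
  · intro g k hg hk hPg hPk
    exact hadd g (hle g hg) k (hle k hk) hPg hPk
  · rintro c _ ⟨x, hx, rfl⟩
    exact hsmul c x hx

lemma trigPoly_mono {S S' : AddSubmonoid ℝ} (h : S ≤ S') : trigPoly S ≤ trigPoly S' :=
  Algebra.adjoin_mono (Set.image_mono h)

lemma mem_top {S : AddSubmonoid ℝ} {f : ℝ → ℂ} (hf : f ∈ trigPoly S) : f ∈ trigPoly ⊤ :=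
  trigPoly_mono le_top hf

lemma star_mem {f : ℝ → ℂ} (hf : f ∈ trigPoly ⊤) : star f ∈ trigPoly ⊤ := by
  refine trigPoly_induction (P := fun f => star f ∈ trigPoly ⊤) ?_ ?_ hf
  · intro c x _
    rw [star_smul, star_character]
    exact Subalgebra.smul_mem _ (character_mem (AddSubmonoid.mem_top _)) _
  · intro f _ g _ hf hg
    rw [star_add]
    exact Subalgebra.add_mem _ hf hg

lemma continuous_of_mem {f : ℝ → ℂ} (hf : f ∈ trigPoly ⊤) : Continuous f := by
  refine trigPoly_induction (P := Continuous) ?_ ?_ hf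
  · intro c x _
    exact (continuous_character x).const_smul c
  · intro f _ g _ hf hg
    exact hf.add hg

lemma exists_norm_le {f : ℝ → ℂ} (hf : f ∈ trigPoly ⊤) : ∃ R, ∀ t, ‖f t‖ ≤ R := by
  refine trigPoly_induction (P := fun f => ∃ R, ∀ t, ‖f t‖ ≤ R) ?_ ?_ hf
  · intro c x _
    exact ⟨‖c‖, fun t => by simp [norm_character]⟩
  · rintro f _ g _ ⟨R, hR⟩ ⟨R', hR'⟩
    exact ⟨R + R', fun t => norm_add_le_of_le (hR t) (hR' t)⟩

lemma average_add {E : Type*} [NormedAddCommGroup E] [NormedSpace ℝ E] {f g : ℝ → E}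
    (hf : Continuous f) (hg : Continuous g) (T : ℝ) :
    average (f + g) T = average f T + average g T := by
  simp only [average, Pi.add_apply]
  rw [integral_add (hf.intervalIntegrable _ _) (hg.intervalIntegrable _ _), smul_add]

lemma average_smul (c : ℂ) (f : ℝ → ℂ) (T : ℝ) : average (c • f) T = c • average f T := by
  simp only [average, Pi.smul_apply]
  rw [intervalIntegral.integral_smul, smul_comm]

lemma average_const {E : Type*} [NormedAddCommGroup E] [NormedSpace ℝ E] [CompleteSpace E]
    (c : E) {T : ℝ} (hT : 0 < T) : average (fun _ => c) T = c := by
  simp only [average, intervalIntegral.integral_const, smul_smul]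
  rw [show 1 / T * (T / 2 - -(T / 2)) = 1 by field_simp; ring, one_smul]

lemma norm_average_le {E : Type*} [NormedAddCommGroup E] [NormedSpace ℝ E] {f : ℝ → E}
    {g : ℝ → ℝ} (hg : Continuous g) (h : ∀ t, ‖f t‖ ≤ g t) {T : ℝ} (hT : 0 < T) :
    ‖average f T‖ ≤ average g T := by
  rw [average, average, norm_smul, Real.norm_of_nonneg (by positivity), smul_eq_mul]
  gcongr
  refine norm_integral_le_of_norm_le (by linarith) (Eventually.of_forall fun t _ => h t)
    (hg.intervalIntegrable _ _)

lemma tendsto_average_character {x : ℝ} (hx : x ≠ 0) :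
    Tendsto (average (character x)) atTop (nhds 0) := by
  have hc : ((2 * Real.pi * x : ℝ) : ℂ) * Complex.I ≠ 0 := by
    simp [hx, Real.pi_ne_zero]
  set c : ℂ := ((2 * Real.pi * x : ℝ) : ℂ) * Complex.I with hcdef
  have hchar : ∀ t : ℝ, character x t = Complex.exp (c * t) := by
    intro t
    simp only [character, hcdef]
    congr 1
    push_cast
    ring
  have hlim : Tendsto (fun T : ℝ => (1 / T) * (2 / ‖c‖)) atTop (nhds 0) := by
    simpa using (tendsto_inv_atTop_zero (𝕜 := ℝ)).mul_const (2 / ‖c‖)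
  refine squeeze_zero_norm' ?_ hlim
  filter_upwards [eventually_gt_atTop 0] with T hT
  rw [average, norm_smul, Real.norm_of_nonneg (by positivity : (0 : ℝ) ≤ 1 / T)]
  gcongr
  simp_rw [hchar]
  rw [integral_exp_mul_complex hc, norm_div]
  gcongr
  rw [← hchar, ← hchar]
  refine (norm_sub_le _ _).trans ?_
  rw [norm_character, norm_character]
  norm_num

lemma tendsto_mean {f : ℝ → ℂ} (hf : f ∈ trigPoly ⊤) :
    Tendsto (average f) atTop (nhds (mean f)) := by
  refine tendsto_nhds_limUnder ?_
  refine trigPoly_induction (P := fun f => ∃ m, Tendsto (average f) atTop (nhds m)) ?_ ?_ hf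
  · intro c x _
    have : ∃ m, Tendsto (average (character x)) atTop (nhds m) := by
      rcases eq_or_ne x 0 with rfl | hx
      · refine ⟨1, tendsto_const_nhds.congr' ?_⟩
        filter_upwards [eventually_gt_atTop 0] with T hT
        rw [character_zero]
        exact (average_const (1 : ℂ) hT).symm
      · exact ⟨0, tendsto_average_character hx⟩
    obtain ⟨m, hm⟩ := this
    refine ⟨c • m, (hm.const_smul c).congr fun T => (average_smul c _ T).symm⟩
  · rintro f hf g hg ⟨m, hm⟩ ⟨m', hm'⟩
    exact ⟨m + m', (hm.add hm').congr fun T =>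
      (average_add (continuous_of_mem hf) (continuous_of_mem hg) T).symm⟩

lemma mean_add {f g : ℝ → ℂ} (hf : f ∈ trigPoly ⊤) (hg : g ∈ trigPoly ⊤) :
    mean (f + g) = mean f + mean g :=
  tendsto_nhds_unique (tendsto_mean (Subalgebra.add_mem _ hf hg))
    (((tendsto_mean hf).add (tendsto_mean hg)).congr fun T =>
      (average_add (continuous_of_mem hf) (continuous_of_mem hg) T).symm)

lemma mean_smul {f : ℝ → ℂ} (c : ℂ) (hf : f ∈ trigPoly ⊤) : mean (c • f) = c * mean f :=
  tendsto_nhds_unique (tendsto_mean (Subalgebra.smul_mem _ hf c))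
    (((tendsto_mean hf).const_smul c).congr fun T => (average_smul c f T).symm)

lemma mean_sub {f g : ℝ → ℂ} (hf : f ∈ trigPoly ⊤) (hg : g ∈ trigPoly ⊤) :
    mean (f - g) = mean f - mean g := by
  have h : f - g = f + (-1 : ℂ) • g := by
    rw [neg_one_smul, sub_eq_add_neg]
  rw [h, mean_add hf (Subalgebra.smul_mem _ hg _), mean_smul _ hg]
  ring

lemma mean_sum {ι : Type*} (s : Finset ι) {f : ι → ℝ → ℂ} (hf : ∀ i ∈ s, f i ∈ trigPoly ⊤) :
    mean (∑ i ∈ s, f i) = ∑ i ∈ s, mean (f i) := by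
  classical
  induction s using Finset.induction_on with
  | empty =>
    have h := mean_smul (0 : ℂ) (Subalgebra.zero_mem (trigPoly ⊤))
    simpa using h
  | insert i s hi ih =>
    have hs : ∀ j ∈ s, f j ∈ trigPoly ⊤ := fun j hj => hf j (Finset.mem_insert_of_mem hj)
    rw [Finset.sum_insert hi, Finset.sum_insert hi, mean_add (hf i (Finset.mem_insert_self i s))
      (Subalgebra.sum_mem _ hs), ih hs]

lemma mean_one : mean 1 = 1 := by
  refine tendsto_nhds_unique (tendsto_mean (Subalgebra.one_mem _)) (tendsto_const_nhds.congr' ?_)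
  filter_upwards [eventually_gt_atTop 0] with T hT
  exact (average_const (1 : ℂ) hT).symm

lemma mean_character (x : ℝ) : mean (character x) = if x = 0 then 1 else 0 := by
  split_ifs with hx
  · rw [hx, character_zero, mean_one]
  · exact tendsto_nhds_unique (tendsto_mean (character_mem (AddSubmonoid.mem_top _)))
      (tendsto_average_character hx)

lemma tendsto_re_mean {f : ℝ → ℂ} (hf : f ∈ trigPoly ⊤) :
    Tendsto (average fun t => (f t).re) atTop (nhds (mean f).re) := by
  refine ((Complex.continuous_re.tendsto _).comp (tendsto_mean hf)).congr fun T => ?_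
  simp only [Function.comp, average, Complex.real_smul, Complex.re_ofReal_mul, smul_eq_mul]
  congr 1
  exact (Complex.reCLM.intervalIntegral_comp_comm
    ((continuous_of_mem hf).intervalIntegrable _ _)).symm

/-- The Bohr mean is monotone. -/
lemma norm_mean_le {f g : ℝ → ℂ} (hf : f ∈ trigPoly ⊤) (hg : g ∈ trigPoly ⊤)
    (h : ∀ t, ‖f t‖ ≤ (g t).re) : ‖mean f‖ ≤ (mean g).re := by
  refine le_of_tendsto_of_tendsto (tendsto_mean hf).norm (tendsto_re_mean hg) ?_
  filter_upwards [eventually_gt_atTop 0] with T hT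
  exact norm_average_le (Complex.continuous_re.comp (continuous_of_mem hg)) h hT

lemma re_mean_mono {f g : ℝ → ℂ} (hf : f ∈ trigPoly ⊤) (hg : g ∈ trigPoly ⊤)
    (h : ∀ t, (f t).re ≤ (g t).re) : (mean f).re ≤ (mean g).re := by
  refine le_of_tendsto_of_tendsto (tendsto_re_mean hf) (tendsto_re_mean hg) ?_
  filter_upwards [eventually_gt_atTop 0] with T hT
  simp only [average, smul_eq_mul]
  gcongr
  exact intervalIntegral.integral_mono (by linarith)
    ((Complex.continuous_re.comp (continuous_of_mem hf)).intervalIntegrable _ _)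
    ((Complex.continuous_re.comp (continuous_of_mem hg)).intervalIntegrable _ _) h

lemma mean_mul {f g : ℝ → ℂ} (hf : f ∈ trigPoly (AddSubmonoid.nonneg ℝ))
    (hg : g ∈ trigPoly (AddSubmonoid.nonneg ℝ)) : mean (f * g) = mean f * mean g := by
  refine trigPoly_induction (P := fun f => mean (f * g) = mean f * mean g) ?_ ?_ hf
  · intro c x hx
    refine trigPoly_induction
      (P := fun g => mean (c • character x * g) = mean (c • character x) * mean g) ?_ ?_ hg
    · intro d y hy
      have hx' : 0 ≤ x := hx
      have hy' : 0 ≤ y := hy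
      have hmem : ∀ z, character z ∈ trigPoly ⊤ := fun z => character_mem (AddSubmonoid.mem_top z)
      rw [smul_mul_smul_comm, ← character_add, mean_smul _ (hmem _), mean_smul _ (hmem _),
        mean_smul _ (hmem _), mean_character, mean_character, mean_character]
      by_cases hx0 : x = 0
      · simp [hx0]
      · have : x + y ≠ 0 := by positivity
        simp [hx0, this]
    · intro g hg k hk hgm hkm
      have hc : c • character x ∈ trigPoly ⊤ :=
        Subalgebra.smul_mem _ (character_mem (AddSubmonoid.mem_top x)) c
      rw [mul_add, mean_add (Subalgebra.mul_mem _ hc (mem_top hg))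
        (Subalgebra.mul_mem _ hc (mem_top hk)), mean_add (mem_top hg) (mem_top hk), hgm, hkm,
        mul_add]
  · intro f hf k hk hfm hkm
    rw [add_mul, mean_add (Subalgebra.mul_mem _ (mem_top hf) (mem_top hg))
      (Subalgebra.mul_mem _ (mem_top hk) (mem_top hg)), mean_add (mem_top hf) (mem_top hk),
      hfm, hkm, add_mul]

lemma mean_character_mul {x : ℝ} (hx : 0 < x) {f : ℝ → ℂ}
    (hf : f ∈ trigPoly (AddSubmonoid.nonneg ℝ)) : mean (character x * f) = 0 := by
  rw [mean_mul (character_mem (S := AddSubmonoid.nonneg ℝ) hx.le) hf, mean_character,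
    if_neg hx.ne', zero_mul]

lemma mul_star_apply (f : ℝ → ℂ) (t : ℝ) : (f * star f) t = ((‖f t‖ ^ 2 : ℝ) : ℂ) := by
  rw [Pi.mul_apply, Pi.star_apply, Complex.star_def, Complex.mul_conj, Complex.normSq_eq_norm_sq]

lemma mul_star_mem {f : ℝ → ℂ} (hf : f ∈ trigPoly ⊤) : f * star f ∈ trigPoly ⊤ :=
  Subalgebra.mul_mem _ hf (star_mem hf)

lemma meanSq_mono {f g : ℝ → ℂ} (hf : f ∈ trigPoly ⊤) (hg : g ∈ trigPoly ⊤)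
    (h : ∀ t, ‖f t‖ ≤ ‖g t‖) : meanSq f ≤ meanSq g := by
  refine re_mean_mono (mul_star_mem hf) (mul_star_mem hg) fun t => ?_
  rw [mul_star_apply, mul_star_apply, Complex.ofReal_re, Complex.ofReal_re]
  gcongr
  exact h t

lemma meanSq_nonneg {f : ℝ → ℂ} (hf : f ∈ trigPoly ⊤) : 0 ≤ meanSq f := by
  have h := meanSq_mono (Subalgebra.zero_mem _) hf (fun t => by simp)
  have h0 := mean_smul (0 : ℂ) (Subalgebra.zero_mem (trigPoly ⊤))
  simp only [zero_smul, zero_mul] at h0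
  simpa [meanSq, h0] using h

lemma meanSq_star (f : ℝ → ℂ) : meanSq (star f) = meanSq f := by
  rw [meanSq, meanSq, star_star, mul_comm]

lemma norm_mean_mul_le_of_pos {f g : ℝ → ℂ} (hf : f ∈ trigPoly ⊤) (hg : g ∈ trigPoly ⊤) {A B : ℝ}
    (hA : 0 < A) (hB : 0 < B) (hfA : meanSq f ≤ A ^ 2) (hgB : meanSq g ≤ B ^ 2) :
    ‖mean (f * g)‖ ≤ A * B := by
  have hmf := Subalgebra.smul_mem _ (mul_star_mem hf) ((B / (2 * A) : ℝ) : ℂ)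
  have hmg := Subalgebra.smul_mem _ (mul_star_mem hg) ((A / (2 * B) : ℝ) : ℂ)
  refine (norm_mean_le (Subalgebra.mul_mem _ hf hg) (Subalgebra.add_mem _ hmf hmg) ?_).trans ?_
  · intro t
    rw [Pi.add_apply, Pi.smul_apply, Pi.smul_apply, mul_star_apply, mul_star_apply, smul_eq_mul,
      smul_eq_mul, ← Complex.ofReal_mul, ← Complex.ofReal_mul, ← Complex.ofReal_add,
      Complex.ofReal_re, Pi.mul_apply, norm_mul]
    have h := sq_nonneg (B * ‖f t‖ - A * ‖g t‖)
    have : B / (2 * A) * ‖f t‖ ^ 2 + A / (2 * B) * ‖g t‖ ^ 2 - ‖f t‖ * ‖g t‖ =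
        (B * ‖f t‖ - A * ‖g t‖) ^ 2 / (2 * A * B) := by
      field_simp
      ring
    have h2 : 0 ≤ (B * ‖f t‖ - A * ‖g t‖) ^ 2 / (2 * A * B) := by positivity
    linarith
  · rw [mean_add hmf hmg, mean_smul _ (mul_star_mem hf), mean_smul _ (mul_star_mem hg),
      Complex.add_re, Complex.re_ofReal_mul, Complex.re_ofReal_mul]
    change B / (2 * A) * meanSq f + A / (2 * B) * meanSq g ≤ A * B
    calc B / (2 * A) * meanSq f + A / (2 * B) * meanSq g
        ≤ B / (2 * A) * A ^ 2 + A / (2 * B) * B ^ 2 := by gcongr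
      _ = A * B := by field_simp; ring

lemma norm_mean_mul_le {f g : ℝ → ℂ} (hf : f ∈ trigPoly ⊤) (hg : g ∈ trigPoly ⊤) :
    ‖mean (f * g)‖ ≤ √(meanSq f) * √(meanSq g) := by
  have hlim : Tendsto (fun ε : ℝ => (√(meanSq f) + ε) * (√(meanSq g) + ε))
      (nhdsWithin 0 (Set.Ioi 0)) (nhds (√(meanSq f) * √(meanSq g))) := by
    have : Continuous fun ε : ℝ => (√(meanSq f) + ε) * (√(meanSq g) + ε) := by fun_prop
    simpa using (this.tendsto 0).mono_left nhdsWithin_le_nhds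
  refine ge_of_tendsto hlim ?_
  filter_upwards [self_mem_nhdsWithin] with ε hε
  have hε' : 0 < ε := hε
  have key : ∀ x : ℝ, x ≤ (√x + ε) ^ 2 := fun x => by
    rw [← Real.sqrt_le_left (by positivity)]
    linarith
  exact norm_mean_mul_le_of_pos hf hg (by positivity) (by positivity) (key _) (key _)

lemma sqrt_meanSq_add_le {f g : ℝ → ℂ} (hf : f ∈ trigPoly ⊤) (hg : g ∈ trigPoly ⊤) :
    √(meanSq (f + g)) ≤ √(meanSq f) + √(meanSq g) := by
  have hf' := star_mem hf
  have hg' := star_mem hg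
  rw [Real.sqrt_le_left (by positivity)]
  have hexp : (f + g) * star (f + g) = f * star f + f * star g + (g * star f + g * star g) := by
    rw [star_add]; ring
  rw [meanSq, hexp, mean_add, mean_add, mean_add, Complex.add_re, Complex.add_re, Complex.add_re]
  · have h1 := (Complex.re_le_norm _).trans (norm_mean_mul_le hf hg')
    have h2 := (Complex.re_le_norm _).trans (norm_mean_mul_le hg hf')
    rw [meanSq_star] at h1 h2
    have h3 := Real.sq_sqrt (meanSq_nonneg hf)
    have h4 := Real.sq_sqrt (meanSq_nonneg hg)
    rw [meanSq] at h3 h4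
    simp only [meanSq] at *
    nlinarith
  all_goals
    first
      | exact Subalgebra.mul_mem _ (by assumption) (by assumption)
      | exact Subalgebra.add_mem _ (Subalgebra.mul_mem _ (by assumption) (by assumption))
          (Subalgebra.mul_mem _ (by assumption) (by assumption))

/-- Parseval's identity for generalized trigonometric polynomials. -/
lemma meanSq_sum {ι : Type*} [DecidableEq ι] (s : Finset ι) {x : ι → ℝ} (hx : Function.Injective x)
    (c : ι → ℂ) : meanSq (∑ i ∈ s, c i • character (x i)) = ∑ i ∈ s, ‖c i‖ ^ 2 := by
  have hmem : ∀ z, character z ∈ trigPoly ⊤ := fun z => character_mem (AddSubmonoid.mem_top z)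
  have hexp : (∑ i ∈ s, c i • character (x i)) * star (∑ i ∈ s, c i • character (x i)) =
      ∑ i ∈ s, ∑ j ∈ s, (c i * star (c j)) • character (x i - x j) := by
    rw [star_sum, Finset.sum_mul_sum]
    refine Finset.sum_congr rfl fun i _ => Finset.sum_congr rfl fun j _ => ?_
    rw [star_smul, star_character, smul_mul_smul_comm, ← character_add, sub_eq_add_neg]
  have hm : ∀ i j, (c i * star (c j)) • character (x i - x j) ∈ trigPoly ⊤ :=
    fun i j => Subalgebra.smul_mem _ (hmem _) _
  rw [meanSq, hexp, mean_sum s fun i _ => Subalgebra.sum_mem _ fun j _ => hm i j]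
  rw [Complex.re_sum]
  refine Finset.sum_congr rfl fun i hi => ?_
  rw [mean_sum s fun j _ => hm i j]
  have : ∀ j, mean ((c i * star (c j)) • character (x i - x j)) =
      if i = j then c i * star (c j) else 0 := by
    intro j
    rw [mean_smul _ (hmem _), mean_character]
    simp [sub_eq_zero, hx.eq_iff]
  simp_rw [this]
  rw [Finset.sum_ite_eq s i, if_pos hi, Complex.star_def, Complex.mul_conj,
    Complex.normSq_eq_norm_sq, Complex.ofReal_re]

lemma exists_approx {f : ℝ → ℂ} (hf : f ∈ trigPoly ⊤) {φ : ℝ → ℝ} (hφ : Continuous φ) {δ : ℝ}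
    (hδ : 0 < δ) :
    ∃ p ∈ trigPoly ⊤, ∀ t, |(p t).re - φ (‖f t‖ ^ 2)| ≤ δ := by
  obtain ⟨R, hR⟩ := exists_norm_le hf
  obtain ⟨q, hq⟩ := exists_polynomial_near_of_continuousOn 0 (R ^ 2) φ hφ.continuousOn δ hδ
  have happ : ∀ t, Polynomial.aeval (f * star f) (q.map (algebraMap ℝ ℂ)) t =
      ((q.eval (‖f t‖ ^ 2) : ℝ) : ℂ) := by
    intro t
    have h := Polynomial.aeval_algHom_apply (Pi.evalAlgHom ℂ (fun _ : ℝ => ℂ) t) (f * star f)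
      (q.map (algebraMap ℝ ℂ))
    rw [Pi.evalAlgHom_apply, Pi.evalAlgHom_apply] at h
    rw [← h, mul_star_apply, Polynomial.aeval_map_algebraMap]
    exact Polynomial.aeval_algebraMap_apply_eq_algebraMap_eval (A := ℂ) _ q
  refine ⟨Polynomial.aeval (f * star f) (q.map (algebraMap ℝ ℂ)), ?_, fun t => ?_⟩
  · exact Algebra.adjoin_le (Set.singleton_subset_iff.2 (mul_star_mem hf))
      (Polynomial.aeval_mem_adjoin_singleton _ _)
  · rw [happ, Complex.ofReal_re]
    refine (hq _ ⟨by positivity, ?_⟩).le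
    have := hR t
    gcongr

lemma exists_tendsto_average_norm {f : ℝ → ℂ} (hf : f ∈ trigPoly ⊤) :
    ∃ L : ℝ, Tendsto (average fun t => ‖f t‖) atTop (nhds L) := by
  refine cauchySeq_tendsto_of_complete (Metric.cauchySeq_iff.2 fun ε hε => ?_)
  obtain ⟨p, hp, hpf⟩ := exists_approx hf Real.continuous_sqrt (show 0 < ε / 4 by positivity)
  have hcont := Complex.continuous_re.comp (continuous_of_mem hp)
  have hclose : ∀ T : ℝ, 0 < T →
      |average (fun t => ‖f t‖) T - average (fun t => (p t).re) T| ≤ ε / 4 := by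
    intro T hT
    have h := norm_average_le (f := fun t => (p t).re - ‖f t‖) (continuous_const (y := ε / 4))
      (fun t => by simpa using hpf t) hT
    rw [average_const _ hT] at h
    have hadd := average_add (f := fun t => (p t).re - ‖f t‖) (g := fun t => ‖f t‖)
      (hcont.sub (continuous_of_mem hf).norm) (continuous_of_mem hf).norm T
    have heq : ((fun t => (p t).re - ‖f t‖) + fun t => ‖f t‖) = fun t => (p t).re := by
      funext t; simp
    rw [heq] at hadd
    rw [hadd, abs_sub_comm]
    simpa using h
  obtain ⟨T₀, hT₀⟩ := Metric.cauchySeq_iff.1 (tendsto_re_mean hp).cauchySeq (ε / 4) (by positivity)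
  refine ⟨max T₀ 1, fun T hT T' hT' => ?_⟩
  have h1 := hclose T (by linarith [le_max_right T₀ 1])
  have h2 := hclose T' (by linarith [le_max_right T₀ 1])
  have h3 := hT₀ T ((le_max_left _ _).trans hT) T' ((le_max_left _ _).trans hT')
  rw [Real.dist_eq, abs_lt] at *
  rw [abs_le] at h1 h2
  constructor <;> linarith [h1.1, h1.2, h2.1, h2.2, h3.1, h3.2]

/-- Every real part of a trigonometric polynomial is the real part of one with nonnegative
frequencies. -/
lemma exists_re_eq {q : ℝ → ℂ} (hq : q ∈ trigPoly ⊤) :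
    ∃ h ∈ trigPoly (AddSubmonoid.nonneg ℝ), (∀ t, (h t).re = (q t).re) ∧ (mean h).im = 0 := by
  have key : ∃ h ∈ trigPoly (AddSubmonoid.nonneg ℝ), ∀ t, (h t).re = (q t).re := by
    refine trigPoly_induction
      (P := fun q => ∃ h ∈ trigPoly (AddSubmonoid.nonneg ℝ), ∀ t, (h t).re = (q t).re) ?_ ?_ hq
    · intro c x _
      rcases le_total 0 x with hx | hx
      · exact ⟨c • character x, Subalgebra.smul_mem _ (character_mem hx) _, fun t => rfl⟩
      · refine ⟨star (c • character x), ?_, fun t => by simp⟩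
        rw [star_smul, star_character]
        exact Subalgebra.smul_mem _ (character_mem (show 0 ≤ -x by linarith)) _
    · rintro f _ g _ ⟨h, hh, hhf⟩ ⟨k, hk, hkg⟩
      exact ⟨h + k, Subalgebra.add_mem _ hh hk, fun t => by simp [hhf, hkg]⟩
  obtain ⟨h, hh, hre⟩ := key
  have h1 := Subalgebra.one_mem (trigPoly (AddSubmonoid.nonneg ℝ))
  have hc := Subalgebra.smul_mem _ h1 ((mean h).im * Complex.I)
  refine ⟨h - ((mean h).im * Complex.I) • 1, Subalgebra.sub_mem _ hh hc, fun t => ?_, ?_⟩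
  · simp [hre]
  · rw [mean_sub (mem_top hh) (mem_top hc), mean_smul _ (mem_top h1), mean_one]
    simp

lemma mean_pow {h : ℝ → ℂ} (hh : h ∈ trigPoly (AddSubmonoid.nonneg ℝ)) (n : ℕ) :
    mean (h ^ n) = mean h ^ n := by
  induction n with
  | zero => rw [pow_zero, pow_zero, mean_one]
  | succ n ih => rw [pow_succ, pow_succ, mean_mul (Subalgebra.pow_mem _ hh n) hh, ih]

/-- The exponential of an analytic trigonometric polynomial is approximated by such polynomials,
compatibly with means. -/
lemma exists_near_exp {h : ℝ → ℂ} (hh : h ∈ trigPoly (AddSubmonoid.nonneg ℝ)) {η : ℝ}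
    (hη : 0 < η) :
    ∃ G ∈ trigPoly (AddSubmonoid.nonneg ℝ), (∀ t, ‖Complex.exp (h t) - G t‖ ≤ η) ∧
      ‖Complex.exp (mean h) - mean G‖ ≤ η := by
  obtain ⟨R₀, hR₀⟩ := exists_norm_le (mem_top hh)
  set R := max R₀ ‖mean h‖ with hR
  have hR0 : 0 ≤ R := (norm_nonneg _).trans (le_max_right _ _)
  obtain ⟨n, hn1, hn2⟩ : ∃ n : ℕ, R ^ n / n.factorial * 2 ≤ η ∧ R / (n + 1) ≤ 1 / 2 := by
    have h1 : ∀ᶠ n : ℕ in atTop, R ^ n / n.factorial * 2 ≤ η := by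
      have := (FloorSemiring.tendsto_pow_div_factorial_atTop R).mul_const 2
      rw [zero_mul] at this
      exact (this.eventually_lt_const hη).mono fun _ => le_of_lt
    have h2 : ∀ᶠ n : ℕ in atTop, R / (n + 1) ≤ 1 / 2 := by
      obtain ⟨m, hm⟩ := exists_nat_ge (2 * R)
      filter_upwards [eventually_ge_atTop m] with n hn
      have : (m : ℝ) ≤ n := by exact_mod_cast hn
      rw [div_le_div_iff₀ (by positivity) (by positivity)]
      linarith
    exact (h1.and h2).exists
  have hexp : ∀ z : ℂ, ‖z‖ ≤ R →
      ‖Complex.exp z - ∑ m ∈ Finset.range n, z ^ m / (m.factorial : ℂ)‖ ≤ η := by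
    intro z hz
    refine (Complex.exp_bound' ?_).trans (le_trans ?_ hn1)
    · rw [Nat.cast_succ]
      refine le_trans ?_ hn2
      gcongr
    · gcongr
  have hpow := fun m : ℕ =>
    Subalgebra.smul_mem _ (Subalgebra.pow_mem _ hh m) ((m.factorial : ℂ)⁻¹)
  refine ⟨∑ m ∈ Finset.range n, ((m.factorial : ℂ)⁻¹) • h ^ m,
    Subalgebra.sum_mem _ fun m _ => hpow m, fun t => ?_, ?_⟩
  · have h1 := hexp (h t) ((hR₀ t).trans (le_max_left _ _))
    have h2 : (∑ m ∈ Finset.range n, ((m.factorial : ℂ)⁻¹) • h ^ m) t =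
        ∑ m ∈ Finset.range n, h t ^ m / (m.factorial : ℂ) := by
      rw [Finset.sum_apply]
      exact Finset.sum_congr rfl fun m _ => by
        rw [Pi.smul_apply, Pi.pow_apply, smul_eq_mul, div_eq_inv_mul]
    rwa [h2]
  · have h1 := hexp (mean h) (le_max_right _ _)
    have h2 : mean (∑ m ∈ Finset.range n, ((m.factorial : ℂ)⁻¹) • h ^ m) =
        ∑ m ∈ Finset.range n, mean h ^ m / (m.factorial : ℂ) := by
      rw [mean_sum _ fun m _ => mem_top (hpow m)]
      exact Finset.sum_congr rfl fun m _ => by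
        rw [mean_smul _ (mem_top (Subalgebra.pow_mem _ hh m)), mean_pow hh, div_eq_inv_mul]
    rwa [h2]

lemma exp_neg_quadratic_le {x : ℝ} (hx : 0 ≤ x) (hx' : x ≤ 2 / 3) :
    Real.exp (-(x + 3 / 2 * x ^ 2)) ≤ 1 - x := by
  have h := Real.quadratic_le_exp_of_nonneg (x := x + 3 / 2 * x ^ 2) (by positivity)
  rw [Real.exp_neg]
  refine inv_le_of_inv_le₀ (by linarith) (le_trans ?_ h)
  rw [inv_le_iff_one_le_mul₀ (by linarith)]
  have h3 : (1 + (x + 3 / 2 * x ^ 2) + (x + 3 / 2 * x ^ 2) ^ 2 / 2) * (1 - x) - 1 =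
      x ^ 2 * (1 - x / 2 - 3 / 8 * x ^ 2 - 9 / 8 * x ^ 3) := by ring
  have h1 : x ^ 2 ≤ (2 / 3) ^ 2 := by gcongr
  have h2 : x ^ 3 ≤ (2 / 3) ^ 3 := by gcongr
  have h4 : 0 ≤ 1 - x / 2 - 3 / 8 * x ^ 2 - 9 / 8 * x ^ 3 := by norm_num at h1 h2; linarith
  nlinarith [mul_nonneg (sq_nonneg x) h4]

/-- An analytic multiplier of modulus at most `1 - 2/3 * ‖f‖` that is close to `1` in mean
square. -/
lemma exists_multiplier {f : ℝ → ℂ} (hf : f ∈ trigPoly ⊤) (hf1 : ∀ t, ‖f t‖ ≤ 1) {ε : ℝ}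
    (hε : 0 < ε) :
    ∃ G ∈ trigPoly (AddSubmonoid.nonneg ℝ), (∀ t, ‖G t‖ ≤ 1 - 2 / 3 * ‖f t‖) ∧
      meanSq (G - 1) ≤ 16 / 9 * meanSq f + ε := by
  set δ := ε / 7 with hδdef
  have hδ : 0 < δ := by positivity
  obtain ⟨p, hp, hpf⟩ := exists_approx hf
    (φ := fun y => 2 / 3 * √y + 3 / 2 * (2 / 3 * √y) ^ 2 + 2 * δ) (by fun_prop) hδ
  simp only [Real.sqrt_sq (norm_nonneg _)] at hpf
  obtain ⟨h, hh, hre, him⟩ := exists_re_eq hp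
  have hexpδ : Real.exp (-δ) < 1 := by simpa using hδ
  have hexpδ' : 1 - δ ≤ Real.exp (-δ) := by linarith [Real.add_one_le_exp (-δ)]
  set η := (1 - Real.exp (-δ)) / 3 with hηdef
  have hη : 0 < η := by rw [hηdef]; linarith
  have hη' : η ≤ δ / 3 := by rw [hηdef]; linarith
  obtain ⟨G, hG, hGexp, hGmean⟩ := exists_near_exp (Subalgebra.neg_mem _ hh) hη
  have hGt : ∀ t, ‖G t‖ ≤ 1 - 2 / 3 * ‖f t‖ := by
    intro t
    set x := 2 / 3 * ‖f t‖ with hx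
    have hx0 : 0 ≤ x := by positivity
    have hx1 : x ≤ 2 / 3 := by rw [hx]; linarith [hf1 t]
    have h1 : ‖Complex.exp ((-h) t)‖ ≤ Real.exp (-δ) * (1 - x) := by
      rw [Complex.norm_exp, Pi.neg_apply, Complex.neg_re, hre]
      refine le_trans ?_ (mul_le_mul_of_nonneg_left (exp_neg_quadratic_le hx0 hx1)
        (Real.exp_pos _).le)
      rw [← Real.exp_add, Real.exp_le_exp]
      have := (abs_le.1 (hpf t)).1
      rw [← hx] at this
      linarith
    have h2 : ‖G t‖ ≤ ‖Complex.exp ((-h) t)‖ + η := by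
      have h3 := norm_sub_norm_le (G t) (Complex.exp ((-h) t))
      rw [norm_sub_rev] at h3
      linarith [hGexp t]
    have h4 : 0 ≤ (1 - Real.exp (-δ)) * (2 / 3 - x) :=
      mul_nonneg (by linarith) (by linarith)
    rw [hηdef] at h2
    nlinarith
  refine ⟨G, hG, hGt, ?_⟩
  have hGT := mem_top hG
  have h1T := Subalgebra.one_mem (trigPoly ⊤)
  have hpoint : (mean (G * star G + (2 : ℂ) • p)).re ≤
      (mean ((1 + 6 * δ : ℂ) • 1 + (16 / 9 : ℂ) • (f * star f))).re := by
    refine re_mean_mono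
      (Subalgebra.add_mem _ (mul_star_mem hGT) (Subalgebra.smul_mem _ hp _))
      (Subalgebra.add_mem _ (Subalgebra.smul_mem _ h1T _)
        (Subalgebra.smul_mem _ (mul_star_mem hf) _)) fun t => ?_
    have e1 : ((G * star G + (2 : ℂ) • p) t).re = ‖G t‖ ^ 2 + 2 * (p t).re := by
      rw [Pi.add_apply, mul_star_apply, Complex.add_re, Complex.ofReal_re]
      simp
    have e2 : (((1 + 6 * δ : ℂ) • 1 + (16 / 9 : ℂ) • (f * star f)) t).re =
        1 + 6 * δ + 16 / 9 * ‖f t‖ ^ 2 := by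
      rw [Pi.add_apply, Pi.smul_apply, Pi.smul_apply, mul_star_apply, smul_eq_mul, smul_eq_mul,
        show (1 + 6 * δ : ℂ) * (1 : ℝ → ℂ) t + 16 / 9 * ((‖f t‖ ^ 2 : ℝ) : ℂ) =
          ((1 + 6 * δ + 16 / 9 * ‖f t‖ ^ 2 : ℝ) : ℂ) by push_cast; simp, Complex.ofReal_re]
    rw [e1, e2]
    have h1 : ‖G t‖ ^ 2 ≤ (1 - 2 / 3 * ‖f t‖) ^ 2 := by
      gcongr
      exact hGt t
    have h2 := (abs_le.1 (hpf t)).2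
    nlinarith
  rw [mean_add (mul_star_mem hGT) (Subalgebra.smul_mem _ hp _), mean_smul _ hp,
    mean_add (Subalgebra.smul_mem _ h1T _) (Subalgebra.smul_mem _ (mul_star_mem hf) _),
    mean_smul _ h1T, mean_smul _ (mul_star_mem hf), mean_one] at hpoint
  have hpoint' : meanSq G + 2 * (mean p).re ≤ 1 + 6 * δ + 16 / 9 * meanSq f := by
    simpa [meanSq, Complex.div_re, Complex.mul_re] using hpoint
  have hmh : (mean h).re = (mean p).re :=
    le_antisymm (re_mean_mono (mem_top hh) hp fun t => (hre t).le)
      (re_mean_mono hp (mem_top hh) fun t => (hre t).ge)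
  have hmG : 1 - (mean p).re - η ≤ (mean G).re := by
    have hneg : mean (-h) = ((-(mean p).re : ℝ) : ℂ) := by
      rw [← neg_one_smul ℂ h, mean_smul _ (mem_top hh)]
      apply Complex.ext <;> simp [hmh, him]
    rw [hneg, ← Complex.ofReal_exp] at hGmean
    have h1 := (Complex.re_le_norm _).trans hGmean
    rw [Complex.sub_re, Complex.ofReal_re] at h1
    linarith [Real.add_one_le_exp (-(mean p).re)]
  have hexp : meanSq (G - 1) = meanSq G - 2 * (mean G).re + 1 := by
    have hsG := star_mem hGT
    have e : (G - 1) * star (G - 1) = G * star G - G - star G + 1 := by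
      rw [star_sub, star_one]; ring
    have hstar : (mean (star G)).re = (mean G).re :=
      le_antisymm (re_mean_mono hsG hGT fun t => by simp)
        (re_mean_mono hGT hsG fun t => by simp)
    rw [meanSq, e, mean_add (Subalgebra.sub_mem _ (Subalgebra.sub_mem _ (mul_star_mem hGT) hGT) hsG)
      h1T, mean_sub (Subalgebra.sub_mem _ (mul_star_mem hGT) hGT) hsG,
      mean_sub (mul_star_mem hGT) hGT, mean_one]
    simp only [Complex.add_re, Complex.sub_re, hstar, Complex.one_re, meanSq]
    ring
  rw [hexp]
  linarith

lemma sqrt_meanSq_tail_le {G : ℕ → ℝ → ℂ} {κ : ℝ}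
    (hG : ∀ i, G i ∈ trigPoly (AddSubmonoid.nonneg ℝ)) (hG1 : ∀ i t, ‖G i t‖ ≤ 1)
    (hGκ : ∀ i, √(meanSq (G i - 1)) ≤ κ * (1 / 6) ^ i) {j J : ℕ} (hJ : j + 1 ≤ J) :
    √(meanSq (∏ i ∈ Finset.Ico (j + 1) J, G i - 1)) ≤
      κ / 5 * ((1 / 6) ^ j - 6 * (1 / 6) ^ J) := by
  have h1 := Subalgebra.one_mem (trigPoly ⊤)
  induction J, hJ using Nat.le_induction with
  | base =>
    have h0 : mean (0 : ℝ → ℂ) = 0 := by simpa using mean_sum (∅ : Finset ℕ) (f := fun _ => 0)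
    simp only [Finset.Ico_self, Finset.prod_empty, sub_self, meanSq, zero_mul, h0]
    rw [Real.sqrt_eq_zero_of_nonpos (by simp), pow_succ]
    exact le_of_eq (by ring)
  | succ J hJ ih =>
    have hP := Subalgebra.prod_mem (trigPoly ⊤) fun i (_ : i ∈ Finset.Ico (j + 1) J) =>
      mem_top (hG i)
    have hP1 := Subalgebra.sub_mem _ hP h1
    have hGJ := mem_top (hG J)
    rw [Finset.prod_Ico_succ_top hJ]
    have e : (∏ i ∈ Finset.Ico (j + 1) J, G i) * G J - 1 =
        (∏ i ∈ Finset.Ico (j + 1) J, G i - 1) * G J + (G J - 1) := by ring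
    rw [e]
    refine (sqrt_meanSq_add_le (Subalgebra.mul_mem _ hP1 hGJ) (Subalgebra.sub_mem _ hGJ h1)).trans ?_
    have h2 : √(meanSq ((∏ i ∈ Finset.Ico (j + 1) J, G i - 1) * G J)) ≤
        √(meanSq (∏ i ∈ Finset.Ico (j + 1) J, G i - 1)) := by
      refine Real.sqrt_le_sqrt (meanSq_mono (Subalgebra.mul_mem _ hP1 hGJ) hP1 fun t => ?_)
      rw [Pi.mul_apply, norm_mul]
      exact mul_le_of_le_one_right (norm_nonneg _) (hG1 J t)
    have h3 := hGκ J
    rw [pow_succ]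
    linarith

lemma norm_riesz_sum_le {f G : ℕ → ℝ → ℂ} {w : ℝ} (hw : 0 ≤ w)
    (hG : ∀ i t, ‖G i t‖ ≤ 1 - w * ‖f i t‖) (J : ℕ) (t : ℝ) :
    ‖(∑ j ∈ Finset.range J, (w : ℂ) • (f j * ∏ i ∈ Finset.Ico (j + 1) J, G i)) t‖ ≤ 1 := by
  induction J with
  | zero => simp
  | succ J ih =>
    have e : (∑ j ∈ Finset.range (J + 1), (w : ℂ) • (f j * ∏ i ∈ Finset.Ico (j + 1) (J + 1), G i)) =
        (∑ j ∈ Finset.range J, (w : ℂ) • (f j * ∏ i ∈ Finset.Ico (j + 1) J, G i)) * G J +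
          (w : ℂ) • f J := by
      rw [Finset.sum_range_succ, Finset.Ico_self, Finset.prod_empty, mul_one, Finset.sum_mul]
      congr 1
      refine Finset.sum_congr rfl fun j hj => ?_
      rw [Finset.prod_Ico_succ_top (Finset.mem_range.1 hj), smul_mul_assoc, mul_assoc]
    rw [e, Pi.add_apply, Pi.mul_apply, Pi.smul_apply, smul_eq_mul]
    refine (norm_add_le _ _).trans ?_
    rw [norm_mul, norm_mul, Complex.norm_real, Real.norm_of_nonneg hw]
    have h1 := mul_le_mul_of_nonneg_right ih (norm_nonneg (G J t))
    linarith [hG J t]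

section Coefficients

variable {ι : Type*} (s : Finset ι) (x : ι → ℝ) (c : ι → ℂ)

lemma sum_character_mem : ∑ l ∈ s, c l • character (x l) ∈ trigPoly ⊤ :=
  Subalgebra.sum_mem _ fun _ _ =>
    Subalgebra.smul_mem _ (character_mem (AddSubmonoid.mem_top _)) _

lemma mean_mul_character_eq_zero {P : ℝ → ℂ} (hP : P ∈ trigPoly (AddSubmonoid.nonneg ℝ)) {y : ℝ}
    (hy : ∀ l ∈ s, 0 < y + x l) :
    mean ((∑ l ∈ s, c l • character (x l)) * P * character y) = 0 := by
  have e : (∑ l ∈ s, c l • character (x l)) * P * character y =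
      ∑ l ∈ s, c l • (character (y + x l) * P) := by
    rw [Finset.sum_mul, Finset.sum_mul]
    refine Finset.sum_congr rfl fun l _ => ?_
    rw [character_add, smul_mul_assoc, smul_mul_assoc]
    congr 1
    ring
  have hm : ∀ l, character (y + x l) * P ∈ trigPoly ⊤ := fun l =>
    Subalgebra.mul_mem _ (character_mem (AddSubmonoid.mem_top _)) (mem_top hP)
  rw [e, mean_sum _ fun l _ => Subalgebra.smul_mem _ (hm l) _]
  refine Finset.sum_eq_zero fun l hl => ?_
  rw [mean_smul _ (hm l), mean_character_mul (hy l hl) hP, mul_zero]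

lemma norm_mean_mul_character_sub_le [DecidableEq ι] (hx : Function.Injective x)
    {P : ℝ → ℂ} (hP : P ∈ trigPoly ⊤) (k : ι) :
    ‖mean ((∑ l ∈ s, c l • character (x l)) * P * character (-x k)) -
        if k ∈ s then c k else 0‖ ≤
      √(meanSq (∑ l ∈ s, c l • character (x l))) * √(meanSq (P - 1)) := by
  set f := ∑ l ∈ s, c l • character (x l) with hf
  have hfm : f ∈ trigPoly ⊤ := sum_character_mem s x c
  have hchar : ∀ y, character y ∈ trigPoly ⊤ := fun y => character_mem (AddSubmonoid.mem_top y)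
  have hP1 := Subalgebra.sub_mem _ hP (Subalgebra.one_mem (trigPoly ⊤))
  have hfc := Subalgebra.mul_mem _ hfm (hchar (-x k))
  have e : f * P * character (-x k) = f * character (-x k) + f * character (-x k) * (P - 1) := by
    ring
  have hcoeff : mean (f * character (-x k)) = if k ∈ s then c k else 0 := by
    have e2 : f * character (-x k) = ∑ l ∈ s, c l • character (x l - x k) := by
      rw [hf, Finset.sum_mul]
      refine Finset.sum_congr rfl fun l _ => ?_
      rw [smul_mul_assoc, ← character_add, sub_eq_add_neg]
    rw [e2, mean_sum _ fun l _ => Subalgebra.smul_mem _ (hchar _) _]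
    have : ∀ l, mean (c l • character (x l - x k)) = if l = k then c l else 0 := by
      intro l
      rw [mean_smul _ (hchar _), mean_character]
      simp [sub_eq_zero, hx.eq_iff]
    simp_rw [this]
    rw [Finset.sum_ite_eq' s k]
  rw [e, mean_add hfc (Subalgebra.mul_mem _ hfc hP1), hcoeff, add_sub_cancel_left]
  refine (norm_mean_mul_le hfc hP1).trans ?_
  gcongr
  refine meanSq_mono hfc hfm fun t => ?_
  rw [Pi.mul_apply, norm_mul, norm_character, mul_one]

end Coefficients

/-- The first index of the `j`-th block; the `j`-th block has length `36 ^ j`. -/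
def blockStart (j : ℕ) : ℕ := ∑ i ∈ Finset.range j, 36 ^ i

/-- The indices in the `j`-th block. -/
def block (N j : ℕ) : Finset (Fin N) :=
  Finset.univ.filter fun k => blockStart j ≤ k ∧ (k : ℕ) < blockStart (j + 1)

lemma blockStart_succ (j : ℕ) : blockStart (j + 1) = blockStart j + 36 ^ j :=
  Finset.sum_range_succ _ _

lemma blockStart_mono : Monotone blockStart :=
  monotone_nat_of_le_succ fun j => (Nat.le_add_right _ _).trans (blockStart_succ j).ge

lemma mul_blockStart (j : ℕ) : 35 * blockStart j + 1 = 36 ^ j := by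
  induction j with
  | zero => simp [blockStart]
  | succ j ih => rw [blockStart_succ, pow_succ]; omega

lemma mem_block {N j : ℕ} {k : Fin N} :
    k ∈ block N j ↔ blockStart j ≤ k ∧ (k : ℕ) < blockStart (j + 1) := by
  simp [block]

lemma card_block_le (N j : ℕ) : (block N j).card ≤ 36 ^ j := by
  have h : (block N j).map Fin.valEmbedding ⊆ Finset.Ico (blockStart j) (blockStart (j + 1)) := by
    intro n hn
    obtain ⟨k, hk, rfl⟩ := Finset.mem_map.1 hn
    exact Finset.mem_Ico.2 (mem_block.1 hk)
  have := Finset.card_le_card h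
  rwa [Finset.card_map, Nat.card_Ico, blockStart_succ, Nat.add_sub_cancel_left] at this

lemma card_block {N j : ℕ} (h : blockStart (j + 1) ≤ N) : (block N j).card = 36 ^ j := by
  have h : (block N j).map Fin.valEmbedding = Finset.Ico (blockStart j) (blockStart (j + 1)) := by
    ext n
    simp only [Finset.mem_map, mem_block, Finset.mem_Ico, Fin.valEmbedding_apply]
    constructor
    · rintro ⟨k, hk, rfl⟩
      exact hk
    · exact fun hn => ⟨⟨n, hn.2.trans_le h⟩, hn, rfl⟩
  have := congrArg Finset.card h
  rwa [Finset.card_map, Nat.card_Ico, blockStart_succ, Nat.add_sub_cancel_left] at this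

lemma exists_mem_block {N J : ℕ} {k : Fin N} (hk : (k : ℕ) < blockStart J) :
    ∃ m < J, k ∈ block N m := by
  induction J with
  | zero => simp [blockStart] at hk
  | succ J ih =>
    rcases lt_or_ge (k : ℕ) (blockStart J) with h | h
    · obtain ⟨m, hm, hkm⟩ := ih h
      exact ⟨m, by omega, hkm⟩
    · exact ⟨J, by omega, mem_block.2 ⟨h, hk⟩⟩

lemma le_sum_of_dominant {r : ℕ → ℝ} {A d : ℝ} {m J : ℕ} (hJ : m + 1 ≤ J) (hlt : ∀ j < m, r j = 0)
    (hm : A * (1 - d) * (1 / 36) ^ m ≤ r m) (hgt : ∀ j, m < j → -(A * d * (1 / 36) ^ j) ≤ r j) :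
    A * ((1 - 36 / 35 * d) * (1 / 36) ^ m + 36 / 35 * d * (1 / 36) ^ J) ≤
      ∑ j ∈ Finset.range J, r j := by
  induction J, hJ using Nat.le_induction with
  | base =>
    rw [Finset.sum_range_succ, Finset.sum_eq_zero fun j hj => hlt j (Finset.mem_range.1 hj),
      pow_succ]
    linarith
  | succ J hJ ih =>
    rw [Finset.sum_range_succ, pow_succ]
    have := hgt J hJ
    linarith

/-- A bounded dual polynomial that correlates with every polynomial having the frequencies `lam`
and coefficient arguments those of `a`. -/
lemma exists_dual {N : ℕ} {lam : Fin N → ℝ} (hlam : StrictMono lam) {a : Fin N → ℂ}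
    (ha : ∀ k, 1 ≤ ‖a k‖) {J : ℕ} (hJ : blockStart J ≤ N) :
    ∃ F ∈ trigPoly ⊤, (∀ t, ‖F t‖ ≤ 1) ∧
      J * (12 / 25 : ℝ) ≤ ∑ k, (a k * mean (F * character (lam k))).re := by
  set u : Fin N → ℂ := fun k => star (a k) / ‖a k‖ with hu
  have ha0 : ∀ k, ‖a k‖ ≠ 0 := fun k => by linarith [ha k]
  have hu1 : ∀ k, ‖u k‖ = 1 := fun k => by
    rw [hu, norm_div, norm_star, Complex.norm_real, norm_norm, div_self (ha0 k)]
  have hau : ∀ k, a k * u k = (‖a k‖ : ℂ) := fun k => by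
    have : (‖a k‖ : ℂ) ≠ 0 := by exact_mod_cast ha0 k
    rw [hu, mul_div_assoc', Complex.star_def, Complex.mul_conj, Complex.normSq_eq_norm_sq,
      div_eq_iff this]
    push_cast
    ring
  set c : ℕ → Fin N → ℂ := fun j k => ((1 / 36) ^ j : ℝ) * u k with hc
  have hcnorm : ∀ j k, ‖c j k‖ = (1 / 36) ^ j := fun j k => by
    rw [hc, norm_mul, hu1, mul_one, Complex.norm_real, Real.norm_of_nonneg (by positivity)]
  have hx : Function.Injective fun k => -lam k := fun k l h => hlam.injective (neg_injective h)
  set f : ℕ → ℝ → ℂ := fun j => ∑ k ∈ block N j, c j k • character (-lam k) with hf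
  have hfm : ∀ j, f j ∈ trigPoly ⊤ := fun j => sum_character_mem _ _ _
  have hcard : ∀ j, ((block N j).card : ℝ) ≤ 36 ^ j := fun j => by
    exact_mod_cast card_block_le N j
  have hf1 : ∀ j t, ‖f j t‖ ≤ 1 := by
    intro j t
    have h1 : ‖f j t‖ ≤ ∑ k ∈ block N j, ((1 / 36 : ℝ)) ^ j := by
      simp only [hf, Finset.sum_apply]
      refine norm_sum_le_of_le _ fun k _ => ?_
      rw [Pi.smul_apply, norm_smul, hcnorm, norm_character, mul_one]
    rw [Finset.sum_const, nsmul_eq_mul] at h1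
    calc ‖f j t‖ ≤ (block N j).card * (1 / 36 : ℝ) ^ j := h1
      _ ≤ 36 ^ j * (1 / 36 : ℝ) ^ j := by gcongr; exact hcard j
      _ = 1 := by rw [← mul_pow]; norm_num
  have hfsq : ∀ j, meanSq (f j) ≤ (1 / 36) ^ j := by
    intro j
    rw [hf, meanSq_sum _ hx]
    simp_rw [hcnorm]
    rw [Finset.sum_const, nsmul_eq_mul]
    calc (block N j).card * ((1 / 36 : ℝ) ^ j) ^ 2 ≤ 36 ^ j * ((1 / 36 : ℝ) ^ j) ^ 2 := by
          gcongr; exact hcard j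
      _ = (1 / 36) ^ j := by rw [sq, ← mul_assoc, ← mul_pow]; norm_num
  have h36 : ∀ j : ℕ, ((1 / 36 : ℝ)) ^ j = ((1 / 6) ^ j) ^ 2 := fun j => by
    rw [← pow_mul, mul_comm, pow_mul]; norm_num
  have hfsqrt : ∀ j, √(meanSq (f j)) ≤ (1 / 6) ^ j := fun j => by
    rw [Real.sqrt_le_left (by positivity), ← h36]
    exact hfsq j
  choose G hG hGnorm hGsq using fun j => exists_multiplier (hfm j) (hf1 j)
    (show (0 : ℝ) < 4 / 100 * (1 / 36) ^ j by positivity)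
  have hG1 : ∀ i t, ‖G i t‖ ≤ 1 := fun i t => by linarith [hGnorm i t, norm_nonneg (f i t)]
  have hGκ : ∀ i, √(meanSq (G i - 1)) ≤ 27 / 20 * (1 / 6) ^ i := fun i => by
    rw [Real.sqrt_le_left (by positivity), mul_pow, ← h36]
    have h1 := hGsq i
    have h2 := hfsq i
    have h3 : (0 : ℝ) < (1 / 36) ^ i := by positivity
    linarith
  set P : ℕ → ℝ → ℂ := fun j => ∏ i ∈ Finset.Ico (j + 1) J, G i with hPdef
  have hP : ∀ j, P j ∈ trigPoly (AddSubmonoid.nonneg ℝ) := fun j =>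
    Subalgebra.prod_mem _ fun i _ => hG i
  have hPtail : ∀ j < J, √(meanSq (P j - 1)) ≤ 27 / 100 * (1 / 6) ^ j := fun j hj => by
    have h1 := sqrt_meanSq_tail_le hG hG1 hGκ hj
    have h2 : (0 : ℝ) < (1 / 6) ^ J := by positivity
    linarith
  have hfP : ∀ j, f j * P j ∈ trigPoly ⊤ := fun j => Subalgebra.mul_mem _ (hfm j) (mem_top (hP j))
  have hterm := fun j => Subalgebra.smul_mem _ (hfP j) ((2 / 3 : ℝ) : ℂ)
  refine ⟨∑ j ∈ Finset.range J, ((2 / 3 : ℝ) : ℂ) • (f j * P j),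
    Subalgebra.sum_mem _ fun j _ => hterm j, fun t => norm_riesz_sum_le (by norm_num) hGnorm J t, ?_⟩
  have hzero : ∀ (k : Fin N) (j : ℕ), blockStart (j + 1) ≤ k →
      mean (f j * P j * character (lam k)) = 0 := by
    intro k j hkj
    refine mean_mul_character_eq_zero _ _ _ (hP j) fun l hl => ?_
    have : l < k := Fin.lt_def.2 ((mem_block.1 hl).2.trans_le hkj)
    linarith [hlam this]
  have hnear : ∀ (k : Fin N), ∀ j < J,
      ‖mean (f j * P j * character (lam k)) - if k ∈ block N j then c j k else 0‖ ≤
        27 / 100 * (1 / 36) ^ j := by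
    intro k j hj
    have h1 := norm_mean_mul_character_sub_le (block N j) _ (c j) hx (mem_top (hP j)) k
    rw [neg_neg] at h1
    refine h1.trans ((mul_le_mul (hfsqrt j) (hPtail j hj) (Real.sqrt_nonneg _)
      (by positivity)).trans (le_of_eq ?_))
    rw [h36]
    ring
  have hre : ∀ (k : Fin N) (μ v : ℂ) (B : ℝ), ‖μ - v‖ ≤ B →
      (a k * v).re - ‖a k‖ * B ≤ (a k * μ).re := by
    intro k μ v B h
    have h1 : ‖a k * v - a k * μ‖ ≤ ‖a k‖ * B := by
      rw [← mul_sub, norm_mul, norm_sub_rev]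
      gcongr
    have h2 := (Complex.re_le_norm _).trans h1
    rw [Complex.sub_re] at h2
    linarith
  have hcoeff : ∀ k, (a k * mean ((∑ j ∈ Finset.range J, ((2 / 3 : ℝ) : ℂ) • (f j * P j)) *
      character (lam k))).re =
      2 / 3 * ∑ j ∈ Finset.range J, (a k * mean (f j * P j * character (lam k))).re := by
    intro k
    have hm : ∀ j, f j * P j * character (lam k) ∈ trigPoly ⊤ := fun j =>
      Subalgebra.mul_mem _ (hfP j) (character_mem (AddSubmonoid.mem_top _))
    simp_rw [Finset.sum_mul, smul_mul_assoc]
    rw [mean_sum _ fun j _ => Subalgebra.smul_mem _ (hm j) _, Finset.mul_sum, Complex.re_sum,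
      Finset.mul_sum]
    refine Finset.sum_congr rfl fun j _ => ?_
    rw [mean_smul _ (hm j), mul_left_comm, Complex.re_ofReal_mul]
  have hlower : ∀ k : Fin N, ∑ j ∈ Finset.range J,
      (if k ∈ block N j then 12 / 25 * (1 / 36 : ℝ) ^ j else 0) ≤
      2 / 3 * ∑ j ∈ Finset.range J, (a k * mean (f j * P j * character (lam k))).re := by
    intro k
    rcases lt_or_ge (k : ℕ) (blockStart J) with hk | hk
    · obtain ⟨m, hm, hkm⟩ := exists_mem_block hk
      have hkm' := mem_block.1 hkm
      have hlt : ∀ j < m, blockStart (j + 1) ≤ k := fun j hj => (blockStart_mono hj).trans hkm'.1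
      have hnot : ∀ j, j ≠ m → k ∉ block N j := by
        intro j hj hkj
        have hkj' := mem_block.1 hkj
        rcases lt_or_gt_of_ne hj with h | h
        · exact absurd (hlt j h) (by omega)
        · exact absurd (blockStart_mono (show m + 1 ≤ j from h)) (by omega)
      rw [Finset.sum_eq_single m (fun j _ hj => if_neg (hnot j hj))
        (fun h => absurd (Finset.mem_range.2 hm) h), if_pos hkm]
      set r : ℕ → ℝ := fun j =>
        if j < J then (a k * mean (f j * P j * character (lam k))).re else 0 with hr
      have hsum : ∑ j ∈ Finset.range J, (a k * mean (f j * P j * character (lam k))).re =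
          ∑ j ∈ Finset.range J, r j :=
        Finset.sum_congr rfl fun j hj => by rw [hr]; simp [Finset.mem_range.1 hj]
      have hdom := le_sum_of_dominant (r := r) (A := ‖a k‖) (d := 27 / 100) (m := m) (J := J) hm
        (fun j hj => by simp [hr, hzero k j (hlt j hj)])
        (by
          have h1 := hre k _ _ _ (hnear k m hm)
          rw [if_pos hkm, hc, mul_left_comm, hau, ← Complex.ofReal_mul, Complex.ofReal_re] at h1
          simp only [hr, if_pos hm]
          linarith)
        (fun j hj => by
          by_cases hjJ : j < J
          · have h1 := hre k _ _ _ (hnear k j hjJ)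
            rw [if_neg (hnot j (by omega)), mul_zero, Complex.zero_re] at h1
            simp only [hr, if_pos hjJ]
            linarith
          · simp only [hr, if_neg hjJ]
            rw [neg_nonpos]
            positivity)
      rw [hsum]
      have h1 : (0 : ℝ) < (1 / 36) ^ J := by positivity
      have h2 : (0 : ℝ) < (1 / 36) ^ m := by positivity
      have h3 := mul_le_mul_of_nonneg_right (ha k)
        (show (0 : ℝ) ≤ (1 - 36 / 35 * (27 / 100)) * (1 / 36) ^ m +
          36 / 35 * (27 / 100) * (1 / 36) ^ J by norm_num at h1 h2 ⊢; positivity)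
      linarith
    · have hle : ∀ j < J, blockStart (j + 1) ≤ k := fun j hj => (blockStart_mono hj).trans hk
      rw [Finset.sum_eq_zero, Finset.sum_eq_zero, mul_zero]
      · intro j hj
        rw [hzero k j (hle j (Finset.mem_range.1 hj)), mul_zero, Complex.zero_re]
      · intro j hj
        refine if_neg fun hkj => ?_
        have h1 := (mem_block.1 hkj).2
        have h2 := hle j (Finset.mem_range.1 hj)
        omega
  simp_rw [hcoeff]
  refine le_trans (le_of_eq ?_) (Finset.sum_le_sum fun k _ => hlower k)
  rw [Finset.sum_comm]
  have hblock : ∀ j ∈ Finset.range J,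
      ∑ k, (if k ∈ block N j then 12 / 25 * (1 / 36 : ℝ) ^ j else 0) = 12 / 25 := by
    intro j hj
    rw [Finset.sum_ite_mem, Finset.univ_inter, Finset.sum_const,
      card_block ((blockStart_mono (Finset.mem_range.1 hj)).trans hJ), nsmul_eq_mul]
    push_cast
    rw [mul_left_comm, ← mul_pow]
    norm_num
  rw [Finset.sum_congr rfl hblock, Finset.sum_const, Finset.card_range, nsmul_eq_mul]

lemma log_36_lt : Real.log 36 < 18 / 5 := by
  have h : (36 : ℝ) ^ 5 < Real.exp 18 := by
    have h1 : (2.7182818283 : ℝ) ^ 18 < Real.exp 1 ^ 18 := by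
      gcongr
      exact Real.exp_one_gt_d9
    rw [← Real.exp_nat_mul] at h1
    norm_num at h1 ⊢
    linarith
  have h2 := (Real.log_lt_iff_lt_exp (by positivity)).2 h
  rw [Real.log_pow] at h2
  norm_num at h2
  linarith

lemma four_div_pi_cube_lt : 4 / Real.pi ^ 3 < 1293 / 10000 := by
  have h : (3.14 : ℝ) ^ 3 < Real.pi ^ 3 := by
    gcongr
    exact Real.pi_gt_d2
  rw [div_lt_iff₀ (by positivity)]
  norm_num at h
  linarith

end Besikovitch

open Besikovitch in
/-- Main theorem (ii): logarithmic lower bound on the Besikovitch L¹ norm when all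
coefficients have modulus at least 1. -/
theorem besikovitch_log_lower_bound (N : ℕ) (lam : Fin N → ℝ) (hlam : StrictMono lam)
    (a : Fin N → ℂ) (ha : ∀ k, 1 ≤ ‖a k‖) :
    ∃ L : ℝ,
      Tendsto (fun T : ℝ => (1 / T) *
          ∫ t in (-(T/2))..(T/2),
            ‖∑ k : Fin N, a k * Complex.exp (((2 * Real.pi * lam k * t : ℝ) : ℂ) * Complex.I)‖)
        atTop (nhds L) ∧
      (4 / Real.pi ^ 3) * Real.log N ≤ L := by
  set g : ℝ → ℂ := ∑ k, a k • character (lam k) with hg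
  have hgm : g ∈ trigPoly ⊤ := sum_character_mem _ _ _
  have hgt : ∀ t, ∑ k : Fin N, a k * Complex.exp (((2 * Real.pi * lam k * t : ℝ) : ℂ) * Complex.I) =
      g t := fun t => by
    rw [hg, Finset.sum_apply]
    rfl
  obtain ⟨L, hL⟩ := exists_tendsto_average_norm hgm
  refine ⟨L, ?_, ?_⟩
  · simp_rw [hgt]
    exact hL
  set J := Nat.log 36 (35 * N + 1) with hJdef
  have hJle : 36 ^ J ≤ 35 * N + 1 := Nat.pow_log_le_self 36 (by omega)
  have hJlt : 35 * N + 1 < 36 ^ (J + 1) := Nat.lt_pow_succ_log_self (by norm_num) _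
  have hJN : blockStart J ≤ N := by have := mul_blockStart J; omega
  obtain ⟨F, hF, hF1, hFsum⟩ := exists_dual hlam ha hJN
  have hmean : mean (F * g) = ∑ k, a k * mean (F * character (lam k)) := by
    have hm : ∀ k, F * character (lam k) ∈ trigPoly ⊤ := fun k =>
      Subalgebra.mul_mem _ hF (character_mem (AddSubmonoid.mem_top _))
    rw [hg, Finset.mul_sum]
    simp_rw [mul_smul_comm]
    rw [mean_sum _ fun k _ => Subalgebra.smul_mem _ (hm k) _]
    exact Finset.sum_congr rfl fun k _ => mean_smul _ (hm k)
  have hnorm : ‖mean (F * g)‖ ≤ L := by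
    refine le_of_tendsto_of_tendsto (tendsto_mean (Subalgebra.mul_mem _ hF hgm)).norm hL ?_
    filter_upwards [eventually_gt_atTop 0] with T hT
    refine norm_average_le (continuous_of_mem hgm).norm (fun t => ?_) hT
    rw [Pi.mul_apply, norm_mul]
    exact mul_le_of_le_one_left (norm_nonneg _) (hF1 t)
  have hJL : J * (12 / 25 : ℝ) ≤ L := by
    refine hFsum.trans (le_trans ?_ hnorm)
    rw [← Complex.re_sum, ← hmean]
    exact Complex.re_le_norm _
  refine le_trans ?_ hJL
  rcases Nat.eq_zero_or_pos N with hN | hN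
  · rw [hN, Nat.cast_zero, Real.log_zero, mul_zero]
    positivity
  have hN' : (0 : ℝ) < N := by exact_mod_cast hN
  have hJ1 : 1 ≤ J := by
    by_contra h
    have : J = 0 := by omega
    rw [this] at hJlt
    omega
  have hJ1' : (1 : ℝ) ≤ J := by exact_mod_cast hJ1
  have hlog : Real.log N ≤ J * Real.log 36 + 1 / 35 := by
    have h1 : (N : ℝ) ≤ 36 ^ J * (36 / 35) := by
      have : 35 * (N : ℝ) + 1 ≤ 36 ^ (J + 1) := by exact_mod_cast hJlt.le
      rw [pow_succ] at this
      linarith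
    have h2 := Real.log_le_log hN' h1
    rw [Real.log_mul (by positivity) (by norm_num), Real.log_pow] at h2
    have h3 := Real.log_le_sub_one_of_pos (show (0 : ℝ) < 36 / 35 by norm_num)
    norm_num at h3 h2 ⊢
    linarith
  have hlog' : Real.log N ≤ J * (18 / 5) + 1 / 35 := by
    have := mul_le_mul_of_nonneg_left log_36_lt.le (show (0 : ℝ) ≤ J by positivity)
    linarith
  have hlog0 : 0 ≤ Real.log N := Real.log_nonneg (by exact_mod_cast hN)
  calc 4 / Real.pi ^ 3 * Real.log N ≤ 1293 / 10000 * (J * (18 / 5) + 1 / 35) :=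
        mul_le_mul four_div_pi_cube_lt.le hlog' hlog0 (by norm_num)
    _ ≤ J * (12 / 25) := by linarith
end
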